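/- Let (u_p)_{p>1} be a family of least energy nodal solutions of (P_p) with concentration points x⁺, x⁻ ∈ Ω, x⁺ ≠ x⁻. Then (x⁺, x⁻) is a minimum point of Ψ, i.e. Ψ(x⁺, x⁻) = min_{(x,y) ∈ M} Ψ(x,y). -/

import Mathlib

open Real MeasureTheory Metric Filter Topology Bornology

noncomputable section

abbrev E2 : Type := EuclideanSpace ℝ (Fin 2)

/-- Laplacian of `u : ℝ² → ℝ` via coordinate second derivatives. -/
def lap (u : E2 → ℝ) (x : E2) : ℝ :=
  ∑ i : Fin 2,
    fderiv ℝ (fun y => fderiv ℝ u y (EuclideanSpace.single i 1)) x (EuclideanSpace.single i 1)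

/-- `u` is a (classical) solution of the Lane–Emden problem `(P_p)` on `Ω`. -/
def IsSolution (Ω : Set E2) (p : ℝ) (u : E2 → ℝ) : Prop :=
  ContDiffOn ℝ 2 u Ω ∧ ContinuousOn u (closure Ω) ∧
    (∀ x ∈ Ω, -lap u x = |u x| ^ (p - 1) * u x) ∧
    (∀ x ∈ frontier Ω, u x = 0)

/-- `u` is a nodal (sign-changing) function on `Ω`. -/
def IsNodal (Ω : Set E2) (u : E2 → ℝ) : Prop :=
  (∃ x ∈ Ω, 0 < u x) ∧ (∃ x ∈ Ω, u x < 0)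

/-- The Green function of `-Δ` on `Ω` with Dirichlet boundary conditions, together with
its regular part `H`, so that `G(x,y) = -(1/2π) log|x-y| + H(x,y)`. -/
structure GreenData (Ω : Set E2) where
  G : E2 → E2 → ℝ
  H : E2 → E2 → ℝ
  decomp : ∀ x y, G x y = -(1 / (2 * π)) * Real.log ‖x - y‖ + H x y
  bdry : ∀ x ∈ Ω, ∀ y ∈ frontier Ω, G x y = 0
  symm : ∀ x y, G x y = G y x
  smoothH : ContDiffOn ℝ (⊤ : ℕ∞) (fun q : E2 × E2 => H q.1 q.2) (Ω ×ˢ Ω)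
  contH : ∀ x ∈ Ω, ContinuousOn (H x) (closure Ω)
  harmH : ∀ x ∈ Ω, ∀ y ∈ Ω, lap (H x) y = 0

/-- The Kirchhoff–Routh type function `Ψ(a₁,a₂) = 2G(a₁,a₂) − R(a₁) − R(a₂)`. -/
def KR {Ω : Set E2} (gd : GreenData Ω) (q : E2 × E2) : ℝ :=
  2 * gd.G q.1 q.2 - gd.H q.1 q.1 - gd.H q.2 q.2

/-- `q` is a non-degenerate critical point of `F`. -/
def NondegCrit (F : E2 × E2 → ℝ) (q : E2 × E2) : Prop :=
  fderiv ℝ F q = 0 ∧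
    ∀ v : E2 × E2, (∀ w : E2 × E2, fderiv ℝ (fun r => fderiv ℝ F r) q v w = 0) → v = 0

/-- Convergence in `C²_loc(S)`: uniform convergence of all derivatives of order `≤ 2`
on compact subsets of `S`. -/
def TendstoC2LocOn (S : Set E2) (F : ℕ → E2 → ℝ) (g : E2 → ℝ) : Prop :=
  ∀ K : Set E2, K ⊆ S → IsCompact K → ∀ k : ℕ, k ≤ 2 →
    TendstoUniformlyOn (fun n x => iteratedFDeriv ℝ k (F n) x)
      (fun x => iteratedFDeriv ℝ k g x) atTop K

/-- `‖u⁺‖_∞` on `closure Ω`. -/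
def supPos (Ω : Set E2) (u : E2 → ℝ) : ℝ := sSup ((fun x => max (u x) 0) '' closure Ω)

/-- `‖u⁻‖_∞` on `closure Ω`. -/
def supNeg (Ω : Set E2) (u : E2 → ℝ) : ℝ := sSup ((fun x => max (-u x) 0) '' closure Ω)

/-- The energy functional `J_p`. -/
def energy (Ω : Set E2) (p : ℝ) (u : E2 → ℝ) : ℝ :=
  (1 / 2) * (∫ x in Ω, ‖fderiv ℝ u x‖ ^ 2) - (1 / (p + 1)) * ∫ x in Ω, |u x| ^ (p + 1)

/-- The standard bubble `U(z) = −2 log(1 + |z|²/8)`. -/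
def Ustd (z : E2) : ℝ := -2 * Real.log (1 + ‖z‖ ^ 2 / 8)

/-- Unit vector at angle `θ`. -/
def circDir (θ : ℝ) : E2 :=
  EuclideanSpace.single 0 (Real.cos θ) + EuclideanSpace.single 1 (Real.sin θ)

/-- Surface integral over the circle `∂B_r(c)`; the integrand may depend on the
outer unit normal (first argument) and on the point (second argument). -/
def surfInt (c : E2) (r : ℝ) (F : E2 → E2 → ℝ) : ℝ :=
  ∫ θ in (0:ℝ)..(2 * π), r * F (circDir θ) (c + r • circDir θ)

/-- Inner product of gradients `⟨∇f, ∇g⟩`. -/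
def gradInner (f g : E2 → ℝ) (x : E2) : ℝ :=
  ∑ j : Fin 2, fderiv ℝ f x (EuclideanSpace.single j 1) *
    fderiv ℝ g x (EuclideanSpace.single j 1)

/-- The quadratic form `P_i` (centred at `c`, radius `r`). -/
def Pform (c : E2) (r : ℝ) (f g : E2 → ℝ) : ℝ :=
  -2 * r * surfInt c r (fun ν x => fderiv ℝ f x ν * fderiv ℝ g x ν) +
    r * surfInt c r (fun _ x => gradInner f g x)

/-- The quadratic form `Q_{ij}` (centred at `c`, radius `r`). -/
def Qform (c : E2) (r : ℝ) (j : Fin 2) (f g : E2 → ℝ) : ℝ :=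
  surfInt c r (fun ν x =>
    -(fderiv ℝ f x (EuclideanSpace.single j 1)) * fderiv ℝ g x ν -
      fderiv ℝ f x ν * fderiv ℝ g x (EuclideanSpace.single j 1) +
      gradInner f g x * ν j)


section

def ee (i : Fin 2) : E2 := EuclideanSpace.single i (1:ℝ)

lemma lap_def (u : E2 → ℝ) (x : E2) :
    lap u x = ∑ i : Fin 2, fderiv ℝ (fun y => fderiv ℝ u y (ee i)) x (ee i) := rfl

lemma lap_congr {f g : E2 → ℝ} {x : E2} (h : f =ᶠ[𝓝 x] g) : lap f x = lap g x := by
  unfold lap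
  refine Finset.sum_congr rfl fun i _ => ?_
  have h2 : (fun y => fderiv ℝ f y (EuclideanSpace.single i 1)) =ᶠ[𝓝 x]
      (fun y => fderiv ℝ g y (EuclideanSpace.single i 1)) := by
    filter_upwards [h.fderiv (𝕜 := ℝ)] with y hy
    rw [hy]
  rw [h2.fderiv_eq]

lemma diffAt_pd {f : E2 → ℝ} {x : E2} (hf : ContDiffAt ℝ 2 f x) (v : E2) :
    DifferentiableAt ℝ (fun y => fderiv ℝ f y v) x := by
  have h1 : ContDiffAt ℝ 1 (fderiv ℝ f) x :=
    hf.fderiv_right (by norm_num)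
  exact (h1.differentiableAt (by norm_num)).clm_apply (differentiableAt_const v)

lemma ev_diff {f : E2 → ℝ} {x : E2} (hf : ContDiffAt ℝ 2 f x) :
    ∀ᶠ y in 𝓝 x, DifferentiableAt ℝ f y := by
  filter_upwards [hf.eventually (by simp)] with y hy
  exact hy.differentiableAt (by norm_num)

lemma lap_add {f g : E2 → ℝ} {x : E2} (hf : ContDiffAt ℝ 2 f x) (hg : ContDiffAt ℝ 2 g x) :
    lap (fun y => f y + g y) x = lap f x + lap g x := by
  simp only [lap_def]
  rw [← Finset.sum_add_distrib]
  refine Finset.sum_congr rfl fun i _ => ?_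
  have h2 : (fun y => fderiv ℝ (fun y => f y + g y) y (ee i)) =ᶠ[𝓝 x]
      (fun y => fderiv ℝ f y (ee i) + fderiv ℝ g y (ee i)) := by
    filter_upwards [ev_diff hf, ev_diff hg] with y h1 h2
    rw [fderiv_fun_add h1 h2]; rfl
  rw [h2.fderiv_eq, fderiv_fun_add (diffAt_pd hf _) (diffAt_pd hg _)]
  rfl

lemma lap_const_mul {f : E2 → ℝ} {x : E2} (hf : ContDiffAt ℝ 2 f x) (c : ℝ) :
    lap (fun y => c * f y) x = c * lap f x := by
  simp only [lap_def]
  rw [Finset.mul_sum]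
  refine Finset.sum_congr rfl fun i _ => ?_
  have h2 : (fun y => fderiv ℝ (fun y => c * f y) y (ee i)) =ᶠ[𝓝 x]
      (fun y => c * fderiv ℝ f y (ee i)) := by
    filter_upwards [ev_diff hf] with y h1
    rw [fderiv_const_mul h1]; rfl
  rw [h2.fderiv_eq, fderiv_const_mul (diffAt_pd hf _)]
  rfl

lemma lap_sub {f g : E2 → ℝ} {x : E2} (hf : ContDiffAt ℝ 2 f x) (hg : ContDiffAt ℝ 2 g x) :
    lap (fun y => f y - g y) x = lap f x - lap g x := by
  have h := lap_add hf (g := fun y => (-1:ℝ) * g y) (contDiffAt_const.mul hg)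
  rw [lap_const_mul hg] at h
  have e : (fun y => f y - g y) = (fun y => f y + (-1) * g y) := by
    funext y; ring
  rw [e, h]; ring

lemma norm_sq_two (z : E2) : ‖z‖ ^ 2 = z 0 ^ 2 + z 1 ^ 2 := by
  rw [EuclideanSpace.norm_sq_eq]; simp [Fin.sum_univ_two]

lemma inner_ee (z : E2) (i : Fin 2) : inner ℝ z (ee i) = z i := by
  simp [ee, EuclideanSpace.inner_single_right]

lemma hasFDerivAt_nsq (x y : E2) :
    HasFDerivAt (fun y : E2 => ‖y - x‖ ^ 2) (2 • (innerSL ℝ (y - x))) y := by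
  have h := (hasStrictFDerivAt_norm_sq (y - x)).hasFDerivAt
  have h2 := h.comp y ((hasFDerivAt_id y).sub_const x)
  refine HasFDerivAt.congr_fderiv (f := fun y : E2 => ‖y - x‖ ^ 2) h2 ?_
  ext v
  simp

/-- regularised logarithm -/
def Lc (c : ℝ) (x y : E2) : ℝ := (1/2) * Real.log (‖y - x‖ ^ 2 + c)

lemma contDiffAt_Lc {c : ℝ} {x y : E2} {n : WithTop ℕ∞} (h : ‖y - x‖ ^ 2 + c ≠ 0) : ContDiffAt ℝ n (Lc c x) y := by
  unfold Lc
  refine contDiffAt_const.mul (ContDiffAt.log ?_ h)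
  exact ((contDiff_id.sub contDiff_const).norm_sq ℝ).contDiffAt.add contDiffAt_const

lemma hasFDerivAt_Lc {c : ℝ} {x y : E2} (h : ‖y - x‖ ^ 2 + c ≠ 0) :
    HasFDerivAt (Lc c x) ((‖y - x‖ ^ 2 + c)⁻¹ • innerSL ℝ (y - x)) y := by
  have h1 := (((hasFDerivAt_nsq x y).add_const c).log h).const_mul (1/2 : ℝ)
  refine h1.congr_fderiv ?_
  ext v
  simp
  ring

lemma lap_Lc {c : ℝ} {x y : E2} (h : ‖y - x‖ ^ 2 + c ≠ 0) :
    lap (Lc c x) y = 2 * c / (‖y - x‖ ^ 2 + c) ^ 2 := by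
  have hev : ∀ᶠ z in 𝓝 y, ‖z - x‖ ^ 2 + c ≠ 0 := by
    have : Continuous (fun z : E2 => ‖z - x‖ ^ 2 + c) := by fun_prop
    exact this.continuousAt.eventually_ne h
  have key : ∀ i, fderiv ℝ (fun z => fderiv ℝ (Lc c x) z (ee i)) y (ee i) =
      (‖y - x‖ ^ 2 + c)⁻¹ - 2 * ((y - x) i) ^ 2 / (‖y - x‖ ^ 2 + c) ^ 2 := by
    intro i
    have e1 : (fun z => fderiv ℝ (Lc c x) z (ee i)) =ᶠ[𝓝 y]
        (fun z => (‖z - x‖ ^ 2 + c)⁻¹ * inner ℝ (z - x) (ee i)) := by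
      filter_upwards [hev] with z hz
      rw [(hasFDerivAt_Lc hz).fderiv]
      rfl
    rw [e1.fderiv_eq]
    have d1 : HasFDerivAt (fun z : E2 => (‖z - x‖ ^ 2 + c)⁻¹) _ y :=
      (hasDerivAt_inv h).comp_hasFDerivAt y ((hasFDerivAt_nsq x y).add_const c)
    have d2 : HasFDerivAt (fun z : E2 => inner ℝ (z - x) (ee i)) (innerSL ℝ (ee i)) y := by
      have : HasFDerivAt (fun z : E2 => innerSL ℝ (ee i) (z - x)) (innerSL ℝ (ee i)) y := by
        have h2 := (innerSL ℝ (ee i)).hasFDerivAt.comp y ((hasFDerivAt_id y).sub_const x)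
        refine HasFDerivAt.congr_fderiv (f := fun z : E2 => innerSL ℝ (ee i) (z - x)) h2 ?_
        ext v
        simp
      refine this.congr_of_eventuallyEq (Eventually.of_forall fun z => ?_)
      simp [real_inner_comm]
    rw [(d1.fun_mul d2).fderiv]
    have hee : ‖ee i‖ = 1 := by simp [ee]
    simp [hee, inner_ee, inner_sub_left]
    field_simp
    ring
  rw [lap_def, Finset.sum_congr rfl (fun i _ => key i), Fin.sum_univ_two]
  have hn := norm_sq_two (y - x)
  field_simp
  rw [hn]; ring

lemma lap_nsq (x : E2) : lap (fun y => ‖y‖ ^ 2) x = 4 := by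
  have key : ∀ i, fderiv ℝ (fun z => fderiv ℝ (fun y : E2 => ‖y‖ ^ 2) z (ee i)) x (ee i) = 2 := by
    intro i
    have e1 : (fun z => fderiv ℝ (fun y : E2 => ‖y‖ ^ 2) z (ee i)) =
        (fun z => 2 * (innerSL ℝ (ee i) z)) := by
      funext z
      have := (hasFDerivAt_nsq 0 z).fderiv
      simp only [sub_zero] at this
      rw [this]
      simp [real_inner_comm]
    rw [e1, fderiv_const_mul (innerSL ℝ (ee i)).differentiableAt]
    have hee : ‖ee i‖ = 1 := by simp [ee]
    rw [ContinuousLinearMap.fderiv]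
    simp [hee]
  rw [lap_def, Finset.sum_congr rfl (fun i _ => key i), Fin.sum_univ_two]; norm_num

lemma lap_nonpos_of_localMax {g : E2 → ℝ} {x : E2} (hg : ContDiffAt ℝ 2 g x)
    (hm : IsLocalMax g x) : lap g x ≤ 0 := by
  rw [lap_def]
  refine Finset.sum_nonpos fun i _ => ?_
  by_contra hpos
  push Not at hpos
  set γ : ℝ → E2 := fun t => x + t • ee i with hγ
  have hγc : Continuous γ := by fun_prop
  have hγ0 : γ 0 = x := by simp [hγ]
  have hγd : ∀ t, HasDerivAt γ (ee i) t := fun t => by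
    have h2 := ((hasDerivAt_id t).smul_const (ee i)).const_add x
    rw [one_smul] at h2
    exact h2
  have ht : Tendsto γ (𝓝 0) (𝓝 x) := by
    have := hγc.tendsto 0; rwa [hγ0] at this
  have hd1 : ∀ᶠ t in 𝓝 (0:ℝ), HasDerivAt (g ∘ γ) (fderiv ℝ g (γ t) (ee i)) t := by
    filter_upwards [ht.eventually (ev_diff hg)] with t h1
    exact h1.hasFDerivAt.comp_hasDerivAt t (hγd t)
  have hd2 : deriv (g ∘ γ) =ᶠ[𝓝 0] fun t => fderiv ℝ g (γ t) (ee i) := by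
    filter_upwards [hd1] with t h1 using h1.deriv
  have hd3 : deriv (deriv (g ∘ γ)) 0 = fderiv ℝ (fun y => fderiv ℝ g y (ee i)) x (ee i) := by
    rw [hd2.deriv_eq]
    have h3 := (diffAt_pd hg (ee i)).hasFDerivAt
    rw [← hγ0] at h3
    have := (h3.comp_hasDerivAt 0 (hγd 0)).deriv
    rw [hγ0] at this
    exact this
  have hmax : IsLocalMax (g ∘ γ) 0 := by
    have : ∀ᶠ t in 𝓝 (0:ℝ), g (γ t) ≤ g x := ht.eventually hm
    filter_upwards [this] with t h1
    simpa [hγ0] using h1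
  have hmin : IsLocalMin (g ∘ γ) 0 := by
    refine isLocalMin_of_deriv_deriv_pos (by rw [hd3]; exact hpos) hmax.deriv_eq_zero ?_
    exact hd1.self_of_nhds.continuousAt
  have hconst : (g ∘ γ) =ᶠ[𝓝 0] fun _ => (g ∘ γ) 0 := by
    filter_upwards [hmax, hmin] with t h1 h2 using le_antisymm h1 h2
  have h0 : deriv (g ∘ γ) =ᶠ[𝓝 0] fun _ => 0 := by
    have := hconst.deriv
    simpa using this
  have := h0.deriv_eq
  rw [hd3] at this
  simp at this
  linarith

lemma max_principle {U : Set E2} (hU : IsOpen U) (hb : IsBounded U) {g : E2 → ℝ} {M : ℝ}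
    (hg : ContDiffOn ℝ 2 g U) (hc : ContinuousOn g (closure U))
    (hl : ∀ x ∈ U, 0 ≤ lap g x) (hM : ∀ x ∈ frontier U, g x ≤ M) : ∀ x ∈ U, g x ≤ M := by
  intro x0 hx0
  by_contra hlt
  push Not at hlt
  obtain ⟨R, hR0, hR⟩ := hb.closure.exists_pos_norm_le
  set ε := (g x0 - M) / (2 * R ^ 2) with hε
  have hεpos : 0 < ε := by
    apply div_pos (by linarith); positivity
  have hcomp : IsCompact (closure U) := hb.isCompact_closure
  have hcont : ContinuousOn (fun x => g x + ε * ‖x‖ ^ 2) (closure U) :=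
    hc.add (by fun_prop)
  obtain ⟨x1, hx1, hmax⟩ := hcomp.exists_isMaxOn ⟨x0, subset_closure hx0⟩ hcont
  have hx1U : x1 ∈ U := by
    by_contra hn
    have hf : x1 ∈ frontier U := by
      rw [hU.frontier_eq]; exact ⟨hx1, hn⟩
    have h1 : g x0 + ε * ‖x0‖ ^ 2 ≤ g x1 + ε * ‖x1‖ ^ 2 := hmax (subset_closure hx0)
    have h2 := hM x1 hf
    have h3 : ‖x1‖ ^ 2 ≤ R ^ 2 := by
      have := hR x1 hx1
      gcongr
    have h4 : ε * R ^ 2 = (g x0 - M) / 2 := by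
      rw [hε]; field_simp
    have h5 : ε * ‖x1‖ ^ 2 ≤ ε * R ^ 2 := by gcongr
    have h6 : 0 ≤ ε * ‖x0‖ ^ 2 := by positivity
    linarith
  have hgx : ContDiffAt ℝ 2 g x1 := hg.contDiffAt (hU.mem_nhds hx1U)
  have hsq : ContDiffAt ℝ 2 (fun x : E2 => ‖x‖ ^ 2) x1 := (contDiff_norm_sq ℝ).contDiffAt
  have hloc : IsLocalMax (fun x => g x + ε * ‖x‖ ^ 2) x1 :=
    hmax.isLocalMax (mem_of_superset (hU.mem_nhds hx1U) subset_closure)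
  have h1 := lap_nonpos_of_localMax (hgx.add (contDiffAt_const.mul hsq)) hloc
  rw [lap_add hgx (contDiffAt_const.mul hsq), lap_const_mul hsq, lap_nsq] at h1
  have := hl x1 hx1U
  linarith

end

section

lemma exists_diam {Ω : Set E2} (hb : IsBounded Ω) :
    ∃ d : ℝ, 1 ≤ d ∧ ∀ x ∈ closure Ω, ∀ y ∈ closure Ω, ‖x - y‖ ≤ d := by
  obtain ⟨R, hR0, hR⟩ := hb.closure.exists_pos_norm_le
  refine ⟨2 * R + 1, by linarith, fun x hx y hy => ?_⟩
  have := norm_sub_le x y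
  have := hR x hx
  have := hR y hy
  linarith

section green
variable {Ω : Set E2}

lemma H_symm (gd : GreenData Ω) (x y : E2) : gd.H x y = gd.H y x := by
  have h1 := gd.decomp x y
  have h2 := gd.decomp y x
  rw [norm_sub_rev y x, gd.symm y x] at h2
  linarith

lemma H_bdry (gd : GreenData Ω) {x y : E2} (hx : x ∈ Ω) (hy : y ∈ frontier Ω) :
    gd.H x y = 1 / (2 * π) * Real.log ‖x - y‖ := by
  have h1 := gd.decomp x y
  rw [gd.bdry x hx y hy] at h1
  linarith

lemma H_contDiffOn (gd : GreenData Ω) {x : E2} (hx : x ∈ Ω) : ContDiffOn ℝ 2 (gd.H x) Ω := by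
  have h : ContDiffOn ℝ 2 (fun q : E2 × E2 => gd.H q.1 q.2) (Ω ×ˢ Ω) :=
    gd.smoothH.of_le (WithTop.coe_le_coe.2 (le_top : (2 : ℕ∞) ≤ ⊤))
  have h2 : ContDiffOn ℝ 2 (fun y : E2 => (x, y)) Ω := contDiffOn_const.prodMk contDiffOn_id
  exact h.comp h2 (fun y hy => ⟨hx, hy⟩)

lemma frontier_dist (hΩ : IsOpen Ω) {x : E2} {δ : ℝ} (hδ : ball x δ ⊆ Ω) {y : E2}
    (hy : y ∈ frontier Ω) : δ ≤ ‖x - y‖ := by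
  by_contra h
  push Not at h
  have : y ∈ ball x δ := by rw [mem_ball, dist_comm, dist_eq_norm]; exact h
  have h2 := hδ this
  rw [hΩ.frontier_eq] at hy
  exact hy.2 h2

lemma frontier_ne (hΩ : IsOpen Ω) {x y : E2} (hx : x ∈ Ω) (hy : y ∈ frontier Ω) : 0 < ‖x - y‖ := by
  rw [norm_pos_iff, sub_ne_zero]
  rintro rfl
  rw [hΩ.frontier_eq] at hy
  exact hy.2 hx

lemma H_upper (hΩ : IsOpen Ω) (hb : IsBounded Ω) (gd : GreenData Ω) {d : ℝ}
    (hd : ∀ x ∈ closure Ω, ∀ y ∈ closure Ω, ‖x - y‖ ≤ d) {x y : E2} (hx : x ∈ Ω) (hy : y ∈ Ω) :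
    gd.H x y ≤ 1 / (2 * π) * Real.log d := by
  refine max_principle hΩ hb (H_contDiffOn gd hx) (gd.contH x hx)
    (fun z hz => (gd.harmH x hx z hz).ge) (fun z hz => ?_) y hy
  rw [H_bdry gd hx hz]
  have := frontier_ne hΩ hx hz
  have h2 := hd x (subset_closure hx) z (frontier_subset_closure hz)
  gcongr

lemma H_lower (hΩ : IsOpen Ω) (hb : IsBounded Ω) (gd : GreenData Ω) {x y : E2} {δ : ℝ}
    (hδ0 : 0 < δ) (hδ : ball x δ ⊆ Ω) (hy : y ∈ Ω) :
    1 / (2 * π) * Real.log δ ≤ gd.H x y := by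
  have hx : x ∈ Ω := hδ (mem_ball_self hδ0)
  have h := max_principle hΩ hb (g := fun y => (-1) * gd.H x y) (M := -(1 / (2 * π) * Real.log δ))
    (contDiffOn_const.mul (H_contDiffOn gd hx)) (continuousOn_const.mul (gd.contH x hx))
    (fun z hz => ?_) (fun z hz => ?_) y hy
  · linarith
  · rw [lap_const_mul ((H_contDiffOn gd hx).contDiffAt (hΩ.mem_nhds hz)), gd.harmH x hx z hz]
    simp
  · rw [H_bdry gd hx hz]
    have h2 : Real.log δ ≤ Real.log ‖x - z‖ := Real.log_le_log hδ0 (frontier_dist hΩ hδ hz)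
    have : 1 / (2 * π) * Real.log δ ≤ 1 / (2 * π) * Real.log ‖x - z‖ := by gcongr
    linarith

lemma G_nonneg (hΩ : IsOpen Ω) (hb : IsBounded Ω) (gd : GreenData Ω) {x y : E2}
    (hx : x ∈ Ω) (hy : y ∈ Ω) (hxy : x ≠ y) : 0 ≤ gd.G x y := by
  obtain ⟨δ, hδ0, hδ⟩ := Metric.isOpen_iff.1 hΩ x hx
  have hnxy : 0 < ‖x - y‖ := norm_pos_iff.2 (sub_ne_zero.2 hxy)
  have key : ∀ ε > 0, 1 / (2 * π) * Real.log ‖x - y‖ - gd.H x y ≤ ε * (1 / (4 * π * δ ^ 2)) := by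
    intro ε hε
    have hne : ∀ z, ‖z - x‖ ^ 2 + ε ≠ 0 := fun z => by positivity
    have h := max_principle hΩ hb (g := fun y => (1 / (2 * π)) * Lc ε x y - gd.H x y)
      (M := ε * (1 / (4 * π * δ ^ 2)))
      (fun z hz => ((contDiffAt_const.mul (contDiffAt_Lc (hne z))).contDiffWithinAt).sub
        (H_contDiffOn gd hx z hz))
      ((continuousOn_const.mul (fun z _ =>
        (contDiffAt_Lc (n := 2) (hne z)).continuousAt.continuousWithinAt)).sub (gd.contH x hx))
      (fun z hz => ?_) (fun z hz => ?_) y hy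
    · refine le_trans ?_ h
      have : Real.log ‖x - y‖ ≤ Lc ε x y := by
        unfold Lc
        have h1 : Real.log (‖x - y‖ ^ 2) ≤ Real.log (‖y - x‖ ^ 2 + ε) := by
          apply Real.log_le_log (by positivity)
          rw [norm_sub_rev]; linarith
        rw [Real.log_pow] at h1
        push_cast at h1
        linarith
      have : 1 / (2 * π) * Real.log ‖x - y‖ ≤ 1 / (2 * π) * Lc ε x y := by gcongr
      linarith
    · rw [lap_sub (contDiffAt_const.mul (contDiffAt_Lc (hne z)))
        ((H_contDiffOn gd hx).contDiffAt (hΩ.mem_nhds hz)), gd.harmH x hx z hz,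
        lap_const_mul (contDiffAt_Lc (hne z)), lap_Lc (hne z)]
      have := Real.pi_pos
      rw [sub_zero]; positivity
    · rw [H_bdry gd hx hz]
      have hzp := frontier_ne hΩ hx hz
      have hzd := frontier_dist hΩ hδ hz
      have h1 : Lc ε x z - Real.log ‖x - z‖ ≤ (1/2) * (ε / δ ^ 2) := by
        unfold Lc
        rw [norm_sub_rev z x]
        have e1 : Real.log (‖x - z‖ ^ 2 + ε) = Real.log (‖x - z‖ ^ 2) + Real.log (1 + ε / ‖x - z‖ ^ 2) := by
          rw [← Real.log_mul (by positivity) (by positivity)]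
          congr 1
          field_simp
        have e2 : Real.log (1 + ε / ‖x - z‖ ^ 2) ≤ ε / ‖x - z‖ ^ 2 := by
          have := Real.log_le_sub_one_of_pos (x := 1 + ε / ‖x - z‖ ^ 2) (by positivity)
          linarith
        have e3 : ε / ‖x - z‖ ^ 2 ≤ ε / δ ^ 2 := by gcongr
        rw [e1, Real.log_pow]
        push_cast
        linarith
      have := Real.pi_pos
      calc 1 / (2 * π) * Lc ε x z - 1 / (2 * π) * Real.log ‖x - z‖
          = 1 / (2 * π) * (Lc ε x z - Real.log ‖x - z‖) := by ring
        _ ≤ 1 / (2 * π) * ((1/2) * (ε / δ ^ 2)) := by gcongr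
        _ = ε * (1 / (4 * π * δ ^ 2)) := by field_simp; ring
  have hlim : 1 / (2 * π) * Real.log ‖x - y‖ - gd.H x y ≤ 0 := by
    have ht : Tendsto (fun ε : ℝ => ε * (1 / (4 * π * δ ^ 2))) (𝓝[>] 0) (𝓝 0) := by
      have : Continuous (fun ε : ℝ => ε * (1 / (4 * π * δ ^ 2))) := by fun_prop
      have h2 := this.tendsto 0
      rw [zero_mul] at h2
      exact h2.mono_left nhdsWithin_le_nhds
    exact ge_of_tendsto ht (by filter_upwards [self_mem_nhdsWithin] with ε hε using key ε hε)
  rw [gd.decomp]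
  linarith

lemma G_upper (hΩ : IsOpen Ω) (hb : IsBounded Ω) (gd : GreenData Ω) {d : ℝ}
    (hd1 : 1 ≤ d) (hd : ∀ x ∈ closure Ω, ∀ y ∈ closure Ω, ‖x - y‖ ≤ d) {x y : E2}
    (hx : x ∈ Ω) (hy : y ∈ Ω) (hxy : x ≠ y) :
    gd.G x y ≤ 1 / (2 * π) * Real.log (d / ‖x - y‖) := by
  have hnxy : 0 < ‖x - y‖ := norm_pos_iff.2 (sub_ne_zero.2 hxy)
  rw [gd.decomp, Real.log_div (by linarith) hnxy.ne']
  have := H_upper hΩ hb gd hd hx hy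
  linarith

open Classical in
/-- The Green kernel extended by zero. -/
def kk (gd : GreenData Ω) (x y : E2) : ℝ := if x ∈ Ω ∧ y ∈ Ω ∧ x ≠ y then gd.G x y else 0

lemma kk_eq (gd : GreenData Ω) {x y : E2} (hx : x ∈ Ω) (hy : y ∈ Ω) (hxy : x ≠ y) :
    kk gd x y = gd.G x y := by
  unfold kk; rw [if_pos ⟨hx, hy, hxy⟩]

lemma kk_zero_left (gd : GreenData Ω) {x y : E2} (hx : x ∉ Ω) : kk gd x y = 0 := by
  unfold kk; rw [if_neg (fun h => hx h.1)]

lemma kk_zero_right (gd : GreenData Ω) {x y : E2} (hy : y ∉ Ω) : kk gd x y = 0 := by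
  unfold kk; rw [if_neg (fun h => hy h.2.1)]

lemma kk_symm (gd : GreenData Ω) (x y : E2) : kk gd x y = kk gd y x := by
  unfold kk
  by_cases h : x ∈ Ω ∧ y ∈ Ω ∧ x ≠ y
  · rw [if_pos h, if_pos ⟨h.2.1, h.1, h.2.2.symm⟩, gd.symm]
  · rw [if_neg h, if_neg (fun h2 => h ⟨h2.2.1, h2.1, h2.2.2.symm⟩)]

lemma kk_nonneg (hΩ : IsOpen Ω) (hb : IsBounded Ω) (gd : GreenData Ω) (x y : E2) :
    0 ≤ kk gd x y := by
  unfold kk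
  split_ifs with h
  · exact G_nonneg hΩ hb gd h.1 h.2.1 h.2.2
  · exact le_rfl

lemma H_contOn (gd : GreenData Ω) : ContinuousOn (fun q : E2 × E2 => gd.H q.1 q.2) (Ω ×ˢ Ω) :=
  gd.smoothH.continuousOn

lemma kk_measurable (hΩ : IsOpen Ω) (gd : GreenData Ω) :
    Measurable (fun q : E2 × E2 => kk gd q.1 q.2) := by
  classical
  set S : Set (E2 × E2) := (Ω ×ˢ Ω) ∩ {q | q.1 ≠ q.2} with hS
  have hSo : IsOpen S := (hΩ.prod hΩ).inter (isOpen_ne_fun continuous_fst continuous_snd)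
  have hc : ContinuousOn (fun q : E2 × E2 => gd.G q.1 q.2) S := by
    have h1 : ContinuousOn (fun q : E2 × E2 => -(1 / (2 * π)) * Real.log ‖q.1 - q.2‖ + gd.H q.1 q.2) S := by
      refine ContinuousOn.add (continuousOn_const.mul (ContinuousOn.log (by fun_prop) ?_))
        ((H_contOn gd).mono Set.inter_subset_left)
      intro q hq
      exact norm_ne_zero_iff.2 (sub_ne_zero.2 hq.2)
    exact h1.congr (fun q _ => gd.decomp q.1 q.2)
  have e : (fun q : E2 × E2 => kk gd q.1 q.2) = S.piecewise (fun q => gd.G q.1 q.2) (fun _ => 0) := by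
    funext q
    unfold kk Set.piecewise
    simp [hS, and_assoc]
  rw [e]
  exact hc.measurable_piecewise continuousOn_const hSo.measurableSet

/-- truncated `1/‖z‖` -/
def invn (R : ℝ) (z : E2) : ℝ := (ball (0:E2) R).indicator (fun z => ‖z‖⁻¹) z

lemma invn_nonneg (R : ℝ) (z : E2) : 0 ≤ invn R z :=
  Set.indicator_nonneg (fun z _ => by positivity) z

lemma invn_integrable (R : ℝ) : Integrable (invn R) := by
  unfold invn
  have h : IntegrableOn (fun z : E2 => ‖z‖⁻¹) (ball (0:E2) R) := by
    rw [integrableOn_fun_norm_addHaar (μ := volume) (f := fun y : ℝ => y⁻¹)]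
    have : IntegrableOn (fun _ : ℝ => (1:ℝ)) (Set.Ioo 0 R) := by
      exact integrableOn_const (by simp) (by simp)
    refine this.congr_fun (fun y hy => ?_) measurableSet_Ioo
    have : y ≠ 0 := hy.1.ne'
    simp [this]
  exact (integrable_indicator_iff measurableSet_ball).2 h

lemma kk_rpow_le (hΩ : IsOpen Ω) (hb : IsBounded Ω) (gd : GreenData Ω) {m : ℝ} (hm : 0 < m) :
    ∃ C : ℝ, ∃ R : ℝ, 0 ≤ C ∧ 0 < R ∧ ∀ x y, kk gd x y ^ m ≤ C * invn R (x - y) := by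
  obtain ⟨d, hd1, hd⟩ := exists_diam hb
  refine ⟨m ^ m * d, d + 1, by positivity, by linarith, fun x y => ?_⟩
  unfold kk
  split_ifs with h
  · obtain ⟨hx, hy, hxy⟩ := h
    have hnxy : 0 < ‖x - y‖ := norm_pos_iff.2 (sub_ne_zero.2 hxy)
    have hle := hd x (subset_closure hx) y (subset_closure hy)
    have h0 := G_nonneg hΩ hb gd hx hy hxy
    have h1 := G_upper hΩ hb gd hd1 hd hx hy hxy
    have hpos : 0 ≤ Real.log (d / ‖x - y‖) := Real.log_nonneg (by rw [le_div_iff₀ hnxy]; linarith)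
    have h2 : Real.log (d / ‖x - y‖) ≤ (d / ‖x - y‖) ^ (1/m) / (1/m) :=
      Real.log_le_rpow_div (by positivity) (by positivity)
    have h3 : gd.G x y ≤ m * (d / ‖x - y‖) ^ (1/m) := by
      have hpi : 1 / (2 * π) ≤ 1 := by
        rw [div_le_one (by positivity)]
        have := Real.pi_gt_three
        linarith
      calc gd.G x y ≤ 1 / (2 * π) * Real.log (d / ‖x - y‖) := h1
        _ ≤ 1 * Real.log (d / ‖x - y‖) := by gcongr
        _ ≤ 1 * ((d / ‖x - y‖) ^ (1/m) / (1/m)) := by gcongr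
        _ = _ := by field_simp
    calc gd.G x y ^ m ≤ (m * (d / ‖x - y‖) ^ (1/m)) ^ m := by gcongr
      _ = m ^ m * (d / ‖x - y‖) := by
        rw [Real.mul_rpow hm.le (by positivity), ← Real.rpow_mul (by positivity)]
        simp [hm.ne']
      _ = m ^ m * d * invn (d + 1) (x - y) := by
        unfold invn
        rw [Set.indicator_of_mem (by simp; linarith)]
        ring
  · rw [Real.zero_rpow hm.ne']
    have := invn_nonneg (d+1) (x - y)
    positivity

lemma invn_comp_integrable (R : ℝ) (x : E2) : Integrable (fun y => invn R (x - y)) :=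
  (invn_integrable R).comp_sub_left x

lemma invn_comp_integral (R : ℝ) (x : E2) : ∫ y, invn R (x - y) = ∫ z, invn R z :=
  integral_sub_left_eq_self _ _ x

lemma kk_meas_right (hΩ : IsOpen Ω) (gd : GreenData Ω) (x : E2) : Measurable (kk gd x) :=
  (kk_measurable hΩ gd).comp measurable_prodMk_left

lemma kk_rpow_int (hΩ : IsOpen Ω) (hb : IsBounded Ω) (gd : GreenData Ω) {m : ℝ} (hm : 0 < m) :
    ∃ M : ℝ, 0 ≤ M ∧ ∀ x, Integrable (fun y => kk gd x y ^ m) ∧ ∫ y, kk gd x y ^ m ≤ M := by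
  obtain ⟨C, R, hC, hR, h⟩ := kk_rpow_le hΩ hb gd hm
  refine ⟨C * ∫ z, invn R z, mul_nonneg hC (integral_nonneg (invn_nonneg R)), fun x => ?_⟩
  have hi : Integrable (fun y => kk gd x y ^ m) := by
    refine ((invn_comp_integrable R x).const_mul C).mono'
      (((kk_meas_right hΩ gd x).pow_const m).aestronglyMeasurable) (Eventually.of_forall fun y => ?_)
    rw [Real.norm_of_nonneg (Real.rpow_nonneg (kk_nonneg hΩ hb gd x y) m)]
    exact h x y
  refine ⟨hi, ?_⟩
  calc ∫ y, kk gd x y ^ m ≤ ∫ y, C * invn R (x - y) :=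
        integral_mono hi ((invn_comp_integrable R x).const_mul C) (h x)
    _ = _ := by rw [integral_const_mul, invn_comp_integral]

end green

end

section

/-- regularised Newtonian kernel -/
def Nw (ε : ℝ) (z : E2) : ℝ := -(1 / (2 * π)) * Lc ε 0 z

/-- its derivative -/
def dN (ε : ℝ) (z : E2) : E2 →L[ℝ] ℝ := (-(1 / (2 * π)) * (‖z‖ ^ 2 + ε)⁻¹) • innerSL ℝ z

lemma Nw_zero_eq (z : E2) : Nw 0 z = -(1 / (2 * π)) * Real.log ‖z‖ := by
  unfold Nw Lc
  simp only [sub_zero, add_zero, Real.log_pow]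
  push_cast; ring

lemma hasFDerivAt_Nw {ε : ℝ} {z : E2} (h : ‖z‖ ^ 2 + ε ≠ 0) : HasFDerivAt (Nw ε) (dN ε z) z := by
  have h1 := (hasFDerivAt_Lc (x := 0) (y := z) (c := ε) (by simpa using h)).const_mul (-(1 / (2 * π)))
  refine h1.congr_fderiv ?_
  simp [dN, smul_smul]

lemma inv2pi_le : 1 / (2 * π) ≤ 1 := by
  rw [div_le_one (by positivity)]
  have := Real.pi_gt_three
  linarith

lemma norm_dN_eq (ε : ℝ) (hε : 0 ≤ ε) (z : E2) : ‖dN ε z‖ = 1 / (2 * π) * ((‖z‖ ^ 2 + ε)⁻¹ * ‖z‖) := by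
  unfold dN
  rw [norm_smul, innerSL_apply_norm, norm_mul, norm_neg, Real.norm_of_nonneg (by positivity),
    Real.norm_of_nonneg (by positivity)]
  ring

lemma norm_dN_le (ε : ℝ) (hε : 0 ≤ ε) (z : E2) : ‖dN ε z‖ ≤ ‖z‖⁻¹ := by
  rw [norm_dN_eq ε hε]
  have h1 : (‖z‖ ^ 2 + ε)⁻¹ * ‖z‖ ≤ ‖z‖⁻¹ := by
    rcases eq_or_ne z 0 with rfl | hz
    · simp
    · have : 0 < ‖z‖ := norm_pos_iff.2 hz
      calc (‖z‖ ^ 2 + ε)⁻¹ * ‖z‖ ≤ (‖z‖ ^ 2)⁻¹ * ‖z‖ := by gcongr; linarith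
        _ = _ := by field_simp
  calc 1 / (2 * π) * ((‖z‖ ^ 2 + ε)⁻¹ * ‖z‖) ≤ 1 * ((‖z‖ ^ 2 + ε)⁻¹ * ‖z‖) := by
        gcongr; exact inv2pi_le
    _ ≤ _ := by linarith

lemma norm_dN_le' (ε : ℝ) (hε : 0 < ε) (z : E2) : ‖dN ε z‖ ≤ 1 + ε⁻¹ := by
  rw [norm_dN_eq ε hε.le]
  have h1 : (‖z‖ ^ 2 + ε)⁻¹ * ‖z‖ ≤ 1 + ε⁻¹ := by
    rw [inv_mul_le_iff₀ (by positivity)]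
    have e : (‖z‖ ^ 2 + ε) * (1 + ε⁻¹) = ‖z‖ ^ 2 + ε + ‖z‖ ^ 2 * ε⁻¹ + 1 := by field_simp; ring
    rw [e]
    have : 0 ≤ ‖z‖ ^ 2 * ε⁻¹ := by positivity
    nlinarith [sq_nonneg (‖z‖ - 1), sq_nonneg ‖z‖]
  calc 1 / (2 * π) * ((‖z‖ ^ 2 + ε)⁻¹ * ‖z‖) ≤ 1 * ((‖z‖ ^ 2 + ε)⁻¹ * ‖z‖) := by
        gcongr; exact inv2pi_le
    _ ≤ _ := by linarith

lemma abs_Nw_le {ε : ℝ} (h0 : 0 ≤ ε) (h1 : ε ≤ 1) {z : E2} (hz : z ≠ 0) : |Nw ε z| ≤ ‖z‖⁻¹ + ‖z‖ ^ 2 := by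
  have hp : 0 < ‖z‖ := norm_pos_iff.2 hz
  have hL : |Lc ε 0 z| ≤ ‖z‖⁻¹ + ‖z‖ ^ 2 := by
    unfold Lc
    rw [sub_zero, abs_le]
    constructor
    · have a1 : Real.log (‖z‖ ^ 2) ≤ Real.log (‖z‖ ^ 2 + ε) := Real.log_le_log (by positivity) (by linarith)
      rw [Real.log_pow] at a1
      push_cast at a1
      have a2 := Real.log_le_sub_one_of_pos (inv_pos.2 hp)
      rw [Real.log_inv] at a2
      have : 0 ≤ ‖z‖ ^ 2 := by positivity
      linarith
    · have a2 := Real.log_le_sub_one_of_pos (x := ‖z‖ ^ 2 + ε) (by positivity)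
      have : 0 ≤ ‖z‖ ^ 2 := by positivity
      have : 0 ≤ ‖z‖⁻¹ := by positivity
      linarith
  unfold Nw
  rw [abs_mul, abs_neg, abs_of_nonneg (show (0:ℝ) ≤ 1 / (2 * π) by positivity)]
  calc 1 / (2 * π) * |Lc ε 0 z| ≤ 1 * |Lc ε 0 z| := by gcongr; exact inv2pi_le
    _ ≤ _ := by linarith

lemma measurable_Nw (ε : ℝ) : Measurable (Nw ε) := by unfold Nw Lc; fun_prop

lemma measurable_dN (ε : ℝ) : Measurable (dN ε) := by
  unfold dN
  have h : Measurable (fun z : E2 => innerSL ℝ z) := (innerSL ℝ (E := E2)).continuous.measurable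
  exact Measurable.smul (f := fun z : E2 => -(1 / (2 * π)) * (‖z‖ ^ 2 + ε)⁻¹) (by fun_prop) h

lemma continuous_dN {ε : ℝ} (hε : 0 < ε) : Continuous (dN ε) := by
  unfold dN
  have hc : Continuous (fun z : E2 => ‖z‖ ^ 2 + ε) := by fun_prop
  refine Continuous.smul (continuous_const.mul (Continuous.inv₀ hc ?_))
    (innerSL ℝ (E := E2)).continuous
  intro z; positivity

/-- Newtonian potential (regularised) -/
def VV (ε : ℝ) (f : E2 → ℝ) (x : E2) : ℝ := ∫ y, Nw ε (x - y) * f y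

def WW (ε : ℝ) (f : E2 → ℝ) (x : E2) : E2 →L[ℝ] ℝ := ∫ y, f y • dN ε (x - y)

/-- bounded measurable function supported in the ball of radius `R` -/
structure BM (f : E2 → ℝ) (F R : ℝ) : Prop where
  meas : Measurable f
  bd : ∀ y, |f y| ≤ F
  supp : ∀ y, y ∉ ball (0:E2) R → f y = 0

lemma BM.integrable {f : E2 → ℝ} {F R : ℝ} (h : BM f F R) : Integrable f := by
  have h1 : Integrable ((ball (0:E2) R).indicator (fun _ => F)) := by
    rw [integrable_indicator_iff measurableSet_ball]
    exact integrableOn_const (by exact measure_ball_lt_top.ne) (by simp)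
  refine h1.mono' h.meas.aestronglyMeasurable (Eventually.of_forall fun y => ?_)
  by_cases hy : y ∈ ball (0:E2) R
  · rw [Set.indicator_of_mem hy]; exact h.bd y
  · rw [Set.indicator_of_notMem hy, h.supp y hy]; simp

lemma BM.F_nonneg {f : E2 → ℝ} {F R : ℝ} (h : BM f F R) : 0 ≤ F := (abs_nonneg _).trans (h.bd 0)

lemma sub_mem_ball {x y : E2} {R : ℝ} (hx : x ∈ ball (0:E2) R) (hy : y ∈ ball (0:E2) R) :
    x - y ∈ ball (0:E2) (2 * R) := by
  simp only [mem_ball_zero_iff] at *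
  have := norm_sub_le x y
  linarith

lemma ae_ne_pt (x : E2) : ∀ᵐ y : E2, x ≠ y := by
  have : ∀ᵐ y : E2, y ∉ ({x} : Set E2) := by
    exact compl_mem_ae_iff.2 (measure_singleton x)
  filter_upwards [this] with y hy h
  exact hy h.symm

/-- common bound for the integrands -/
lemma V_bound {f : E2 → ℝ} {F R : ℝ} (h : BM f F R) {x : E2} (hx : x ∈ ball (0:E2) R) {ε : ℝ}
    (h0 : 0 ≤ ε) (h1 : ε ≤ 1) : ∀ᵐ y : E2, ‖Nw ε (x - y) * f y‖ ≤
      F * (invn (2 * R) (x - y)) + (4 * R ^ 2) * |f y| := by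
  filter_upwards [ae_ne_pt x] with y hy
  by_cases hyb : y ∈ ball (0:E2) R
  · have hm := sub_mem_ball hx hyb
    have a1 := abs_Nw_le h0 h1 (sub_ne_zero.2 hy)
    have a2 : ‖x - y‖ ^ 2 ≤ 4 * R ^ 2 := by
      rw [mem_ball_zero_iff] at hm
      nlinarith [norm_nonneg (x - y)]
    unfold invn
    rw [Set.indicator_of_mem hm, Real.norm_eq_abs, abs_mul]
    have a3 := h.bd y
    have : 0 ≤ ‖x - y‖⁻¹ := by positivity
    calc |Nw ε (x - y)| * |f y| ≤ (‖x - y‖⁻¹ + ‖x - y‖ ^ 2) * |f y| := by gcongr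
      _ = ‖x - y‖⁻¹ * |f y| + ‖x - y‖ ^ 2 * |f y| := by ring
      _ ≤ ‖x - y‖⁻¹ * F + (4 * R ^ 2) * |f y| := by gcongr
      _ = _ := by ring
  · rw [h.supp y hyb]
    have := invn_nonneg (2 * R) (x - y)
    have := h.F_nonneg
    simp
    positivity

lemma V_bound_int {f : E2 → ℝ} {F R : ℝ} (h : BM f F R) (x : E2) :
    Integrable (fun y => F * (invn (2 * R) (x - y)) + (4 * R ^ 2) * |f y|) :=
  ((invn_comp_integrable _ x).const_mul _).add (h.integrable.abs.const_mul _)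

lemma V_int {f : E2 → ℝ} {F R : ℝ} (h : BM f F R) {x : E2} (hx : x ∈ ball (0:E2) R) {ε : ℝ}
    (h0 : 0 ≤ ε) (h1 : ε ≤ 1) : Integrable (fun y => Nw ε (x - y) * f y) :=
  (V_bound_int h x).mono' ((((measurable_Nw ε).comp (by fun_prop : Measurable fun y : E2 => x - y)).mul
    h.meas).aestronglyMeasurable) (V_bound h hx h0 h1)

lemma W_meas {f : E2 → ℝ} (hf : Measurable f) (x : E2) (ε : ℝ) :
    AEStronglyMeasurable (fun y => f y • dN ε (x - y)) volume :=
  hf.aestronglyMeasurable.smul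
    ((measurable_dN ε).comp (by fun_prop : Measurable fun y : E2 => x - y)).aestronglyMeasurable

lemma W_bound {f : E2 → ℝ} {F R : ℝ} (h : BM f F R) {x : E2} (hx : x ∈ ball (0:E2) R) {ε : ℝ}
    (h0 : 0 ≤ ε) (y : E2) : ‖f y • dN ε (x - y)‖ ≤ F * (invn (2 * R) (x - y)) := by
  by_cases hyb : y ∈ ball (0:E2) R
  · have hm := sub_mem_ball hx hyb
    unfold invn
    rw [Set.indicator_of_mem hm, norm_smul]
    exact mul_le_mul (h.bd y) (norm_dN_le ε h0 _) (norm_nonneg _) h.F_nonneg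
  · rw [h.supp y hyb]
    have := invn_nonneg (2 * R) (x - y)
    have := h.F_nonneg
    simp
    positivity

lemma W_int {f : E2 → ℝ} {F R : ℝ} (h : BM f F R) {x : E2} (hx : x ∈ ball (0:E2) R) {ε : ℝ}
    (h0 : 0 ≤ ε) : Integrable (fun y => f y • dN ε (x - y)) :=
  ((invn_comp_integrable (2 * R) x).const_mul F).mono' (W_meas h.meas x ε)
    (Eventually.of_forall (W_bound h hx h0))

lemma hasFDerivAt_V_eps {f : E2 → ℝ} {F R : ℝ} (h : BM f F R) {x : E2} (hx : x ∈ ball (0:E2) R)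
    {ε : ℝ} (h0 : 0 < ε) (h1 : ε ≤ 1) : HasFDerivAt (VV ε f) (WW ε f x) x := by
  unfold VV WW
  refine hasFDerivAt_integral_of_dominated_of_fderiv_le (s := Set.univ)
    (F := fun x y => Nw ε (x - y) * f y) (F' := fun x y => f y • dN ε (x - y))
    (bound := fun y => |f y| * (1 + ε⁻¹)) univ_mem
    (Eventually.of_forall fun x => (((measurable_Nw ε).comp
      (by fun_prop : Measurable fun y : E2 => x - y)).mul h.meas).aestronglyMeasurable)
    (V_int h hx h0.le h1) (W_meas h.meas x ε) ?_ (h.integrable.abs.mul_const _) ?_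
  · refine Eventually.of_forall fun y z _ => ?_
    rw [norm_smul]
    exact mul_le_mul_of_nonneg_left (norm_dN_le' ε h0 _) (abs_nonneg _)
  · refine Eventually.of_forall fun y z _ => ?_
    have h3 : HasFDerivAt (fun z => Nw ε (z - y)) (dN ε (z - y)) z := by
      have := (hasFDerivAt_Nw (ε := ε) (z := z - y) (by positivity)).comp z
        ((hasFDerivAt_id z).sub_const y)
      exact this
    exact h3.mul_const (f y)

lemma continuousOn_W_eps {f : E2 → ℝ} {F R : ℝ} (h : BM f F R) {ε : ℝ} (h0 : 0 < ε) :
    Continuous (WW ε f) := by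
  unfold WW
  refine continuous_of_dominated (fun x => W_meas h.meas x ε) (bound := fun y => |f y| * (1 + ε⁻¹))
    (fun x => Eventually.of_forall fun y => ?_) (h.integrable.abs.mul_const _)
    (Eventually.of_forall fun y => ?_)
  · rw [norm_smul]
    exact mul_le_mul_of_nonneg_left (norm_dN_le' ε h0 _) (abs_nonneg _)
  · exact ((continuous_dN h0).comp (by fun_prop : Continuous fun x : E2 => x - y)).const_smul (f y)

/-- a sequence of regularisation parameters -/
def eps (n : ℕ) : ℝ := (((n:ℝ) + 1) ^ 2)⁻¹

lemma eps_pos (n : ℕ) : 0 < eps n := by unfold eps; positivity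
lemma eps_le (n : ℕ) : eps n ≤ 1 := by
  unfold eps
  apply inv_le_one_of_one_le₀
  have : (0:ℝ) ≤ n := by positivity
  nlinarith
lemma eps_tendsto : Tendsto eps atTop (𝓝 0) := by
  unfold eps
  apply tendsto_inv_atTop_zero.comp
  exact (tendsto_pow_atTop (by norm_num)).comp (tendsto_natCast_atTop_atTop.atTop_add tendsto_const_nhds)

lemma Nw_tendsto {z : E2} (hz : z ≠ 0) : Tendsto (fun n => Nw (eps n) z) atTop (𝓝 (Nw 0 z)) := by
  have : ContinuousAt (fun ε => Nw ε z) 0 := by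
    unfold Nw Lc
    refine continuousAt_const.mul (continuousAt_const.mul (ContinuousAt.log (by fun_prop) ?_))
    simpa using hz
  exact this.tendsto.comp eps_tendsto

lemma dN_tendsto (z : E2) : Tendsto (fun n => dN (eps n) z) atTop (𝓝 (dN 0 z)) := by
  rcases eq_or_ne z 0 with rfl | hz
  · simp [dN]
  have : ContinuousAt (fun ε => dN ε z) 0 := by
    unfold dN
    have hc : ContinuousAt (fun ε : ℝ => ‖z‖ ^ 2 + ε) 0 := by fun_prop
    refine ContinuousAt.smul (continuousAt_const.mul (ContinuousAt.inv₀ hc ?_)) continuousAt_const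
    simpa using hz
  exact this.tendsto.comp eps_tendsto

lemma V_tendsto {f : E2 → ℝ} {F R : ℝ} (h : BM f F R) {x : E2} (hx : x ∈ ball (0:E2) R) :
    Tendsto (fun n => VV (eps n) f x) atTop (𝓝 (VV 0 f x)) := by
  unfold VV
  refine tendsto_integral_of_dominated_convergence _
    (fun n => (V_int h hx (eps_pos n).le (eps_le n)).aestronglyMeasurable) (V_bound_int h x)
    (fun n => V_bound h hx (eps_pos n).le (eps_le n)) ?_
  filter_upwards [ae_ne_pt x] with y hy
  exact (Nw_tendsto (sub_ne_zero.2 hy)).mul_const _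

lemma W_unif {f : E2 → ℝ} {F R : ℝ} (h : BM f F R) :
    TendstoUniformlyOn (fun n => WW (eps n) f) (WW 0 f) atTop (ball (0:E2) R) := by
  set D : ℕ → E2 → ℝ := fun n => (ball (0:E2) (2 * R)).indicator (fun z => ‖dN 0 z - dN (eps n) z‖) with hD
  have hDm : ∀ n, Measurable (D n) := fun n =>
    ((measurable_dN 0).sub (measurable_dN (eps n))).norm.indicator measurableSet_ball
  have hDb : ∀ n z, ‖D n z‖ ≤ 2 * invn (2 * R) z := by
    intro n z
    by_cases hz : z ∈ ball (0:E2) (2 * R)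
    · simp only [hD, invn, Set.indicator_of_mem hz, norm_norm]
      have := norm_sub_le (dN 0 z) (dN (eps n) z)
      have := norm_dN_le 0 le_rfl z
      have := norm_dN_le (eps n) (eps_pos n).le z
      linarith
    · simp [hD, invn, Set.indicator_of_notMem hz]
  have hDi : ∀ n, Integrable (D n) := fun n =>
    ((invn_integrable (2 * R)).const_mul 2).mono' (hDm n).aestronglyMeasurable
      (Eventually.of_forall (hDb n))
  have hD0 : Tendsto (fun n => F * ∫ z, D n z) atTop (𝓝 0) := by
    have : Tendsto (fun n => ∫ z, D n z) atTop (𝓝 (∫ z : E2, (0:ℝ))) := by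
      refine tendsto_integral_of_dominated_convergence _
        (fun n => (hDm n).aestronglyMeasurable) ((invn_integrable (2 * R)).const_mul 2)
        (fun n => Eventually.of_forall (hDb n)) (Eventually.of_forall fun z => ?_)
      by_cases hz : z ∈ ball (0:E2) (2 * R)
      · simp only [hD, Set.indicator_of_mem hz]
        have := ((dN_tendsto z).const_sub (dN 0 z)).norm
        simpa using this
      · simp [hD, Set.indicator_of_notMem hz]
    simpa using this.const_mul F
  rw [Metric.tendstoUniformlyOn_iff]
  intro δ hδ
  filter_upwards [hD0.eventually (gt_mem_nhds hδ)] with n hn x hx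
  refine lt_of_le_of_lt ?_ hn
  rw [dist_eq_norm]
  unfold WW
  rw [← integral_sub (W_int h hx le_rfl) (W_int h hx (eps_pos n).le)]
  have e : F * ∫ z, D n z = ∫ y, F * D n (x - y) := by
    rw [integral_const_mul, integral_sub_left_eq_self (D n) volume x]
  rw [e]
  refine norm_integral_le_of_norm_le (((hDi n).comp_sub_left x).const_mul F)
    (Eventually.of_forall fun y => ?_)
  have e2 : f y • dN 0 (x - y) - f y • dN (eps n) (x - y) = f y • (dN 0 (x - y) - dN (eps n) (x - y)) := by
    ext v
    simp only [sub_apply, smul_apply, smul_eq_mul]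
    ring
  rw [e2, norm_smul]
  by_cases hyb : y ∈ ball (0:E2) R
  · have hm := sub_mem_ball hx hyb
    simp only [hD, Set.indicator_of_mem hm]
    exact mul_le_mul_of_nonneg_right (h.bd y) (norm_nonneg _)
  · rw [h.supp y hyb]
    have : 0 ≤ D n (x - y) := Set.indicator_nonneg (fun z _ => norm_nonneg _) _
    have := h.F_nonneg
    simp
    positivity

lemma hasFDerivAt_V {f : E2 → ℝ} {F R : ℝ} (h : BM f F R) {x : E2} (hx : x ∈ ball (0:E2) R) :
    HasFDerivAt (VV 0 f) (WW 0 f x) x :=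
  hasFDerivAt_of_tendstoUniformlyOn isOpen_ball (W_unif h)
    (fun n _ hx => hasFDerivAt_V_eps h hx (eps_pos n) (eps_le n)) (fun _ hx => V_tendsto h hx) hx

lemma continuousOn_W {f : E2 → ℝ} {F R : ℝ} (h : BM f F R) : ContinuousOn (WW 0 f) (ball (0:E2) R) :=
  (W_unif h).continuousOn (Frequently.of_forall fun n => (continuousOn_W_eps h (eps_pos n)).continuousOn)

lemma contDiffOn_V {f : E2 → ℝ} {F R : ℝ} (h : BM f F R) : ContDiffOn ℝ 1 (VV 0 f) (ball (0:E2) R) := by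
  rw [show (1 : WithTop ℕ∞) = 0 + 1 from rfl, contDiffOn_succ_iff_fderiv_of_isOpen isOpen_ball,
    contDiffOn_zero]
  refine ⟨fun x hx => (hasFDerivAt_V h hx).differentiableAt.differentiableWithinAt, by simp, ?_⟩
  exact (continuousOn_W h).congr fun x hx => (hasFDerivAt_V h hx).fderiv

end

section

lemma BM.mono {f : E2 → ℝ} {F R R' : ℝ} (h : BM f F R) (hR : R ≤ R') : BM f F R' :=
  ⟨h.meas, h.bd, fun y hy => h.supp y (fun h2 => hy (ball_subset_ball hR h2))⟩

lemma exists_BM {f : E2 → ℝ} (hf : Continuous f) (hc : HasCompactSupport f) :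
    ∃ F R, 0 < R ∧ BM f F R := by
  obtain ⟨F, hF⟩ := hc.exists_bound_of_continuous hf
  obtain ⟨R, hR0, hR⟩ := hc.isBounded.exists_pos_norm_lt
  refine ⟨F, R, hR0, hf.measurable, hF, fun y hy => ?_⟩
  by_contra h
  exact hy (mem_ball_zero_iff.2 (hR y (subset_tsupport f h)))

lemma locInt_Nw : LocallyIntegrable (Nw 0) volume := by
  intro x
  refine ⟨ball 0 (‖x‖ + 1), isOpen_ball.mem_nhds (by simp), ?_⟩
  rw [← integrable_indicator_iff measurableSet_ball]
  have hb : Integrable (fun z => invn (‖x‖ + 1) z + (ball (0:E2) (‖x‖ + 1)).indicator (fun _ => (‖x‖ + 1) ^ 2) z) := by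
    refine (invn_integrable _).add ?_
    rw [integrable_indicator_iff measurableSet_ball]
    exact integrableOn_const (by exact measure_ball_lt_top.ne) (by simp)
  refine hb.mono' ((measurable_Nw 0).indicator measurableSet_ball).aestronglyMeasurable ?_
  filter_upwards [ae_ne_pt 0] with z hz
  by_cases hm : z ∈ ball (0:E2) (‖x‖ + 1)
  · simp only [invn, Set.indicator_of_mem hm]
    have h1 := abs_Nw_le le_rfl zero_le_one hz.symm
    have h2 : ‖z‖ ^ 2 ≤ (‖x‖ + 1) ^ 2 := by
      have := (mem_ball_zero_iff.1 hm).le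
      gcongr
    rw [Real.norm_eq_abs]
    linarith
  · simp [invn, Set.indicator_of_notMem hm]

lemma VV_eq_conv (f : E2 → ℝ) :
    VV 0 f = MeasureTheory.convolution (Nw 0) f (ContinuousLinearMap.mul ℝ ℝ) volume := by
  funext x
  unfold VV MeasureTheory.convolution
  rw [← integral_sub_left_eq_self _ volume x]
  simp

lemma fderiv_V_C1 {f : E2 → ℝ} (hf : ContDiff ℝ 1 f) (hc : HasCompactSupport f) (x v : E2) :
    fderiv ℝ (VV 0 f) x v = VV 0 (fun y => fderiv ℝ f y v) x := by
  rw [VV_eq_conv, VV_eq_conv,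
    (hc.hasFDerivAt_convolution_right (ContinuousLinearMap.mul ℝ ℝ) locInt_Nw hf x).fderiv,
    convolution_precompR_apply _ locInt_Nw (hc.fderiv ℝ) (hf.continuous_fderiv (by norm_num))]

lemma contDiff_V_one {f : E2 → ℝ} (hf : Continuous f) (hc : HasCompactSupport f) :
    ContDiff ℝ 1 (VV 0 f) := by
  obtain ⟨F, R, hR, hB⟩ := exists_BM hf hc
  rw [contDiff_iff_contDiffAt]
  intro x
  have h2 := contDiffOn_V (hB.mono (le_max_left R (‖x‖ + 1)))
  exact h2.contDiffAt (isOpen_ball.mem_nhds (by simp))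

lemma pd_compact {f : E2 → ℝ} (hc : HasCompactSupport f) (v : E2) :
    HasCompactSupport (fun y => fderiv ℝ f y v) :=
  hc.fderiv_apply (𝕜 := ℝ) v

lemma pd_cont {f : E2 → ℝ} (hf : ContDiff ℝ 1 f) (v : E2) :
    Continuous (fun y => fderiv ℝ f y v) :=
  (hf.continuous_fderiv (by norm_num)).clm_apply continuous_const

lemma ee_sum (L : E2 →L[ℝ] ℝ) : L = ∑ i, L (ee i) • (innerSL ℝ (ee i)) := by
  ext v
  have hv : v = ∑ i, v i • ee i := by
    ext j
    fin_cases j <;> simp [ee, Fin.sum_univ_two]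
  conv_lhs => rw [hv]
  simp only [Fin.sum_univ_two]
  simp [real_inner_comm, inner_ee]
  ring

lemma contDiffOn_succ_of_pd {n : ℕ} {f : E2 → ℝ} {U : Set E2} (hU : IsOpen U)
    (hd : DifferentiableOn ℝ f U)
    (h : ∀ i, ContDiffOn ℝ n (fun x => fderiv ℝ f x (ee i)) U) : ContDiffOn ℝ (n + 1 : ℕ) f U := by
  have : ((n + 1 : ℕ) : WithTop ℕ∞) = (n : WithTop ℕ∞) + 1 := by push_cast; rfl
  rw [this, contDiffOn_succ_iff_fderiv_of_isOpen hU]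
  refine ⟨hd, by simp, ?_⟩
  have e : (fderiv ℝ f) = fun x => ∑ i, (fderiv ℝ f x (ee i)) • (innerSL ℝ (ee i)) := by
    funext x; exact ee_sum _
  rw [e]
  exact ContDiffOn.sum fun i _ => (h i).smul contDiffOn_const

lemma contDiff_V_two {f : E2 → ℝ} (hf : ContDiff ℝ 1 f) (hc : HasCompactSupport f) :
    ContDiff ℝ 2 (VV 0 f) := by
  rw [← contDiffOn_univ]
  refine contDiffOn_succ_of_pd (n := 1) isOpen_univ
    ((contDiff_V_one hf.continuous hc).differentiable (by norm_num)).differentiableOn fun i => ?_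
  rw [contDiffOn_univ]
  have : (fun x => fderiv ℝ (VV 0 f) x (ee i)) = VV 0 (fun y => fderiv ℝ f y (ee i)) := by
    funext x; exact fderiv_V_C1 hf hc x _
  rw [this]
  exact contDiff_V_one (pd_cont hf _) (pd_compact hc _)

/-- the peak function -/
def peak (z : E2) : ℝ := (1 / π) * ((‖z‖ ^ 2 + 1) ^ 2)⁻¹

lemma peak_integral : ∫ z, peak z = 1 := by
  have h := integral_fun_norm_addHaar (E := E2) (μ := volume)
    (fun y : ℝ => (1 / π) * ((y ^ 2 + 1) ^ 2)⁻¹)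
  have e : ∫ z, peak z = ∫ z : E2, (fun y : ℝ => (1 / π) * ((y ^ 2 + 1) ^ 2)⁻¹) ‖z‖ := rfl
  rw [e, h]
  have hv : (volume : Measure E2).real (ball (0:E2) 1) = π := by
    rw [measureReal_def, EuclideanSpace.volume_ball_fin_two]
    simp [Real.pi_pos.le]
  have hIntg : ∫ y in Set.Ioi (0:ℝ), y * ((1 / π) * ((y ^ 2 + 1) ^ 2)⁻¹) = 0 - (-(1 / (2 * π)) * ((0:ℝ) ^ 2 + 1)⁻¹) := by
    refine integral_Ioi_of_hasDerivAt_of_nonneg' (g := fun y => -(1 / (2 * π)) * (y ^ 2 + 1)⁻¹) ?_ ?_ ?_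
    · intro y _
      have h1 : HasDerivAt (fun y : ℝ => y ^ 2 + 1) (2 * y) y := by
        simpa using (hasDerivAt_pow 2 y).add_const 1
      have h2 := (h1.fun_inv (by positivity)).const_mul (-(1 / (2 * π)))
      refine h2.congr_deriv ?_
      field_simp
    · intro y hy
      have : (0:ℝ) < y := hy
      positivity
    · have h1 : Tendsto (fun y : ℝ => (y ^ 2 + 1)⁻¹) atTop (𝓝 0) :=
        tendsto_inv_atTop_zero.comp
          ((tendsto_pow_atTop (by norm_num)).atTop_add tendsto_const_nhds)
      simpa using h1.const_mul (-(1 / (2 * π)))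
  have hf : Module.finrank ℝ E2 = 2 := by simp
  rw [hf, hv]
  simp only [smul_eq_mul, nsmul_eq_mul, Nat.add_one_sub_one, pow_one]
  have hint2 : ∫ y in Set.Ioi (0:ℝ), y ^ (2 - 1) * ((1 / π) * ((y ^ 2 + 1) ^ 2)⁻¹) = 1 / (2 * π) := by
    simp only [Nat.add_one_sub_one, pow_one]
    rw [hIntg]; simp
  simp only [Nat.add_one_sub_one, pow_one] at hint2
  rw [hint2]
  have := Real.pi_pos
  push_cast
  field_simp

lemma peak_tendsto : Tendsto (fun z : E2 => ‖z‖ ^ Module.finrank ℝ E2 * peak z) (cobounded E2) (𝓝 0) := by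
  have hf : Module.finrank ℝ E2 = 2 := by simp
  rw [hf]
  have h1 : Tendsto (fun z : E2 => (‖z‖ ^ 2 + 1)⁻¹) (cobounded E2) (𝓝 0) :=
    tendsto_inv_atTop_zero.comp
      (((tendsto_pow_atTop (by norm_num)).comp tendsto_norm_cobounded_atTop).atTop_add tendsto_const_nhds)
  have hpi : 1 / π ≤ 1 := by
    rw [div_le_one Real.pi_pos]
    linarith [Real.pi_gt_three]
  refine squeeze_zero (fun z => by unfold peak; positivity) (fun z => ?_) h1
  unfold peak
  calc ‖z‖ ^ 2 * (1 / π * ((‖z‖ ^ 2 + 1) ^ 2)⁻¹)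
      ≤ (‖z‖ ^ 2 + 1) * (1 * ((‖z‖ ^ 2 + 1) ^ 2)⁻¹) := by
        gcongr
        linarith
    _ = _ := by field_simp

lemma W_ibp {f : E2 → ℝ} (hf : ContDiff ℝ 1 f) (hc : HasCompactSupport f) (x : E2) {ε : ℝ} (hε : 0 < ε) :
    ∑ i, WW ε (fun y => fderiv ℝ f y (ee i)) x (ee i) =
      - ∫ y, (1 / π) * (ε / (‖y - x‖ ^ 2 + ε) ^ 2) * f y := by
  have hne : ∀ z, ‖z - x‖ ^ 2 + ε ≠ 0 := fun z => by positivity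
  have hg : ContDiff ℝ 2 (Lc ε x) := contDiff_iff_contDiffAt.2 fun z => contDiffAt_Lc (hne z)
  have hgi : ∀ i, ContDiff ℝ 1 (fun y => fderiv ℝ (Lc ε x) y (ee i)) := fun i =>
    (hg.fderiv_right (m := 1) (by norm_num)).clm_apply contDiff_const
  have hii : ∀ i, Continuous (fun y => fderiv ℝ (fun y => fderiv ℝ (Lc ε x) y (ee i)) y (ee i)) :=
    fun i => pd_cont (hgi i) _
  have key : ∀ i, WW ε (fun y => fderiv ℝ f y (ee i)) x (ee i) =
      -(1 / (2 * π)) * ∫ y, fderiv ℝ (fun y => fderiv ℝ (Lc ε x) y (ee i)) y (ee i) * f y := by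
    intro i
    obtain ⟨F, R, hR, hB⟩ := exists_BM (pd_cont hf (ee i)) (pd_compact hc (ee i))
    have hWi := W_int (hB.mono (le_max_left R (‖x‖ + 1))) (x := x) (by simp) hε.le
    unfold WW
    rw [ContinuousLinearMap.integral_apply hWi]
    have e1 : ∀ y, (fderiv ℝ f y (ee i) • dN ε (x - y)) (ee i) =
        (1 / (2 * π)) * (fderiv ℝ (Lc ε x) y (ee i) * fderiv ℝ f y (ee i)) := by
      intro y
      rw [(hasFDerivAt_Lc (hne y)).fderiv]
      unfold dN
      simp only [smul_apply, smul_eq_mul, innerSL_apply_apply]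
      rw [inner_ee, inner_ee, norm_sub_rev x y]
      simp
      ring
    simp_rw [e1]
    rw [integral_const_mul, integral_mul_fderiv_eq_neg_fderiv_mul_of_integrable]
    · ring
    · exact ((hii i).mul hf.continuous).integrable_of_hasCompactSupport hc.mul_left
    · exact ((hgi i).continuous.mul (pd_cont hf _)).integrable_of_hasCompactSupport
        (pd_compact hc _).mul_left
    · exact ((hgi i).continuous.mul hf.continuous).integrable_of_hasCompactSupport hc.mul_left
    · exact fun y _ => (hgi i).differentiable (by norm_num) y
    · exact fun y _ => hf.differentiable (by norm_num) y
  have hsum : ∀ i ∈ (Finset.univ : Finset (Fin 2)), Integrable (fun y =>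
      fderiv ℝ (fun y => fderiv ℝ (Lc ε x) y (ee i)) y (ee i) * f y) := fun i _ =>
    ((hii i).mul hf.continuous).integrable_of_hasCompactSupport hc.mul_left
  rw [Finset.sum_congr rfl fun i _ => key i, ← Finset.mul_sum,
    ← integral_finsetSum _ hsum, ← integral_const_mul, ← integral_neg]
  congr 1
  funext y
  rw [← Finset.sum_mul, ← lap_def, lap_Lc (hne y)]
  have := Real.pi_pos
  field_simp

lemma lap_V {f : E2 → ℝ} (hf : ContDiff ℝ 1 f) (hc : HasCompactSupport f) (x : E2) :
    lap (VV 0 f) x = - f x := by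
  have h1 : lap (VV 0 f) x = ∑ i, WW 0 (fun y => fderiv ℝ f y (ee i)) x (ee i) := by
    rw [lap_def]
    refine Finset.sum_congr rfl fun i _ => ?_
    have : (fun x => fderiv ℝ (VV 0 f) x (ee i)) = VV 0 (fun y => fderiv ℝ f y (ee i)) := by
      funext x; exact fderiv_V_C1 hf hc x _
    rw [this]
    obtain ⟨F, R, hR, hB⟩ := exists_BM (pd_cont hf (ee i)) (pd_compact hc (ee i))
    rw [(hasFDerivAt_V (hB.mono (le_max_left R (‖x‖ + 1))) (x := x) (by simp)).fderiv]
  have h2 : Tendsto (fun n => ∑ i, WW (eps n) (fun y => fderiv ℝ f y (ee i)) x (ee i)) atTop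
      (𝓝 (lap (VV 0 f) x)) := by
    rw [h1]
    refine tendsto_finsetSum _ fun i _ => ?_
    obtain ⟨F, R, hR, hB⟩ := exists_BM (pd_cont hf (ee i)) (pd_compact hc (ee i))
    have := (W_unif (hB.mono (le_max_left R (‖x‖ + 1)))).tendsto_at (x := x) (by simp)
    exact ((ContinuousLinearMap.apply ℝ ℝ (ee i)).continuous.tendsto _).comp this
  have h3 : Tendsto (fun n => ∑ i, WW (eps n) (fun y => fderiv ℝ f y (ee i)) x (ee i)) atTop
      (𝓝 (- f x)) := by
    have hp := tendsto_integral_comp_smul_smul_of_integrable' (μ := (volume : Measure E2))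
      (φ := peak) (fun z => by unfold peak; positivity)
      peak_integral peak_tendsto (hf.continuous.integrable_of_hasCompactSupport hc)
      (x₀ := x) hf.continuous.continuousAt
    have hn : Tendsto (fun n : ℕ => (n:ℝ) + 1) atTop atTop :=
      tendsto_natCast_atTop_atTop.atTop_add tendsto_const_nhds
    refine ((hp.comp hn).neg).congr fun n => ?_
    rw [W_ibp hf hc x (eps_pos n)]
    simp only [Function.comp]
    congr 2
    funext y
    have hfr : Module.finrank ℝ E2 = 2 := by simp
    rw [hfr]
    unfold peak eps
    rw [norm_smul, smul_eq_mul, norm_sub_rev x y, Real.norm_of_nonneg (by positivity)]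
    have : (0:ℝ) < (n:ℝ) + 1 := by positivity
    congr 1
    field_simp
  exact tendsto_nhds_unique h2 h3

end

section

lemma lap_translate (f : E2 → ℝ) (x y : E2) : lap (fun z => f (z - x)) y = lap f (y - x) := by
  simp only [lap_def]
  refine Finset.sum_congr rfl fun i _ => ?_
  have : (fun z => fderiv ℝ (fun z => f (z - x)) z (ee i)) = fun z => (fun w => fderiv ℝ f w (ee i)) (z - x) := by
    funext z
    rw [fderiv_comp_sub]
  rw [this, fderiv_comp_sub (f := fun w => fderiv ℝ f w (ee i))]

lemma pd_C {n : WithTop ℕ∞} {f : E2 → ℝ} (hf : ContDiff ℝ (n + 1) f) (v : E2) :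
    ContDiff ℝ n (fun y => fderiv ℝ f y v) :=
  (hf.fderiv_right (m := n) le_rfl).clm_apply contDiff_const

lemma cont_lap {f : E2 → ℝ} (hf : ContDiff ℝ 2 f) : Continuous (lap f) := by
  have : lap f = fun x => ∑ i : Fin 2, fderiv ℝ (fun y => fderiv ℝ f y (ee i)) x (ee i) := rfl
  rw [this]
  exact continuous_finsetSum _ fun i _ => pd_cont (pd_C (n := 1) (by simpa [one_add_one_eq_two] using hf) _) _

lemma green_id {φ f : E2 → ℝ} (hφ : ContDiff ℝ 2 φ) (hf : ContDiff ℝ 2 f) (hc : HasCompactSupport f) :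
    ∫ y, φ y * lap f y = ∫ y, lap φ y * f y := by
  have hφ' : ContDiff ℝ (1 + 1) φ := by simpa [one_add_one_eq_two] using hφ
  have hf' : ContDiff ℝ (1 + 1) f := by simpa [one_add_one_eq_two] using hf
  have h1 : ∀ i, ContDiff ℝ 1 (fun y => fderiv ℝ φ y (ee i)) := fun i => pd_C hφ' _
  have h2 : ∀ i, ContDiff ℝ 1 (fun y => fderiv ℝ f y (ee i)) := fun i => pd_C hf' _
  have c2 : ∀ i, HasCompactSupport (fun y => fderiv ℝ f y (ee i)) := fun i => pd_compact hc _
  have c3 : ∀ i, HasCompactSupport (fun y => fderiv ℝ (fun y => fderiv ℝ f y (ee i)) y (ee i)) :=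
    fun i => pd_compact (c2 i) _
  have i1 : ∀ i ∈ (Finset.univ : Finset (Fin 2)), Integrable (fun y => φ y * fderiv ℝ (fun y => fderiv ℝ f y (ee i)) y (ee i)) := fun i _ =>
    (hφ.continuous.mul (pd_cont (h2 i) _)).integrable_of_hasCompactSupport (c3 i).mul_left
  have i2 : ∀ i ∈ (Finset.univ : Finset (Fin 2)), Integrable (fun y => fderiv ℝ (fun y => fderiv ℝ φ y (ee i)) y (ee i) * f y) := fun i _ =>
    ((pd_cont (h1 i) _).mul hf.continuous).integrable_of_hasCompactSupport hc.mul_left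
  have i3 : ∀ i, Integrable (fun y => fderiv ℝ φ y (ee i) * fderiv ℝ f y (ee i)) := fun i =>
    ((h1 i).continuous.mul (h2 i).continuous).integrable_of_hasCompactSupport (c2 i).mul_left
  simp only [lap_def, Finset.mul_sum, Finset.sum_mul]
  rw [integral_finsetSum _ i1, integral_finsetSum _ i2]
  refine Finset.sum_congr rfl fun i _ => ?_
  rw [integral_mul_fderiv_eq_neg_fderiv_mul_of_integrable (i3 i) (i1 i (by simp))
      ((hφ.continuous.mul (h2 i).continuous).integrable_of_hasCompactSupport (c2 i).mul_left)
      (fun y _ => hφ.differentiable (by norm_num) y) (fun y _ => (h2 i).differentiable (by norm_num) y)]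
  rw [integral_mul_fderiv_eq_neg_fderiv_mul_of_integrable (i2 i (by simp)) (i3 i)
      (((h1 i).continuous.mul hf.continuous).integrable_of_hasCompactSupport hc.mul_left)
      (fun y _ => (h1 i).differentiable (by norm_num) y) (fun y _ => hf.differentiable (by norm_num) y)]
  simp

lemma V_lap {f : E2 → ℝ} (hf : ContDiff ℝ 2 f) (hc : HasCompactSupport f) (x : E2) :
    VV 0 (lap f) x = - f x := by
  have hf' : ContDiff ℝ (1 + 1) f := by simpa [one_add_one_eq_two] using hf
  have h2 : ∀ i, ContDiff ℝ 1 (fun y => fderiv ℝ f y (ee i)) := fun i => pd_C hf' _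
  have c2 : ∀ i, HasCompactSupport (fun y => fderiv ℝ f y (ee i)) := fun i => pd_compact hc _
  rw [← lap_V (hf.of_le (by norm_num)) hc, lap_def]
  have h3 : ∀ i, fderiv ℝ (fun y => fderiv ℝ (VV 0 f) y (ee i)) x (ee i) =
      VV 0 (fun y => fderiv ℝ (fun y => fderiv ℝ f y (ee i)) y (ee i)) x := by
    intro i
    have : (fun x => fderiv ℝ (VV 0 f) x (ee i)) = VV 0 (fun y => fderiv ℝ f y (ee i)) := by
      funext x; exact fderiv_V_C1 (hf.of_le (by norm_num)) hc x _
    rw [this, fderiv_V_C1 (h2 i) (c2 i)]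
  rw [Finset.sum_congr rfl fun i _ => h3 i]
  simp only [VV, lap_def, Finset.mul_sum]
  rw [integral_finsetSum]
  intro i _
  obtain ⟨F, R, hR, hB⟩ := exists_BM (pd_cont (h2 i) (ee i)) (pd_compact (c2 i) (ee i))
  exact V_int (hB.mono (le_max_left R (‖x‖ + 1))) (x := x) (by simp) le_rfl zero_le_one

lemma Nw0_smooth {z : E2} (hz : z ≠ 0) : ContDiffAt ℝ (⊤ : ℕ∞) (Nw 0) z := by
  have : Nw 0 = fun z => -(1 / (2 * π)) * Lc 0 0 z := by funext z; rfl
  rw [this]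
  exact contDiffAt_const.mul (contDiffAt_Lc (by simpa using hz))

lemma Nw0_harm {z : E2} (hz : z ≠ 0) : lap (Nw 0) z = 0 := by
  have : Nw 0 = fun z => -(1 / (2 * π)) * Lc 0 0 z := by funext z; rfl
  rw [this, lap_const_mul (contDiffAt_Lc (by simpa using hz)), lap_Lc (by simpa using hz)]
  simp

lemma harm_rep {δ : ℝ} (hδ : 0 < δ) : ∃ η : E2 → ℝ, ContDiff ℝ (⊤ : ℕ∞) η ∧ (∀ z, δ ≤ ‖z‖ → η z = 0) ∧
    ∀ f x, ContDiff ℝ 2 f → HasCompactSupport f → (∀ y ∈ ball x δ, lap f y = 0) →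
      f x = ∫ y, η (x - y) * f y := by
  let χ : ContDiffBump (0:E2) := ⟨δ / 4, δ / 2, by linarith, by linarith⟩
  let E : E2 → ℝ := fun z => (1 - χ z) * Nw 0 z
  have hχ1 : ∀ z : E2, ‖z‖ ≤ δ / 4 → χ z = 1 := fun z hz =>
    χ.one_of_mem_closedBall (by simpa using hz)
  have hχ0 : ∀ z : E2, δ / 2 ≤ ‖z‖ → χ z = 0 := fun z hz =>
    χ.zero_of_le_dist (by simpa using hz)
  have hE : ContDiff ℝ (⊤ : ℕ∞) E := by
    rw [contDiff_iff_contDiffAt]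
    intro z
    by_cases hz : z = 0
    · have : E =ᶠ[𝓝 z] fun _ => 0 := by
        filter_upwards [ball_mem_nhds z (show 0 < δ / 4 by linarith)] with w hw
        simp only [E]
        rw [hχ1 w (by rw [hz] at hw; exact (mem_ball_zero_iff.1 hw).le)]
        simp
      exact contDiffAt_const.congr_of_eventuallyEq this
    · exact (contDiffAt_const.sub χ.contDiff.contDiffAt).mul (Nw0_smooth hz)
  have hE2 : ContDiff ℝ 2 E := hE.of_le (WithTop.coe_le_coe.2 (le_top : (2:ℕ∞) ≤ ⊤))
  have hl : ∀ z : E2, δ ≤ ‖z‖ → lap E z = 0 := by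
    intro z hz
    have hz0 : z ≠ 0 := by rintro rfl; simp at hz; linarith
    rw [← Nw0_harm hz0]
    apply lap_congr
    have : {w : E2 | δ / 2 < ‖w‖} ∈ 𝓝 z :=
      (isOpen_lt continuous_const continuous_norm).mem_nhds (by simp only [Set.mem_ofPred_eq]; linarith)
    filter_upwards [this] with w hw
    simp only [E]
    rw [hχ0 w (le_of_lt hw)]; ring
  refine ⟨fun z => - lap E (-z), ?_, fun z hz => ?_, fun f x hf hc hx => ?_⟩
  · have hs : ContDiff ℝ (⊤ : ℕ∞) (lap E) := by
      have : lap E = fun x => ∑ i : Fin 2, fderiv ℝ (fun y => fderiv ℝ E y (ee i)) x (ee i) := rfl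
      rw [this]
      refine ContDiff.sum fun i _ => pd_C (n := (⊤ : ℕ∞)) (pd_C (n := (⊤ : ℕ∞)) ?_ _) _
      exact hE
    exact (hs.comp contDiff_neg).neg
  · simp only
    rw [hl _ (by simpa using hz)]; simp
  · have hg := green_id (φ := fun y => E (y - x)) (hE2.comp (contDiff_id.sub contDiff_const)) hf hc
    simp_rw [lap_translate] at hg
    have hv := V_lap hf hc x
    have e1 : (fun y => Nw 0 (x - y) * lap f y) = fun y => E (y - x) * lap f y := by
      funext y
      by_cases hy : y ∈ ball x δ
      · rw [hx y hy]; simp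
      · have hN : Nw 0 (x - y) = Nw 0 (y - x) := by
          rw [Nw_zero_eq, Nw_zero_eq, norm_sub_rev]
        have hd : δ ≤ ‖y - x‖ := by
          rw [mem_ball, dist_eq_norm] at hy; exact not_lt.1 hy
        simp only [E]
        rw [hχ0 _ (by linarith), hN]; ring
    unfold VV at hv
    rw [e1, hg] at hv
    simp only [neg_sub, neg_mul]
    rw [integral_neg, hv]; simp

def cv (η k : E2 → ℝ) (x : E2) : ℝ := ∫ y, η (x - y) * k y

lemma cv_eq_conv (η k : E2 → ℝ) :
    cv η k = MeasureTheory.convolution k η (ContinuousLinearMap.mul ℝ ℝ) volume := by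
  funext x
  unfold cv MeasureTheory.convolution
  simp [mul_comm]

lemma fderiv_cv {η k : E2 → ℝ} (hη : ContDiff ℝ 1 η) (hc : HasCompactSupport η) (hk : LocallyIntegrable k)
    (x v : E2) : fderiv ℝ (cv η k) x v = cv (fun y => fderiv ℝ η y v) k x := by
  rw [cv_eq_conv, cv_eq_conv,
    (hc.hasFDerivAt_convolution_right (ContinuousLinearMap.mul ℝ ℝ) hk hη x).fderiv,
    convolution_precompR_apply _ hk (hc.fderiv ℝ) (hη.continuous_fderiv (by norm_num))]

lemma contDiff_cv {η k : E2 → ℝ} {n : ℕ∞} (hη : ContDiff ℝ n η) (hc : HasCompactSupport η) (hk : LocallyIntegrable k) :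
    ContDiff ℝ n (cv η k) := by
  rw [cv_eq_conv]
  exact hc.contDiff_convolution_right _ hk hη

lemma cv_integrable {η k : E2 → ℝ} (hη : Continuous η) (hc : HasCompactSupport η) (hk : LocallyIntegrable k) (x : E2) :
    Integrable (fun y => η (x - y) * k y) := by
  have h := hc.convolutionExists_right (ContinuousLinearMap.mul ℝ ℝ) (μ := volume) hk hη x
  unfold ConvolutionExistsAt at h
  simpa [mul_comm] using h

lemma lap_cv {η k : E2 → ℝ} (hη : ContDiff ℝ 2 η) (hc : HasCompactSupport η) (hk : LocallyIntegrable k) (x : E2) :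
    lap (cv η k) x = cv (lap η) k x := by
  have hη' : ContDiff ℝ (1 + 1) η := by simpa [one_add_one_eq_two] using hη
  have h2 : ∀ i, ContDiff ℝ 1 (fun y => fderiv ℝ η y (ee i)) := fun i => pd_C hη' _
  have c2 : ∀ i, HasCompactSupport (fun y => fderiv ℝ η y (ee i)) := fun i => pd_compact hc _
  rw [lap_def]
  have h3 : ∀ i, fderiv ℝ (fun y => fderiv ℝ (cv η k) y (ee i)) x (ee i) =
      cv (fun y => fderiv ℝ (fun y => fderiv ℝ η y (ee i)) y (ee i)) k x := by
    intro i
    have : (fun x => fderiv ℝ (cv η k) x (ee i)) = cv (fun y => fderiv ℝ η y (ee i)) k := by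
      funext x; exact fderiv_cv (hη.of_le (by norm_num)) hc hk x _
    rw [this, fderiv_cv (h2 i) (c2 i) hk]
  rw [Finset.sum_congr rfl fun i _ => h3 i]
  simp only [cv, lap_def, Finset.sum_mul]
  rw [integral_finsetSum]
  intro i _
  exact cv_integrable (pd_cont (h2 i) _) (pd_compact (c2 i) _) hk x

/-- local representation of harmonic functions by a fixed smooth kernel -/
lemma harm_rep_local {δ : ℝ} (hδ : 0 < δ) : ∃ η : E2 → ℝ, ContDiff ℝ (⊤ : ℕ∞) η ∧ HasCompactSupport η ∧
    ∀ g x0, ContDiffOn ℝ 2 g (ball x0 (3 * δ)) → (∀ y ∈ ball x0 (3 * δ), lap g y = 0) →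
      ∀ x ∈ ball x0 δ, g x = cv η ((ball x0 (2 * δ)).indicator g) x := by
  obtain ⟨η, h1, h2, h3⟩ := harm_rep hδ
  refine ⟨η, h1, ?_, fun g x0 hg hl x hx => ?_⟩
  · refine HasCompactSupport.of_support_subset_isCompact (isCompact_closedBall 0 δ) fun z hz => ?_
    by_contra h
    exact hz (h2 z (by simpa using (not_le.1 fun h' => h (by simpa using h')).le))
  · let χ : ContDiffBump x0 := ⟨2 * δ, (5/2) * δ, by linarith, by linarith⟩
    let f : E2 → ℝ := fun z => χ z * g z
    have hx1 : ∀ z ∈ ball x0 (2 * δ), f z = g z := fun z hz => by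
      simp only [f]
      rw [χ.one_of_mem_closedBall (ball_subset_closedBall hz), one_mul]
    have hf : ContDiff ℝ 2 f := by
      rw [contDiff_iff_contDiffAt]
      intro z
      by_cases hz : z ∈ ball x0 (3 * δ)
      · exact χ.contDiff.contDiffAt.mul (hg.contDiffAt (isOpen_ball.mem_nhds hz))
      · have : f =ᶠ[𝓝 z] fun _ => 0 := by
          have hm : (closedBall x0 ((5/2) * δ))ᶜ ∈ 𝓝 z := by
            refine isClosed_closedBall.isOpen_compl.mem_nhds fun h => hz ?_
            exact closedBall_subset_ball (by linarith) h
          filter_upwards [hm] with w hw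
          simp only [f]
          rw [χ.zero_of_le_dist (not_le.1 fun h => hw (mem_closedBall.2 h)).le, zero_mul]
        exact contDiffAt_const.congr_of_eventuallyEq this
    have hc : HasCompactSupport f := χ.hasCompactSupport.mul_right
    have hxb : ball x δ ⊆ ball x0 (2 * δ) := by
      refine ball_subset_ball' ?_
      have := mem_ball.1 hx
      linarith
    have := h3 f x hf hc (fun y hy => by
      have hy2 := hxb hy
      rw [← hl y (ball_subset_ball (by linarith) hy2)]
      apply lap_congr
      filter_upwards [isOpen_ball.mem_nhds hy2] with w hw using hx1 w hw)
    rw [hx1 x (hxb (mem_ball_self hδ))] at this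
    rw [this]
    unfold cv
    congr 1
    funext y
    by_cases hy : y ∈ ball x δ
    · rw [Set.indicator_of_mem (hxb hy), hx1 y (hxb hy)]
    · rw [h2 (x - y)]
      · simp
      · rw [mem_ball, dist_eq_norm, norm_sub_rev] at hy
        exact not_lt.1 hy

/-- parameter integrals of bounded harmonic functions are harmonic -/
lemma harm_param {δ : ℝ} (hδ : 0 < δ) {g : E2 → E2 → ℝ} {x0 : E2} {M : ℝ} {f : E2 → ℝ}
    (hg : ∀ y, ContDiffOn ℝ 2 (fun x => g x y) (ball x0 (3 * δ)))
    (hl : ∀ y, ∀ x ∈ ball x0 (3 * δ), lap (fun x => g x y) x = 0)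
    (hM : ∀ y, ∀ x ∈ ball x0 (3 * δ), |g x y| ≤ M)
    (hm : Measurable (fun q : E2 × E2 => (ball x0 (2 * δ)).indicator (fun x => g x q.2) q.1))
    (hf : Integrable f) :
    ContDiffOn ℝ 2 (fun x => ∫ y, g x y * f y) (ball x0 δ) ∧
      ∀ x ∈ ball x0 δ, lap (fun x => ∫ y, g x y * f y) x = 0 := by
  obtain ⟨η, h1, h2, h3⟩ := harm_rep_local hδ
  obtain ⟨B, hB⟩ : ∃ B : Set E2, B = ball x0 (2 * δ) := ⟨_, rfl⟩
  have hBm : MeasurableSet B := hB ▸ measurableSet_ball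
  have hBv : volume B ≠ ⊤ := hB ▸ measure_ball_lt_top.ne
  rw [← hB] at hm
  have hη2 : ContDiff ℝ 2 η := h1.of_le (WithTop.coe_le_coe.2 (le_top : (2:ℕ∞) ≤ ⊤))
  obtain ⟨gt, hgt⟩ : ∃ gt : E2 → E2 → ℝ, gt = fun z y => B.indicator (fun x => g x y) z := ⟨_, rfl⟩
  have hm : Measurable (fun q : E2 × E2 => gt q.1 q.2) := by rw [hgt]; exact hm
  have hgtb : ∀ z y, |gt z y| ≤ M := by
    intro z y
    have hM0 : 0 ≤ M := (abs_nonneg _).trans (hM y x0 (mem_ball_self (by linarith)))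
    simp only [hgt]
    by_cases hz : z ∈ B
    · rw [Set.indicator_of_mem hz]; exact hM y z (ball_subset_ball (by linarith) (hB ▸ hz))
    · rw [Set.indicator_of_notMem hz]; simpa using hM0
  have hgtm : ∀ y, Measurable (fun z => gt z y) := fun y => hm.comp (measurable_id.prodMk measurable_const)
  have hgtl : ∀ y, LocallyIntegrable (fun z => gt z y) := by
    intro y
    refine Integrable.locallyIntegrable ?_
    have : Integrable (B.indicator (fun _ => M)) := by
      rw [integrable_indicator_iff hBm]
      exact integrableOn_const hBv (by simp)
    refine this.mono' (hgtm y).aestronglyMeasurable (Filter.Eventually.of_forall fun z => ?_)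
    by_cases hz : z ∈ B
    · rw [Set.indicator_of_mem hz]; exact hgtb z y
    · rw [Set.indicator_of_notMem hz]; simp [hgt, Set.indicator_of_notMem hz]
  -- truncated function
  obtain ⟨k, hk⟩ : ∃ k : E2 → ℝ, k = fun z => ∫ y, gt z y * f y := ⟨_, rfl⟩
  -- product integrability
  have hprod : ∀ θ : E2 → ℝ, Continuous θ → HasCompactSupport θ → ∀ x,
      Integrable (fun q : E2 × E2 => θ (x - q.1) * (gt q.1 q.2 * f q.2)) (volume.prod volume) := by
    intro θ hθ hθc x
    have i1 : Integrable (fun z => θ (x - z)) := (hθ.integrable_of_hasCompactSupport hθc).comp_sub_left x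
    have i2 := (i1.mul_prod hf).mul_const M
    refine i2.mono ?_ (Filter.Eventually.of_forall fun q => ?_)
    · refine AEStronglyMeasurable.mul ?_ (hm.aestronglyMeasurable.mul hf.aestronglyMeasurable.comp_snd)
      exact (hθ.comp (continuous_const.sub continuous_fst)).aestronglyMeasurable
    · simp only [norm_mul, Real.norm_eq_abs]
      have := (hgtb q.1 q.2).trans (le_abs_self M)
      calc |θ (x - q.1)| * (|gt q.1 q.2| * |f q.2|) ≤ |θ (x - q.1)| * (|M| * |f q.2|) := by gcongr
        _ = _ := by ring
  have hswap : ∀ θ : E2 → ℝ, Continuous θ → HasCompactSupport θ → ∀ x,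
      cv θ k x = ∫ y, cv θ (fun z => gt z y) x * f y := by
    intro θ hθ hθc x
    have := integral_integral_swap (f := fun z y => θ (x - z) * (gt z y * f y)) (hprod θ hθ hθc x)
    unfold cv
    rw [hk]
    simp_rw [← integral_const_mul, ← integral_mul_const]
    simp_rw [mul_assoc]
    exact this
  have hkl : LocallyIntegrable k := by
    refine Integrable.locallyIntegrable ?_
    have i0 : Integrable (B.indicator (fun _ => M * ∫ y, |f y|)) := by
      rw [integrable_indicator_iff hBm]
      exact integrableOn_const hBv (by exact enorm_ne_top)
    refine i0.mono' ?_ (Filter.Eventually.of_forall fun z => ?_)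
    · have : AEStronglyMeasurable (fun q : E2 × E2 => gt q.1 q.2 * f q.2) (volume.prod volume) :=
        hm.aestronglyMeasurable.mul hf.aestronglyMeasurable.comp_snd
      rw [hk]
      exact this.integral_prod_right'
    · by_cases hz : z ∈ B
      · rw [Set.indicator_of_mem hz, ← integral_const_mul, hk]
        refine norm_integral_le_of_norm_le (hf.abs.const_mul M) (Filter.Eventually.of_forall fun y => ?_)
        rw [norm_mul]
        exact mul_le_mul_of_nonneg_right (hgtb z y) (abs_nonneg _)
      · rw [Set.indicator_of_notMem hz]; simp [hk, hgt, Set.indicator_of_notMem hz]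
  have hrep : ∀ x ∈ ball x0 δ, (∫ y, g x y * f y) = cv η k x := by
    intro x hx
    rw [hswap η h1.continuous h2]
    congr 1
    funext y
    rw [h3 (fun x => g x y) x0 (hg y) (hl y) x hx, hgt, hB]
  have hC : ContDiff ℝ 2 (cv η k) := contDiff_cv (n := 2) hη2 h2 hkl
  refine ⟨hC.contDiffOn.congr hrep, fun x hx => ?_⟩
  have e1 : lap (fun x => ∫ y, g x y * f y) x = lap (cv η k) x := by
    apply lap_congr
    filter_upwards [isOpen_ball.mem_nhds hx] with w hw using hrep w hw
  have hlc : HasCompactSupport (lap η) := by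
    refine HasCompactSupport.of_support_subset_isCompact h2 fun z hz => ?_
    by_contra h
    apply hz
    have h0 : η =ᶠ[𝓝 z] fun _ => 0 := notMem_tsupport_iff_eventuallyEq.1 h
    rw [lap_congr h0]
    simp [lap]
  rw [e1, lap_cv hη2 h2 hkl, hswap (lap η) (cont_lap hη2) hlc]
  have : ∀ y, cv (lap η) (fun z => gt z y) x = 0 := by
    intro y
    rw [← lap_cv hη2 h2 (hgtl y), ← hl y x (ball_subset_ball (by linarith) hx)]
    apply lap_congr
    filter_upwards [isOpen_ball.mem_nhds hx] with w hw
    rw [h3 (fun x => g x y) x0 (hg y) (hl y) w hw, hgt, hB]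
  simp [this]

end

section

variable {Ω : Set E2}

def KK (gd : GreenData Ω) (f : E2 → ℝ) (x : E2) : ℝ := ∫ y, kk gd x y * f y

lemma H_measurable (hΩ : IsOpen Ω) (gd : GreenData Ω) :
    Measurable (fun q : E2 × E2 => (Ω ×ˢ Ω).indicator (fun q => gd.H q.1 q.2) q) := by
  classical
  have h := (H_contOn gd).measurable_piecewise (g := fun _ => (0:ℝ)) continuousOn_const
    (hΩ.prod hΩ).measurableSet
  convert h using 1
  funext q
  simp [Set.indicator, Set.piecewise]

/-- the decomposition of `KK f` near a point -/
lemma KK_local (hΩ : IsOpen Ω) (hb : IsBounded Ω) (gd : GreenData Ω) {f : E2 → ℝ} {F R : ℝ}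
    (hf : BM f F R) (hR : Ω ⊆ ball 0 R) (h0 : ∀ y, y ∉ Ω → f y = 0) {x0 : E2} (hx0 : x0 ∈ Ω) :
    ∃ δ : ℝ, 0 < δ ∧ ∃ χ : E2 → ℝ, ContDiff ℝ (⊤ : ℕ∞) χ ∧ HasCompactSupport χ ∧ tsupport χ ⊆ Ω ∧
      (∀ y, |χ y| ≤ 1) ∧ (∀ y ∈ ball x0 δ, χ y = 1) ∧ ∃ h : E2 → ℝ, ContDiffOn ℝ 2 h (ball x0 δ) ∧
      (∀ x ∈ ball x0 δ, lap h x = 0) ∧ ∀ x ∈ ball x0 δ, KK gd f x = VV 0 (fun y => χ y * f y) x + h x := by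
  obtain ⟨ρ, hρ, hball⟩ := Metric.isOpen_iff.1 hΩ x0 hx0
  obtain ⟨d, hd1, hd⟩ := exists_diam hb
  obtain ⟨δ, hδ, h6⟩ : ∃ δ > 0, ρ = 6 * δ := ⟨ρ / 6, by positivity, by ring⟩
  let χ : ContDiffBump x0 := ⟨4 * δ, 5 * δ, by linarith, by linarith⟩
  have hχ0 : ∀ y, 0 ≤ χ y := fun y => χ.nonneg
  have hχ1 : ∀ y, χ y ≤ 1 := fun y => χ.le_one
  have hχe : ∀ y ∈ closedBall x0 (4 * δ), χ y = 1 := fun y hy => χ.one_of_mem_closedBall hy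
  obtain ⟨g, hg⟩ : ∃ g : E2 → E2 → ℝ, g = fun x y => Ω.indicator (fun y => (1 - χ y) * Nw 0 (x - y) + gd.H x y) y := ⟨_, rfl⟩
  have hgin : ∀ x, ∀ y ∈ Ω, g x y = (1 - χ y) * Nw 0 (x - y) + gd.H x y := fun x y hy => by
    rw [hg]; exact Set.indicator_of_mem hy _
  have hgout : ∀ x y, y ∉ Ω → g x y = 0 := fun x y hy => by
    rw [hg]; exact Set.indicator_of_notMem hy _
  have hsub : ball x0 (3 * δ) ⊆ Ω := (ball_subset_ball (by linarith)).trans hball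
  have hfar : ∀ x ∈ ball x0 (3 * δ), ∀ y, y ∉ closedBall x0 (4 * δ) → δ < ‖x - y‖ := by
    intro x hx y hy
    rw [mem_closedBall, not_le] at hy
    rw [mem_ball] at hx
    have := dist_triangle y x x0
    rw [← dist_eq_norm, dist_comm x y]
    linarith
  -- the singular part
  have hS : ∀ y, (∀ x ∈ ball x0 (3 * δ), ContDiffAt ℝ 2 (fun x => (1 - χ y) * Nw 0 (x - y)) x) ∧
      (∀ x ∈ ball x0 (3 * δ), lap (fun x => (1 - χ y) * Nw 0 (x - y)) x = 0) := by
    intro y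
    by_cases hy : y ∈ closedBall x0 (4 * δ)
    · have : (fun x => (1 - χ y) * Nw 0 (x - y)) = fun _ => 0 := by
        funext x; rw [hχe y hy]; ring
      rw [this]
      exact ⟨fun x _ => contDiffAt_const, fun x _ => by simp [lap]⟩
    · have hN : ∀ x ∈ ball x0 (3 * δ), ContDiffAt ℝ 2 (fun x => Nw 0 (x - y)) x := by
        intro x hx
        have hne : x - y ≠ 0 := norm_pos_iff.1 (hδ.trans (hfar x hx y hy))
        have := (Nw0_smooth hne).of_le (WithTop.coe_le_coe.2 (le_top : (2:ℕ∞) ≤ ⊤))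
        exact ContDiffAt.comp (g := Nw 0) (f := fun x => x - y) x this (contDiffAt_id.sub contDiffAt_const)
      refine ⟨fun x hx => contDiffAt_const.mul (hN x hx), fun x hx => ?_⟩
      have hne : x - y ≠ 0 := norm_pos_iff.1 (hδ.trans (hfar x hx y hy))
      rw [lap_const_mul (hN x hx), lap_translate, Nw0_harm hne, mul_zero]
  have hHy : ∀ y, (fun x => gd.H x y) = gd.H y := fun y => by funext x; exact H_symm gd x y
  have P := harm_param hδ (g := g) (x0 := x0) (M := δ⁻¹ + d ^ 2 + (|1 / (2 * π) * Real.log d| + |1 / (2 * π) * Real.log (2 * δ)|)) (f := f)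
    (fun y => ?_) (fun y x hx => ?_) (fun y x hx => ?_) ?_ hf.integrable
  · refine ⟨δ, hδ, χ, χ.contDiff, χ.hasCompactSupport, ?_, fun y => ?_, fun y hy => ?_,
      fun x => ∫ y, g x y * f y, P.1, P.2, fun x hx => ?_⟩
    · rw [χ.tsupport_eq]
      exact (closedBall_subset_ball (show 5 * δ < ρ by linarith)).trans hball
    · rw [abs_of_nonneg (hχ0 y)]; exact hχ1 y
    · exact hχe y (ball_subset_closedBall (ball_subset_ball (by linarith) hy))
    · have hx3 : x ∈ ball x0 (3 * δ) := ball_subset_ball (by linarith) hx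
      have hxΩ := hsub hx3
      unfold KK VV
      have hB : BM (fun y => χ y * f y) F R := by
        refine ⟨χ.continuous.measurable.mul hf.meas, fun y => ?_, fun y hy => by rw [hf.supp y hy, mul_zero]⟩
        rw [abs_mul, abs_of_nonneg (hχ0 y)]
        calc χ y * |f y| ≤ 1 * F := mul_le_mul (hχ1 y) (hf.bd y) (abs_nonneg _) zero_le_one
          _ = F := one_mul _
      have i1 := V_int hB (hR hxΩ) le_rfl zero_le_one
      have i2 : Integrable (fun y => Nw 0 (x - y) * f y) := V_int hf (hR hxΩ) le_rfl zero_le_one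
      have i3 : Integrable (fun y => gd.H x y * f y) := by
        refine (hf.integrable.abs.mul_const (|1 / (2 * π) * Real.log d| + |1 / (2 * π) * Real.log (2 * δ)|)).mono' ?_ (Eventually.of_forall fun y => ?_)
        · have := ((H_measurable hΩ gd).comp (measurable_prodMk_left (x := x))).mul hf.meas
          refine AEStronglyMeasurable.congr this.aestronglyMeasurable (Eventually.of_forall fun y => ?_)
          by_cases hy : y ∈ Ω
          · simp [Set.indicator, hxΩ, hy]
          · simp [h0 y hy]
        · by_cases hy : y ∈ Ω
          · rw [norm_mul, mul_comm]
            refine mul_le_mul_of_nonneg_left ?_ (abs_nonneg _)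
            have h1 := H_upper hΩ hb gd hd hxΩ hy
            have h2 := H_lower hΩ hb gd (x := x) (y := y) (δ := 2 * δ) (by linarith)
              ((ball_subset_ball' (by have := mem_ball.1 hx3; linarith)).trans hball) hy
            rw [Real.norm_eq_abs, abs_le]
            constructor <;> linarith [le_abs_self (1 / (2 * π) * Real.log d), neg_abs_le (1 / (2 * π) * Real.log (2 * δ)), abs_nonneg (1 / (2 * π) * Real.log d), abs_nonneg (1 / (2 * π) * Real.log (2 * δ))]
          · simp [h0 y hy]
      have i4 : Integrable (fun y => g x y * f y) := by
        refine ((i2.sub i1).add i3).congr (Eventually.of_forall fun y => ?_)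
        by_cases hy : y ∈ Ω
        · simp only [Pi.add_apply, Pi.sub_apply]
          rw [hgin x y hy]; ring
        · simp [h0 y hy]
      rw [← integral_add i1 i4]
      refine integral_congr_ae ?_
      filter_upwards [ae_ne_pt x] with y hxy
      by_cases hy : y ∈ Ω
      · rw [hgin x y hy, kk_eq gd hxΩ hy hxy, gd.decomp, Nw_zero_eq]; ring
      · simp [h0 y hy]
  · by_cases hy : y ∈ Ω
    · simp_rw [hgin _ y hy]
      refine ContDiffOn.add (fun x hx => ((hS y).1 x hx).contDiffWithinAt) ?_
      rw [hHy]
      exact (H_contDiffOn gd hy).mono hsub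
    · simp_rw [hgout _ y hy]; exact contDiffOn_const
  · by_cases hy : y ∈ Ω
    · simp_rw [hgin _ y hy]
      rw [lap_add ((hS y).1 x hx), (hS y).2 x hx, hHy, gd.harmH y hy x (hsub hx), add_zero]
      rw [hHy]
      exact (H_contDiffOn gd hy).contDiffAt (hΩ.mem_nhds (hsub hx))
    · simp_rw [hgout _ y hy]; simp [lap]
  · by_cases hy : y ∈ Ω
    · rw [hgin x y hy]
      refine (abs_add_le _ _).trans (add_le_add ?_ ?_)
      · rw [abs_mul]
        by_cases hyc : y ∈ closedBall x0 (4 * δ)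
        · rw [hχe y hyc]; simp; positivity
        · have hd' := hfar x hx y hyc
          have hne : x - y ≠ 0 := norm_pos_iff.1 (hδ.trans hd')
          have h1 := abs_Nw_le le_rfl zero_le_one hne
          have h2 : ‖x - y‖⁻¹ ≤ δ⁻¹ := inv_anti₀ hδ hd'.le
          have h3 : ‖x - y‖ ^ 2 ≤ d ^ 2 := by
            have := hd x (subset_closure (hsub hx)) y (subset_closure hy)
            gcongr
          have h4 : |1 - χ y| ≤ 1 := by
            rw [abs_le]; constructor <;> linarith [hχ0 y, hχ1 y]
          calc |1 - χ y| * |Nw 0 (x - y)| ≤ 1 * (δ⁻¹ + d ^ 2) :=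
                mul_le_mul h4 (by linarith) (abs_nonneg _) zero_le_one
            _ = _ := one_mul _
      · have h1 := H_upper hΩ hb gd hd (hsub hx) hy
        have h2 := H_lower hΩ hb gd (x := x) (y := y) (δ := 2 * δ) (by linarith)
          ((ball_subset_ball' (by have := mem_ball.1 hx; linarith)).trans hball) hy
        rw [abs_le]
        constructor <;> linarith [le_abs_self (1 / (2 * π) * Real.log d), neg_abs_le (1 / (2 * π) * Real.log (2 * δ)), abs_nonneg (1 / (2 * π) * Real.log d), abs_nonneg (1 / (2 * π) * Real.log (2 * δ))]
    · rw [hgout x y hy]; simp; positivity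
  · have m1 : Measurable (fun q : E2 × E2 => (1 - χ q.2) * Nw 0 (q.1 - q.2)) := by
      refine Measurable.mul ?_ ((measurable_Nw 0).comp (measurable_fst.sub measurable_snd))
      exact measurable_const.sub (χ.continuous.measurable.comp measurable_snd)
    have m2 := (m1.add (H_measurable hΩ gd)).indicator
      (s := ball x0 (2 * δ) ×ˢ Ω) (measurableSet_ball.prod hΩ.measurableSet)
    convert m2 using 1
    funext q
    symm
    by_cases hq1 : q.1 ∈ ball x0 (2 * δ)
    · have hq3 : q.1 ∈ Ω := hsub (ball_subset_ball (by linarith) hq1)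
      by_cases hq2 : q.2 ∈ Ω
      · rw [Set.indicator_of_mem (Set.mem_prod.2 ⟨hq1, hq2⟩), Set.indicator_of_mem hq1, hgin _ _ hq2]
        simp only [Pi.add_apply]
        rw [Set.indicator_of_mem (Set.mem_prod.2 ⟨hq3, hq2⟩)]
      · rw [Set.indicator_of_notMem (fun h => hq2 (Set.mem_prod.1 h).2), Set.indicator_of_mem hq1, hgout _ _ hq2]
    · rw [Set.indicator_of_notMem (fun h => hq1 (Set.mem_prod.1 h).1), Set.indicator_of_notMem hq1]

end

section

variable {Ω : Set E2}

lemma KK_C1 (hΩ : IsOpen Ω) (hb : IsBounded Ω) (gd : GreenData Ω) {f : E2 → ℝ} {F R : ℝ}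
    (hf : BM f F R) (hR : Ω ⊆ ball 0 R) (h0 : ∀ y, y ∉ Ω → f y = 0) : ContDiffOn ℝ 1 (KK gd f) Ω := by
  intro x0 hx0
  obtain ⟨δ, hδ, χ, c1, c2, c3, c4, c5, h, h1, h2, h3⟩ := KK_local hΩ hb gd hf hR h0 hx0
  have hB : BM (fun y => χ y * f y) F R := by
    refine ⟨c1.continuous.measurable.mul hf.meas, fun y => ?_, fun y hy => by rw [hf.supp y hy, mul_zero]⟩
    rw [abs_mul]
    calc |χ y| * |f y| ≤ 1 * F := mul_le_mul (c4 y) (hf.bd y) (abs_nonneg _) zero_le_one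
      _ = F := one_mul _
  have e : KK gd f =ᶠ[𝓝 x0] fun x => VV 0 (fun y => χ y * f y) x + h x := by
    filter_upwards [ball_mem_nhds x0 hδ] with x hx using h3 x hx
  refine ContDiffAt.contDiffWithinAt (ContDiffAt.congr_of_eventuallyEq ?_ e)
  refine ContDiffAt.add ((contDiffOn_V hB).contDiffAt (isOpen_ball.mem_nhds (hR hx0))) ?_
  exact (h1.contDiffAt (ball_mem_nhds x0 hδ)).of_le (by norm_num)

lemma KK_C2 (hΩ : IsOpen Ω) (hb : IsBounded Ω) (gd : GreenData Ω) {f : E2 → ℝ} {F R : ℝ}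
    (hf : BM f F R) (hR : Ω ⊆ ball 0 R) (h0 : ∀ y, y ∉ Ω → f y = 0) (hf1 : ContDiffOn ℝ 1 f Ω) :
    ContDiffOn ℝ 2 (KK gd f) Ω ∧ ∀ x ∈ Ω, lap (KK gd f) x = - f x := by
  have key : ∀ x0 ∈ Ω, ContDiffAt ℝ 2 (KK gd f) x0 ∧ lap (KK gd f) x0 = - f x0 := by
    intro x0 hx0
    obtain ⟨δ, hδ, χ, c1, c2, c3, c4, c5, h, h1, h2, h3⟩ := KK_local hΩ hb gd hf hR h0 hx0
    have hχf : ContDiff ℝ 1 (fun y => χ y * f y) := by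
      rw [contDiff_iff_contDiffAt]
      intro z
      by_cases hz : z ∈ Ω
      · exact (c1.contDiffAt.of_le (WithTop.coe_le_coe.2 (le_top : (1:ℕ∞) ≤ ⊤))).mul
          (hf1.contDiffAt (hΩ.mem_nhds hz))
      · have : (fun y => χ y * f y) =ᶠ[𝓝 z] fun _ => 0 := by
          have h0 : χ =ᶠ[𝓝 z] fun _ => 0 := notMem_tsupport_iff_eventuallyEq.1 (fun h => hz (c3 h))
          filter_upwards [h0] with w hw
          rw [hw, zero_mul]
        exact contDiffAt_const.congr_of_eventuallyEq this
    have hcs : HasCompactSupport (fun y => χ y * f y) := c2.mul_right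
    have e : KK gd f =ᶠ[𝓝 x0] fun x => VV 0 (fun y => χ y * f y) x + h x := by
      filter_upwards [ball_mem_nhds x0 hδ] with x hx using h3 x hx
    have a1 := (contDiff_V_two hχf hcs).contDiffAt (x := x0)
    have a2 := h1.contDiffAt (ball_mem_nhds x0 hδ)
    refine ⟨(a1.add a2).congr_of_eventuallyEq e, ?_⟩
    rw [lap_congr e, lap_add a1 a2, lap_V hχf hcs, h2 x0 (mem_ball_self hδ), c5 x0 (mem_ball_self hδ)]
    ring
  exact ⟨fun x hx => (key x hx).1.contDiffWithinAt, fun x hx => (key x hx).2⟩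

lemma kk_tendsto_bdry (hΩ : IsOpen Ω) (gd : GreenData Ω) {z : E2} (hz : z ∈ frontier Ω) (y : E2) :
    Tendsto (fun x => kk gd x y) (𝓝 z) (𝓝 0) := by
  by_cases hy : y ∈ Ω
  · have hzy : 0 < ‖y - z‖ := frontier_ne hΩ hy hz
    have h1 : Tendsto (fun x => -(1 / (2 * π)) * Real.log ‖y - x‖ + gd.H y x) (𝓝[closure Ω] z) (𝓝 (gd.G y z)) := by
      rw [gd.decomp y z]
      refine Tendsto.add ?_ (gd.contH y hy z (frontier_subset_closure hz))
      have : ContinuousAt (fun x : E2 => -(1 / (2 * π)) * Real.log ‖y - x‖) z :=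
        continuousAt_const.mul (ContinuousAt.log (by fun_prop) hzy.ne')
      exact this.tendsto.mono_left nhdsWithin_le_nhds
    rw [gd.bdry y hy z hz] at h1
    have h2 : Tendsto (fun x => (closure Ω).indicator (fun x => -(1 / (2 * π)) * Real.log ‖y - x‖ + gd.H y x) x) (𝓝 z) (𝓝 0) := by
      rw [Metric.tendsto_nhds] at h1 ⊢
      intro ε hε
      have := h1 ε hε
      rw [eventually_nhdsWithin_iff] at this
      filter_upwards [this] with x hx
      by_cases hxc : x ∈ closure Ω
      · rw [Set.indicator_of_mem hxc]; exact hx hxc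
      · rw [Set.indicator_of_notMem hxc]; simpa using hε
    have h3 := h2.norm
    rw [norm_zero] at h3
    refine squeeze_zero_norm (fun x => ?_) h3
    unfold kk
    split_ifs with h
    · rw [Set.indicator_of_mem (subset_closure h.1), gd.symm, gd.decomp]
    · simp
  · simp_rw [kk_zero_right gd hy]; exact tendsto_const_nhds

lemma kk_integrable (hΩ : IsOpen Ω) (hb : IsBounded Ω) (gd : GreenData Ω) (x : E2) : Integrable (kk gd x) := by
  obtain ⟨M, hM, h⟩ := kk_rpow_int hΩ hb gd (m := 1) one_pos
  simpa using (h x).1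

lemma kk_int_tendsto_bdry (hΩ : IsOpen Ω) (hb : IsBounded Ω) (gd : GreenData Ω) {z : E2} (hz : z ∈ frontier Ω) :
    Tendsto (fun x => ∫ y, kk gd x y) (𝓝 z) (𝓝 0) := by
  obtain ⟨M, hM, h⟩ := kk_rpow_int hΩ hb gd (m := 2) two_pos
  have hk0 := kk_nonneg hΩ hb gd
  rw [Metric.tendsto_nhds]
  intro ε hε
  obtain ⟨T, hT⟩ : ∃ T, T = 2 * (M + 1) / ε := ⟨_, rfl⟩
  have hT0 : 0 < T := by rw [hT]; positivity
  have hd : Tendsto (fun x => ∫ y in Ω, min (kk gd x y) T) (𝓝 z) (𝓝 (∫ y in Ω, (0:ℝ))) := by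
    refine tendsto_integral_filter_of_dominated_convergence (fun _ => T) (Eventually.of_forall fun x => ?_)
      (Eventually.of_forall fun x => Eventually.of_forall fun y => ?_) ?_ (Eventually.of_forall fun y => ?_)
    · exact ((kk_meas_right hΩ gd x).min measurable_const).aestronglyMeasurable
    · rw [Real.norm_of_nonneg (le_min (hk0 x y) hT0.le)]; exact min_le_right _ _
    · exact integrableOn_const hb.measure_lt_top.ne (by simp)
    · have := (kk_tendsto_bdry hΩ gd hz y).min (tendsto_const_nhds (x := T))
      rwa [min_eq_left hT0.le] at this
  rw [integral_zero, Metric.tendsto_nhds] at hd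
  filter_upwards [hd (ε / 2) (by linarith)] with x hx
  have i1 : IntegrableOn (fun y => min (kk gd x y) T) Ω := by
    refine (kk_integrable hΩ hb gd x).integrableOn.mono' ((kk_meas_right hΩ gd x).min measurable_const).aestronglyMeasurable
      (Eventually.of_forall fun y => ?_)
    rw [Real.norm_of_nonneg (le_min (hk0 x y) hT0.le)]; exact min_le_left _ _
  have i2 : IntegrableOn (fun y => kk gd x y ^ (2:ℝ) / T) Ω := ((h x).1.div_const T).integrableOn
  have e : ∫ y, kk gd x y = ∫ y in Ω, kk gd x y := by
    rw [setIntegral_eq_integral_of_forall_compl_eq_zero]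
    intro y hy; exact kk_zero_right gd hy
  rw [dist_zero_right, Real.norm_of_nonneg (integral_nonneg (hk0 x)), e]
  have b1 : ∫ y in Ω, kk gd x y ≤ ∫ y in Ω, (min (kk gd x y) T + kk gd x y ^ (2:ℝ) / T) := by
    refine setIntegral_mono (kk_integrable hΩ hb gd x).integrableOn (i1.add i2) fun y => ?_
    have h2 : kk gd x y ^ (2:ℝ) = kk gd x y ^ 2 := by norm_cast
    simp only [h2]
    have := hk0 x y
    rcases le_total (kk gd x y) T with hl | hl
    · rw [min_eq_left hl]
      have : 0 ≤ kk gd x y ^ 2 / T := by positivity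
      linarith
    · rw [min_eq_right hl]
      have : kk gd x y ≤ kk gd x y ^ 2 / T := by
        rw [le_div_iff₀ hT0]; nlinarith
      linarith
  rw [integral_add i1 i2, integral_div] at b1
  have b2 : ∫ y in Ω, kk gd x y ^ (2:ℝ) ≤ M :=
    (setIntegral_le_integral (h x).1 (Eventually.of_forall fun y => Real.rpow_nonneg (hk0 x y) _)).trans (h x).2
  have b3 : (∫ y in Ω, kk gd x y ^ (2:ℝ)) / T < ε / 2 := by
    rw [div_lt_iff₀ hT0, hT]
    have : ε / 2 * (2 * (M + 1) / ε) = M + 1 := by field_simp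
    rw [this]; linarith
  rw [dist_zero_right] at hx
  have := (le_abs_self _).trans_lt hx
  linarith

lemma KK_abs_le (hΩ : IsOpen Ω) (hb : IsBounded Ω) (gd : GreenData Ω) {f : E2 → ℝ} {F : ℝ}
    (hf : ∀ y, |f y| ≤ F) (x : E2) : |KK gd f x| ≤ F * ∫ y, kk gd x y := by
  unfold KK
  rw [← integral_const_mul, ← Real.norm_eq_abs]
  refine norm_integral_le_of_norm_le ((kk_integrable hΩ hb gd x).const_mul F) (Eventually.of_forall fun y => ?_)
  rw [norm_mul, Real.norm_of_nonneg (kk_nonneg hΩ hb gd x y), mul_comm]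
  exact mul_le_mul_of_nonneg_right (hf y) (kk_nonneg hΩ hb gd x y)

lemma KK_out (gd : GreenData Ω) (f : E2 → ℝ) {x : E2} (hx : x ∉ Ω) : KK gd f x = 0 := by
  unfold KK
  simp [kk_zero_left gd hx]

lemma KK_continuousOn (hΩ : IsOpen Ω) (hb : IsBounded Ω) (gd : GreenData Ω) {f : E2 → ℝ} {F R : ℝ}
    (hf : BM f F R) (hR : Ω ⊆ ball 0 R) (h0 : ∀ y, y ∉ Ω → f y = 0) : ContinuousOn (KK gd f) (closure Ω) := by
  intro z hz
  by_cases hzΩ : z ∈ Ω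
  · exact ((KK_C1 hΩ hb gd hf hR h0).continuousOn.continuousAt (hΩ.mem_nhds hzΩ)).continuousWithinAt
  · have hfr : z ∈ frontier Ω := by rw [hΩ.frontier_eq]; exact ⟨hz, hzΩ⟩
    refine ContinuousAt.continuousWithinAt ?_
    unfold ContinuousAt
    rw [KK_out gd f hzΩ]
    refine squeeze_zero_norm (fun x => KK_abs_le hΩ hb gd hf.bd x) ?_
    simpa using (kk_int_tendsto_bdry hΩ hb gd hfr).const_mul F

/-- representation of classical solutions -/
lemma eq_KK (hΩ : IsOpen Ω) (hb : IsBounded Ω) (gd : GreenData Ω) {f u : E2 → ℝ} {F R : ℝ}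
    (hf : BM f F R) (hR : Ω ⊆ ball 0 R) (h0 : ∀ y, y ∉ Ω → f y = 0) (hf1 : ContDiffOn ℝ 1 f Ω)
    (hu : ContDiffOn ℝ 2 u Ω) (huc : ContinuousOn u (closure Ω)) (hl : ∀ x ∈ Ω, lap u x = - f x)
    (hub : ∀ x ∈ frontier Ω, u x = 0) : ∀ x ∈ Ω, u x = KK gd f x := by
  obtain ⟨k1, k2⟩ := KK_C2 hΩ hb gd hf hR h0 hf1
  have kc := KK_continuousOn hΩ hb gd hf hR h0
  have kb : ∀ x ∈ frontier Ω, KK gd f x = 0 := fun x hx => by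
    rw [hΩ.frontier_eq] at hx; exact KK_out gd f hx.2
  have cu : ∀ x ∈ Ω, ContDiffAt ℝ 2 u x := fun x hx => hu.contDiffAt (hΩ.mem_nhds hx)
  have ck : ∀ x ∈ Ω, ContDiffAt ℝ 2 (KK gd f) x := fun x hx => k1.contDiffAt (hΩ.mem_nhds hx)
  intro x hx
  have a := max_principle hΩ hb (g := fun x => u x - KK gd f x) (M := 0) (hu.sub k1) (huc.sub kc)
    (fun x hx => by rw [lap_sub (cu x hx) (ck x hx), hl x hx, k2 x hx]; simp)
    (fun x hx => by simp [hub x hx, kb x hx]) x hx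
  have b := max_principle hΩ hb (g := fun x => KK gd f x - u x) (M := 0) (k1.sub hu) (kc.sub huc)
    (fun x hx => by rw [lap_sub (ck x hx) (cu x hx), hl x hx, k2 x hx]; simp)
    (fun x hx => by simp [hub x hx, kb x hx]) x hx
  linarith

end

section

variable {Ω : Set E2}

/-- the nonlinearity -/
def nl (p t : ℝ) : ℝ := |t| ^ (p - 1) * t

lemma nl_zero (p : ℝ) : nl p 0 = 0 := by simp [nl]

lemma abs_nl {p : ℝ} (hp : 1 < p) (t : ℝ) : |nl p t| = |t| ^ p := by
  unfold nl
  rcases eq_or_ne t 0 with rfl | ht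
  · simp [Real.zero_rpow (by linarith : p ≠ 0)]
  · rw [abs_mul, abs_of_nonneg (Real.rpow_nonneg (abs_nonneg t) _)]
    conv_lhs => rw [← Real.rpow_one |t|]
    rw [← Real.rpow_mul (abs_nonneg t), ← Real.rpow_add (abs_pos.2 ht)]
    congr 1; ring

lemma nl_mul_self {p : ℝ} (hp : 1 < p) (t : ℝ) : nl p t * t = |t| ^ (p + 1) := by
  unfold nl
  rcases eq_or_ne t 0 with rfl | ht
  · simp [Real.zero_rpow (by linarith : p + 1 ≠ 0)]
  · have : t * t = |t| ^ (2:ℝ) := by rw [← abs_mul_abs_self]; norm_cast; ring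
    rw [mul_assoc, this, ← Real.rpow_add (abs_pos.2 ht)]
    congr 1; ring

lemma nl_neg (p t : ℝ) : nl p (-t) = - nl p t := by unfold nl; rw [abs_neg]; ring

lemma nl_of_nonneg {p t : ℝ} (hp : 1 < p) (ht : 0 ≤ t) : nl p t = t ^ p := by
  have := abs_nl hp t
  rwa [abs_of_nonneg (by unfold nl; positivity), abs_of_nonneg ht] at this

lemma hasDerivAt_nl {p : ℝ} (hp : 1 < p) (t : ℝ) : HasDerivAt (nl p) (p * |t| ^ (p - 1)) t := by
  rcases lt_trichotomy t 0 with ht | rfl | ht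
  · have h : HasDerivAt (fun s : ℝ => -((-s) ^ p)) (p * |t| ^ (p - 1)) t := by
      have h1 := ((hasDerivAt_neg t).rpow_const (p := p) (Or.inl (by simpa using ht.ne))).neg
      refine h1.congr_deriv ?_
      rw [abs_of_neg ht]; ring
    refine h.congr_of_eventuallyEq ?_
    filter_upwards [Iio_mem_nhds ht] with s hs
    have hs' : s < 0 := hs
    rw [← nl_of_nonneg hp (by linarith : 0 ≤ -s), nl_neg, neg_neg]
  · rw [abs_zero, Real.zero_rpow (by linarith), mul_zero, hasDerivAt_iff_tendsto_slope]
    have h1 : Tendsto (fun s : ℝ => |s| ^ (p - 1)) (𝓝[≠] 0) (𝓝 0) := by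
      have : ContinuousAt (fun s : ℝ => |s| ^ (p - 1)) 0 :=
        (continuous_abs.continuousAt).rpow_const (Or.inr (by linarith))
      have h := this.tendsto
      rw [abs_zero, Real.zero_rpow (by linarith)] at h
      exact h.mono_left nhdsWithin_le_nhds
    refine h1.congr' ?_
    filter_upwards [self_mem_nhdsWithin] with s hs
    have hs' : s ≠ 0 := hs
    rw [slope_def_field, nl_zero]
    unfold nl
    field_simp
    simp
  · have h1 := (hasDerivAt_id t).rpow_const (p := p) (Or.inl ht.ne')
    have h : HasDerivAt (fun s : ℝ => s ^ p) (p * |t| ^ (p - 1)) t := by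
      refine h1.congr_deriv ?_
      rw [abs_of_pos ht]; simp
    refine h.congr_of_eventuallyEq ?_
    filter_upwards [Ioi_mem_nhds ht] with s hs
    exact nl_of_nonneg hp (le_of_lt hs)

lemma contDiff_nl {p : ℝ} (hp : 1 < p) : ContDiff ℝ 1 (nl p) := by
  rw [contDiff_one_iff_deriv]
  refine ⟨fun t => (hasDerivAt_nl hp t).differentiableAt, ?_⟩
  have : deriv (nl p) = fun t => p * |t| ^ (p - 1) := by
    funext t; exact (hasDerivAt_nl hp t).deriv
  rw [this]
  exact continuous_const.mul (continuous_abs.rpow_const fun t => Or.inr (by linarith))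

lemma norm_sq_clm (L : E2 →L[ℝ] ℝ) : ‖L‖ ^ 2 = ∑ i, L (ee i) ^ 2 := by
  have h : L = innerSL ℝ (∑ i, L (ee i) • ee i) := by
    conv_lhs => rw [ee_sum L]
    simp [map_sum]
  have h2 : ‖L‖ = ‖∑ i, L (ee i) • ee i‖ := by
    conv_lhs => rw [h]
    rw [innerSL_apply_norm]
  rw [h2, norm_sq_two]
  simp [Fin.sum_univ_two, ee]

lemma fderiv_zero_on_zeros (hΩ : IsOpen Ω) {u : E2 → ℝ} (hu : ContDiffOn ℝ 2 u Ω) :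
    ∀ᵐ x ∂(volume.restrict Ω), u x = 0 → fderiv ℝ u x = 0 := by
  classical
  obtain ⟨s, hs⟩ : ∃ s, s = Ω ∩ {x | u x = 0} := ⟨_, rfl⟩
  have hsm : MeasurableSet s := by
    have h1 : s = Ω ∩ (Ω.piecewise u 0) ⁻¹' {0} := by
      rw [hs]
      ext x
      simp only [Set.mem_inter_iff, Set.mem_preimage, Set.mem_singleton_iff]
      constructor
      · rintro ⟨a, b⟩; refine ⟨a, ?_⟩; rw [Set.piecewise_eq_of_mem _ _ _ a]; exact b
      · rintro ⟨a, b⟩; refine ⟨a, ?_⟩; rw [Set.piecewise_eq_of_mem _ _ _ a] at b; exact b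
    rw [h1]
    exact hΩ.measurableSet.inter
      ((hu.continuousOn.measurable_piecewise continuousOn_const hΩ.measurableSet) (measurableSet_singleton 0))
  have h := ApproximatesLinearOn.norm_fderiv_sub_le (μ := (volume : Measure E2)) (A := (0 : E2 →L[ℝ] E2)) (δ := 0)
    (f := fun x => u x • ee 0) (s := s) (fun x hx y hy => by
      rw [hs] at hx hy
      have hx2 : u x = 0 := hx.2
      have hy2 : u y = 0 := hy.2
      simp [hx2, hy2]) hsm (fun x => (fderiv ℝ u x).smulRight (ee 0)) (fun x hx => by
      rw [hs] at hx
      exact (((hu.contDiffAt (hΩ.mem_nhds hx.1)).differentiableAt (by norm_num)).hasFDerivAt.smul_const (ee 0)).hasFDerivWithinAt)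
  rw [ae_restrict_iff' hsm] at h
  rw [ae_restrict_iff' hΩ.measurableSet]
  filter_upwards [h] with x hx hxΩ hux
  have h1 := hx (by rw [hs]; exact ⟨hxΩ, hux⟩)
  have h2 : fderiv ℝ u x = 0 ∨ ee 0 = 0 := by simpa using h1
  rcases h2 with h2 | h2
  · exact h2
  · exfalso
    have h3 := congrArg (fun v : E2 => v 0) h2
    simp [ee] at h3

/-- cutoff near zero -/
def Mc (ε s : ℝ) : ℝ := min 1 (max 0 (|s| / ε - 1))

lemma Mc_cont (ε : ℝ) : Continuous (Mc ε) := by unfold Mc; fun_prop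
lemma Mc_nonneg (ε s : ℝ) : 0 ≤ Mc ε s := le_min zero_le_one (le_max_left _ _)
lemma Mc_le (ε s : ℝ) : Mc ε s ≤ 1 := min_le_left _ _
lemma Mc_zero {ε s : ℝ} (hε : 0 < ε) (h : |s| ≤ ε) : Mc ε s = 0 := by
  unfold Mc
  rw [max_eq_left, min_eq_right zero_le_one]
  rw [sub_nonpos, div_le_one hε]; exact h
lemma Mc_mono {ε ε' : ℝ} (hε : 0 < ε) (h : ε ≤ ε') (s : ℝ) : Mc ε' s ≤ Mc ε s := by
  unfold Mc
  gcongr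

def sqn (n : ℕ) : ℝ := 1 / ((n:ℝ) + 1)
lemma sqn_pos (n : ℕ) : 0 < sqn n := by unfold sqn; positivity
lemma sqn_anti {n m : ℕ} (h : n ≤ m) : sqn m ≤ sqn n := by
  unfold sqn
  have : (n:ℝ) ≤ m := by exact_mod_cast h
  gcongr

lemma Mc_tendsto {s : ℝ} (hs : s ≠ 0) : Tendsto (fun n => Mc (sqn n) s) atTop (𝓝 1) := by
  have hn : Tendsto (fun n : ℕ => (n:ℝ) + 1) atTop atTop :=
    tendsto_natCast_atTop_atTop.atTop_add tendsto_const_nhds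
  have h1 : Tendsto (fun n : ℕ => |s| * ((n:ℝ) + 1)) atTop atTop :=
    hn.const_mul_atTop (abs_pos.2 hs)
  refine tendsto_const_nhds.congr' ?_
  filter_upwards [h1.eventually_ge_atTop 2] with n hn
  unfold Mc sqn
  rw [min_eq_left]
  refine le_max_of_le_right ?_
  rw [div_div_eq_mul_div, div_one]
  linarith

def Ph (ε t : ℝ) : ℝ := ∫ s in (0:ℝ)..t, Mc ε s

lemma Ph_deriv (ε t : ℝ) : HasDerivAt (Ph ε) (Mc ε t) t :=
  ((Mc_cont ε).integral_hasStrictDerivAt 0 t).hasDerivAt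

lemma Ph_C1 (ε : ℝ) : ContDiff ℝ 1 (Ph ε) := by
  rw [contDiff_one_iff_deriv]
  refine ⟨fun t => (Ph_deriv ε t).differentiableAt, ?_⟩
  have : deriv (Ph ε) = Mc ε := by funext t; exact (Ph_deriv ε t).deriv
  rw [this]; exact Mc_cont ε

lemma Ph_le (ε t : ℝ) : |Ph ε t| ≤ |t| := by
  have := intervalIntegral.norm_integral_le_of_norm_le_const (a := 0) (b := t) (f := Mc ε) (C := 1)
    (fun s _ => by rw [Real.norm_of_nonneg (Mc_nonneg ε s)]; exact Mc_le ε s)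
  simpa [Ph] using this

lemma Ph_zero {ε t : ℝ} (hε : 0 < ε) (h : |t| ≤ ε) : Ph ε t = 0 := by
  unfold Ph
  rw [intervalIntegral.integral_congr (g := fun _ => 0), intervalIntegral.integral_zero]
  intro s hs
  refine Mc_zero hε (le_trans ?_ h)
  rw [Set.mem_uIcc] at hs
  rcases hs with hs | hs
  · rw [abs_of_nonneg hs.1, abs_of_nonneg (hs.1.trans hs.2)]; exact hs.2
  · rw [abs_of_nonpos hs.2, abs_of_nonpos (hs.1.trans hs.2)]; linarith

lemma Ph_tendsto (t : ℝ) : Tendsto (fun n => Ph (sqn n) t) atTop (𝓝 t) := by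
  have h : Tendsto (fun n => ∫ s in (0:ℝ)..t, Mc (sqn n) s) atTop (𝓝 (∫ s in (0:ℝ)..t, (1:ℝ))) := by
    refine intervalIntegral.tendsto_integral_filter_of_dominated_convergence (fun _ => 1)
      (Eventually.of_forall fun n => (Mc_cont _).aestronglyMeasurable)
      (Eventually.of_forall fun n => Eventually.of_forall fun s _ => ?_) (by simp) ?_
    · rw [Real.norm_of_nonneg (Mc_nonneg _ s)]; exact Mc_le _ s
    · have : ∀ᵐ s : ℝ, s ∉ ({0} : Set ℝ) := compl_mem_ae_iff.2 (measure_singleton 0)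
      filter_upwards [this] with s hs _
      exact Mc_tendsto hs
  simpa [Ph] using h

end

section

variable {Ω : Set E2}

lemma int_of_supp {K : Set E2} {f : E2 → ℝ} (hK : IsCompact K) (hKΩ : K ⊆ Ω)
    (hf : ContinuousOn f Ω) (h0 : ∀ x, x ∉ K → f x = 0) : Integrable f := by
  refine (integrableOn_iff_integrable_of_support_subset (s := K) ?_).1
    ((hf.mono hKΩ).integrableOn_compact hK)
  intro x hx
  by_contra h
  exact hx (h0 x h)

lemma energy_eps (hΩ : IsOpen Ω) (hb : IsBounded Ω) {p : ℝ} (hp : 1 < p) {u : E2 → ℝ}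
    (hu : IsSolution Ω p u) {ε : ℝ} (hε : 0 < ε) :
    Integrable (fun x => Mc ε (u x) * ‖fderiv ℝ u x‖ ^ 2) (volume.restrict Ω) ∧
    ∫ x in Ω, Mc ε (u x) * ‖fderiv ℝ u x‖ ^ 2 = ∫ x in Ω, nl p (u x) * Ph ε (u x) := by
  classical
  obtain ⟨hu2, huc, hlap, hbd⟩ := hu
  obtain ⟨K, hKdef⟩ : ∃ K, K = closure Ω ∩ u ⁻¹' {t | ε ≤ |t|} := ⟨_, rfl⟩
  have hKc : IsCompact K := by
    rw [hKdef]
    exact (hb.isCompact_closure).of_isClosed_subset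
      (huc.preimage_isClosed_of_isClosed isClosed_closure
        (isClosed_le continuous_const continuous_abs)) Set.inter_subset_left
  have hKΩ : K ⊆ Ω := by
    rw [hKdef]
    rintro x ⟨hx, hx2⟩
    by_contra hn
    have : x ∈ frontier Ω := ⟨hx, by rwa [hΩ.interior_eq]⟩
    have h3 : ε ≤ |u x| := hx2
    rw [hbd x this, abs_zero] at h3
    linarith
  have hKsm : ∀ x ∈ Ω, x ∉ K → |u x| ≤ ε := by
    intro x hx hn
    by_contra h
    refine hn ?_
    rw [hKdef]
    exact ⟨subset_closure hx, (not_le.1 h).le⟩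
  obtain ⟨F, hF⟩ : ∃ F, F = Ω.indicator (fun x => Ph ε (u x)) := ⟨_, rfl⟩
  have hFΩ : ∀ x ∈ Ω, F x = Ph ε (u x) := fun x hx => by rw [hF, Set.indicator_of_mem hx]
  have hF0 : ∀ x, x ∉ K → F x = 0 := by
    intro x hx
    by_cases hxΩ : x ∈ Ω
    · rw [hFΩ x hxΩ]; exact Ph_zero hε (hKsm x hxΩ hx)
    · rw [hF, Set.indicator_of_notMem hxΩ]
  have hdu : ∀ x ∈ Ω, HasFDerivAt u (fderiv ℝ u x) x := fun x hx =>
    ((hu2.contDiffAt (hΩ.mem_nhds hx)).differentiableAt (by norm_num)).hasFDerivAt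
  have hFd : ∀ x ∈ Ω, HasFDerivAt F (Mc ε (u x) • fderiv ℝ u x) x := by
    intro x hx
    refine ((Ph_deriv ε (u x)).comp_hasFDerivAt x (hdu x hx)).congr_of_eventuallyEq ?_
    filter_upwards [hΩ.mem_nhds hx] with y hy
    exact hFΩ y hy
  have hFd0 : ∀ x, x ∉ K → HasFDerivAt F (0 : E2 →L[ℝ] ℝ) x := by
    intro x hx
    refine (hasFDerivAt_const (0:ℝ) x).congr_of_eventuallyEq ?_
    filter_upwards [hKc.isClosed.isOpen_compl.mem_nhds hx] with y hy
    exact hF0 y hy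
  have hFdiff : Differentiable ℝ F := by
    intro x
    by_cases hx : x ∈ K
    · exact (hFd x (hKΩ hx)).differentiableAt
    · exact (hFd0 x hx).differentiableAt
  have hfd1 : ContDiffOn ℝ 1 (fun x => fderiv ℝ u x) Ω :=
    ((contDiffOn_succ_iff_fderiv_of_isOpen (n := 1) hΩ).1 (by simpa [one_add_one_eq_two] using hu2)).2.2
  have hg1 : ∀ i, ContDiffOn ℝ 1 (fun x => fderiv ℝ u x (ee i)) Ω := fun i =>
    hfd1.clm_apply contDiffOn_const
  have hts : tsupport F ⊆ K := closure_minimal (by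
    intro x hx; by_contra h; exact hx (hF0 x h)) hKc.isClosed
  have hpc : ∀ i, ContinuousOn (fun x => fderiv ℝ (fun y => fderiv ℝ u y (ee i)) x (ee i)) Ω := by
    intro i
    have := ((contDiffOn_succ_iff_fderiv_of_isOpen (n := 0) hΩ).1 (by simpa using hg1 i)).2.2
    exact this.continuousOn.clm_apply continuousOn_const
  have hFc : ContinuousOn F Ω := hFdiff.continuous.continuousOn
  have hfF : ∀ i, ∀ x, fderiv ℝ F x (ee i) = if x ∈ Ω then Mc ε (u x) * fderiv ℝ u x (ee i) else 0 := by
    intro i x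
    split_ifs with hx
    · rw [(hFd x hx).fderiv]; simp
    · rw [(hFd0 x (fun h => hx (hKΩ h))).fderiv]; simp
  have hI1 : ∀ i, Integrable (fun x => fderiv ℝ (fun y => fderiv ℝ u y (ee i)) x (ee i) * F x) := fun i =>
    int_of_supp hKc hKΩ ((hpc i).mul hFc) (fun x hx => by rw [hF0 x hx, mul_zero])
  have huΩ : ContinuousOn u Ω := hu2.continuousOn
  have hI2 : ∀ i, Integrable (fun x => fderiv ℝ u x (ee i) * fderiv ℝ F x (ee i)) := fun i => by
    refine int_of_supp hKc hKΩ ?_ (fun x hx => by rw [(hFd0 x hx).fderiv]; simp)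
    have : ContinuousOn (fun x => fderiv ℝ u x (ee i) * (Mc ε (u x) * fderiv ℝ u x (ee i))) Ω :=
      (hg1 i).continuousOn.mul (((Mc_cont ε).comp_continuousOn huΩ).mul (hg1 i).continuousOn)
    refine this.congr fun x hx => ?_
    simp only [hfF, if_pos hx]
  have hI3 : ∀ i, Integrable (fun x => fderiv ℝ u x (ee i) * F x) := fun i =>
    int_of_supp hKc hKΩ ((hg1 i).continuousOn.mul hFc) (fun x hx => by rw [hF0 x hx, mul_zero])
  have key : ∀ i, ∫ x, fderiv ℝ u x (ee i) * fderiv ℝ F x (ee i)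
      = - ∫ x, fderiv ℝ (fun y => fderiv ℝ u y (ee i)) x (ee i) * F x := fun i =>
    integral_mul_fderiv_eq_neg_fderiv_mul_of_integrable (hI1 i) (hI2 i) (hI3 i)
      (fun x hx => ((hg1 i).contDiffAt (hΩ.mem_nhds (hKΩ (hts hx)))).differentiableAt (by norm_num))
      (fun x _ => hFdiff x)
  have hsum := Finset.sum_congr (s₁ := (Finset.univ : Finset (Fin 2))) rfl fun i _ => key i
  rw [Finset.sum_neg_distrib, ← integral_finsetSum _ fun i _ => hI2 i, ← integral_finsetSum _ fun i _ => hI1 i] at hsum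
  have e1 : (fun x => ∑ i, fderiv ℝ u x (ee i) * fderiv ℝ F x (ee i))
      = Ω.indicator (fun x => Mc ε (u x) * ‖fderiv ℝ u x‖ ^ 2) := by
    funext x
    by_cases hx : x ∈ Ω
    · rw [Set.indicator_of_mem hx, norm_sq_clm, Finset.mul_sum]
      refine Finset.sum_congr rfl fun i _ => ?_
      rw [hfF, if_pos hx]; ring
    · rw [Set.indicator_of_notMem hx]
      refine Finset.sum_eq_zero fun i _ => ?_
      rw [hfF, if_neg hx, mul_zero]
  have e2 : (fun x => ∑ i, fderiv ℝ (fun y => fderiv ℝ u y (ee i)) x (ee i) * F x)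
      = Ω.indicator (fun x => - (nl p (u x) * Ph ε (u x))) := by
    funext x
    by_cases hx : x ∈ Ω
    · rw [Set.indicator_of_mem hx, ← Finset.sum_mul, hFΩ x hx]
      have := hlap x hx
      have h2 : lap u x = ∑ i, fderiv ℝ (fun y => fderiv ℝ u y (ee i)) x (ee i) := rfl
      rw [← h2]
      unfold nl
      rw [← this]; ring
    · rw [Set.indicator_of_notMem hx]
      refine Finset.sum_eq_zero fun i _ => ?_
      rw [hF, Set.indicator_of_notMem hx, mul_zero]
  have hIntg := integrable_finsetSum (Finset.univ : Finset (Fin 2)) fun i _ => hI2 i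
  rw [e1, e2, integral_indicator hΩ.measurableSet, integral_indicator hΩ.measurableSet, integral_neg, neg_neg] at hsum
  refine ⟨?_, hsum⟩
  rw [e1, integrable_indicator_iff hΩ.measurableSet] at hIntg
  exact hIntg

lemma sol_bdd (hb : IsBounded Ω) {p : ℝ} {u : E2 → ℝ} (hu : IsSolution Ω p u) :
    ∃ C, 0 ≤ C ∧ ∀ x ∈ closure Ω, |u x| ≤ C := by
  obtain ⟨C, hC⟩ := hb.isCompact_closure.exists_bound_of_continuousOn hu.2.1
  exact ⟨max C 0, le_max_right _ _, fun x hx => (hC x hx).trans (le_max_left _ _)⟩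

lemma energy_id (hΩ : IsOpen Ω) (hb : IsBounded Ω) {p : ℝ} (hp : 1 < p) {u : E2 → ℝ}
    (hu : IsSolution Ω p u) : ∫ x in Ω, ‖fderiv ℝ u x‖ ^ 2 = ∫ x in Ω, |u x| ^ (p + 1) := by
  obtain ⟨C, hC0, hC⟩ := sol_bdd hb hu
  haveI : IsFiniteMeasure (volume.restrict Ω) := ⟨by simpa using hb.measure_lt_top⟩
  have huΩ : ContinuousOn u Ω := hu.1.continuousOn
  have hnlc : Continuous (nl p) := (contDiff_nl hp).continuous
  have h1 : Tendsto (fun n => ∫ x in Ω, nl p (u x) * Ph (sqn n) (u x)) atTop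
      (𝓝 (∫ x in Ω, |u x| ^ (p + 1))) := by
    refine tendsto_integral_of_dominated_convergence (fun _ => C ^ (p + 1)) (fun n => ?_)
      (integrable_const _) (fun n => ?_) ?_
    · exact ((hnlc.comp_continuousOn huΩ).mul ((Ph_C1 _).continuous.comp_continuousOn huΩ)).aestronglyMeasurable hΩ.measurableSet
    · refine (ae_restrict_iff' hΩ.measurableSet).2 (Eventually.of_forall fun x hx => ?_)
      have hx1 := hC x (subset_closure hx)
      calc ‖nl p (u x) * Ph (sqn n) (u x)‖ = |nl p (u x)| * |Ph (sqn n) (u x)| := by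
            rw [Real.norm_eq_abs, abs_mul]
        _ ≤ |nl p (u x)| * |u x| := mul_le_mul_of_nonneg_left (Ph_le _ _) (abs_nonneg _)
        _ = |u x| ^ (p + 1) := by rw [← abs_mul, nl_mul_self hp, abs_of_nonneg (by positivity)]
        _ ≤ C ^ (p + 1) := by gcongr
    · refine Eventually.of_forall fun x => ?_
      rw [← nl_mul_self hp]
      exact (Ph_tendsto _).const_mul _
  have hm : AEMeasurable (fun x => ‖fderiv ℝ u x‖ ^ 2) (volume.restrict Ω) := by
    have : ContinuousOn (fun x => fderiv ℝ u x) Ω := hu.1.continuousOn_fderiv_of_isOpen hΩ (by norm_num)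
    exact ((this.norm).pow 2).aemeasurable hΩ.measurableSet
  have h2 : Tendsto (fun n => ∫⁻ x in Ω, ENNReal.ofReal (Mc (sqn n) (u x) * ‖fderiv ℝ u x‖ ^ 2)) atTop
      (𝓝 (∫⁻ x in Ω, ENNReal.ofReal (‖fderiv ℝ u x‖ ^ 2))) := by
    refine lintegral_tendsto_of_tendsto_of_monotone (fun n => ?_) ?_ ?_
    · exact ((((Mc_cont _).comp_continuousOn huΩ).aemeasurable hΩ.measurableSet).mul hm).ennreal_ofReal
    · refine Eventually.of_forall fun x n m hnm => ENNReal.ofReal_le_ofReal ?_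
      have := Mc_mono (sqn_pos m) (sqn_anti hnm) (u x)
      exact mul_le_mul_of_nonneg_right this (by positivity)
    · filter_upwards [fderiv_zero_on_zeros hΩ hu.1] with x hx
      refine ENNReal.tendsto_ofReal ?_
      by_cases h : u x = 0
      · rw [hx h]; simp
      · simpa using (Mc_tendsto h).mul_const (‖fderiv ℝ u x‖ ^ 2)
  have h3 : Tendsto (fun n => ∫⁻ x in Ω, ENNReal.ofReal (Mc (sqn n) (u x) * ‖fderiv ℝ u x‖ ^ 2)) atTop
      (𝓝 (ENNReal.ofReal (∫ x in Ω, |u x| ^ (p + 1)))) := by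
    refine (ENNReal.tendsto_ofReal h1).congr fun n => ?_
    obtain ⟨hi, he⟩ := energy_eps hΩ hb hp hu (sqn_pos n)
    rw [← he, ofReal_integral_eq_lintegral_ofReal hi]
    exact Eventually.of_forall fun x => mul_nonneg (Mc_nonneg _ _) (by positivity)
  have h4 := tendsto_nhds_unique h2 h3
  rw [integral_eq_lintegral_of_nonneg_ae (Eventually.of_forall fun x => by positivity) hm.aestronglyMeasurable, h4,
    ENNReal.toReal_ofReal (integral_nonneg fun x => by positivity)]

lemma energy_sol (hΩ : IsOpen Ω) (hb : IsBounded Ω) {p : ℝ} (hp : 1 < p) {u : E2 → ℝ}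
    (hu : IsSolution Ω p u) : energy Ω p u = (1 / 2 - 1 / (p + 1)) * ∫ x in Ω, |u x| ^ (p + 1) := by
  unfold energy
  rw [energy_id hΩ hb hp hu]; ring

end

section

lemma gA_le {q A α s : ℝ} (hq : 1 < q) (hq2 : q < 2) (hA : 0 < A) (hα : 0 < α) (hs : 0 ≤ s) :
    s ^ q * A / q - s ^ 2 * α / 2 ≤ (1 / q - 1 / 2) * (A ^ (1 + q / (2 - q)) * α ^ (-(q / (2 - q)))) := by
  have h2q : 0 < 2 - q := by linarith
  have h := Real.geom_mean_le_arith_mean2_weighted (w₁ := q / 2) (w₂ := 1 - q / 2)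
    (p₁ := s ^ 2 * α) (p₂ := A ^ (1 + q / (2 - q)) * α ^ (-(q / (2 - q))))
    (by positivity) (by linarith) (by positivity) (by positivity) (by ring)
  have e1 : (s ^ 2 * α) ^ (q / 2) = s ^ q * α ^ (q / 2) := by
    rw [Real.mul_rpow (by positivity) hα.le, ← Real.rpow_natCast s 2, ← Real.rpow_mul hs]
    congr 2; push_cast; ring
  have e2 : (A ^ (1 + q / (2 - q)) * α ^ (-(q / (2 - q)))) ^ (1 - q / 2) = A * α ^ (-(q / 2)) := by
    rw [Real.mul_rpow (by positivity) (by positivity), ← Real.rpow_mul hA.le, ← Real.rpow_mul hα.le]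
    have a1 : (1 + q / (2 - q)) * (1 - q / 2) = 1 := by field_simp; ring
    have a2 : -(q / (2 - q)) * (1 - q / 2) = -(q / 2) := by field_simp
    rw [a1, a2, Real.rpow_one]
  have e3 : s ^ q * α ^ (q / 2) * (A * α ^ (-(q / 2))) = s ^ q * A := by
    have : α ^ (q / 2) * α ^ (-(q / 2)) = 1 := by
      rw [← Real.rpow_add hα]; simp
    linear_combination (s ^ q * A) * this
  rw [e1, e2, e3] at h
  have h3 : s ^ q * A / q ≤ (q / 2 * (s ^ 2 * α) + (1 - q / 2) * (A ^ (1 + q / (2 - q)) * α ^ (-(q / (2 - q))))) / q := by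
    gcongr
  refine (sub_le_sub_right h3 _).trans (le_of_eq ?_)
  field_simp; ring

lemma gA_atBot {q A α : ℝ} (hq : 1 < q) (hq2 : q < 2) (hα : 0 < α) :
    Tendsto (fun s : ℝ => s ^ q * A / q - s ^ 2 * α / 2) atTop atBot := by
  have h1 : Tendsto (fun s : ℝ => s ^ (2 - q)) atTop atTop := tendsto_rpow_atTop (by linarith)
  have h2 : Tendsto (fun s : ℝ => A / q - s ^ (2 - q) * (α / 2)) atTop atBot := by
    have := (h1.atTop_mul_const (by positivity : 0 < α / 2))
    have h3 := tendsto_neg_atTop_atBot.comp this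
    have h4 := tendsto_atBot_add_const_left atTop (A / q) h3
    simpa [sub_eq_add_neg, Function.comp_def] using h4
  have h3 := (tendsto_rpow_atTop (by linarith : 0 < q)).atTop_mul_atBot₀ h2
  refine h3.congr' ?_
  filter_upwards [eventually_gt_atTop 0] with s hs
  have : s ^ q * s ^ (2 - q) = s ^ 2 := by
    rw [← Real.rpow_add hs, ← Real.rpow_natCast]; congr 1; push_cast; ring
  linear_combination (-α / 2) * this

lemma lemS_aux {q A c Qa t D : ℝ} (hq : 1 < q) (hq2 : q < 2) (hA : 0 < A) (hc : 0 ≤ c) (ht : 0 ≤ t) (hQ : 0 < Qa)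
    (hD : 0 < D) : ∃ s, 0 < s ∧ s < D ∧ 0 < s ^ q * A / q - s ^ 2 * Qa / 2 + s * t * c := by
  have h1 : Tendsto (fun s : ℝ => s ^ (2 - q) * (Qa / 2)) (𝓝[>] 0) (𝓝 0) := by
    have : ContinuousAt (fun s : ℝ => s ^ (2 - q)) 0 := continuousAt_id.rpow_const (Or.inr (by linarith))
    have h := this.tendsto
    rw [Real.zero_rpow (by linarith)] at h
    simpa using (h.mono_left (nhdsWithin_le_nhds (s := Set.Ioi 0))).mul_const (Qa / 2)
  have h2 : ∀ᶠ s in 𝓝[>] (0:ℝ), s ^ (2 - q) * (Qa / 2) < A / q := h1.eventually_lt_const (by positivity)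
  have h3 : ∀ᶠ s in 𝓝[>] (0:ℝ), s < D := nhdsWithin_le_nhds (Iio_mem_nhds hD)
  obtain ⟨s, h2, h3, hs⟩ := (h2.and (h3.and self_mem_nhdsWithin)).exists
  have hs : 0 < s := hs
  refine ⟨s, hs, h3, ?_⟩
  have e : s ^ q * s ^ (2 - q) = s ^ 2 := by
    rw [← Real.rpow_add hs, ← Real.rpow_natCast]; congr 1; push_cast; ring
  have h4 : 0 < s ^ q * (A / q - s ^ (2 - q) * (Qa / 2)) := mul_pos (by positivity) (by linarith)
  have h5 : 0 ≤ s * t * c := by positivity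
  have : s ^ q * (A / q - s ^ (2 - q) * (Qa / 2)) = s ^ q * A / q - s ^ 2 * Qa / 2 := by
    linear_combination (-Qa / 2) * e
  linarith

lemma lemS {q A B Qa Qb c : ℝ} (hq : 1 < q) (hq2 : q < 2) (hA : 0 < A) (hB : 0 < B) (hc : 0 ≤ c)
    (ha : 0 < Qa - c) (hb : 0 < Qb - c) :
    ∃ s t : ℝ, 0 < s ∧ 0 < t ∧ s ^ q * A = s ^ 2 * Qa - s * t * c ∧ t ^ q * B = t ^ 2 * Qb - s * t * c ∧
      s ^ q * A + t ^ q * B ≤ A ^ (1 + q / (2 - q)) * (Qa - c) ^ (-(q / (2 - q))) +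
        B ^ (1 + q / (2 - q)) * (Qb - c) ^ (-(q / (2 - q))) := by
  obtain ⟨f, hf⟩ : ∃ f : ℝ × ℝ → ℝ, f = fun z => (z.1 ^ q * A + z.2 ^ q * B) / q
    - (z.1 ^ 2 * Qa - 2 * z.1 * z.2 * c + z.2 ^ 2 * Qb) / 2 := ⟨_, rfl⟩
  have hfc : Continuous f := by
    rw [hf]
    have h1 : Continuous fun z : ℝ × ℝ => z.1 ^ q := continuous_fst.rpow_const fun _ => Or.inr (by linarith)
    have h2 : Continuous fun z : ℝ × ℝ => z.2 ^ q := continuous_snd.rpow_const fun _ => Or.inr (by linarith)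
    fun_prop
  obtain ⟨cA, hcA⟩ : ∃ cA, cA = (1 / q - 1 / 2) * (A ^ (1 + q / (2 - q)) * (Qa - c) ^ (-(q / (2 - q)))) := ⟨_, rfl⟩
  obtain ⟨cB, hcB⟩ : ∃ cB, cB = (1 / q - 1 / 2) * (B ^ (1 + q / (2 - q)) * (Qb - c) ^ (-(q / (2 - q)))) := ⟨_, rfl⟩
  have hle : ∀ s t, f (s, t) ≤ (s ^ q * A / q - s ^ 2 * (Qa - c) / 2) + (t ^ q * B / q - t ^ 2 * (Qb - c) / 2) := by
    intro s t
    have h1 : 0 ≤ (s - t) ^ 2 * c := by positivity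
    have e : (s ^ q * A / q - s ^ 2 * (Qa - c) / 2) + (t ^ q * B / q - t ^ 2 * (Qb - c) / 2) - f (s, t)
      = (s - t) ^ 2 * c / 2 := by rw [hf]; ring
    linarith
  have gA : ∀ s, 0 ≤ s → s ^ q * A / q - s ^ 2 * (Qa - c) / 2 ≤ cA := fun s hs => by
    rw [hcA]; exact gA_le hq hq2 hA ha hs
  have gB : ∀ s, 0 ≤ s → s ^ q * B / q - s ^ 2 * (Qb - c) / 2 ≤ cB := fun s hs => by
    rw [hcB]; exact gA_le hq hq2 hB hb hs
  obtain ⟨L, hL1, hL2, hL0⟩ := (((gA_atBot (A := A) hq hq2 ha).eventually_le_atBot (-cB - 1)).and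
    (((gA_atBot (A := B) hq hq2 hb).eventually_le_atBot (-cA - 1)).and (eventually_gt_atTop 0))).exists
  have hcomp : IsCompact ((Set.Icc 0 L) ×ˢ (Set.Icc 0 L) : Set (ℝ × ℝ)) := isCompact_Icc.prod isCompact_Icc
  have h00 : ((0:ℝ), (0:ℝ)) ∈ ((Set.Icc 0 L) ×ˢ (Set.Icc 0 L) : Set (ℝ × ℝ)) := by
    simp [hL0.le]
  obtain ⟨⟨s, t⟩, hst, hmax⟩ := hcomp.exists_isMaxOn ⟨_, h00⟩ hfc.continuousOn
  have hmax' : ∀ s' t', 0 ≤ s' → s' ≤ L → 0 ≤ t' → t' ≤ L → f (s', t') ≤ f (s, t) :=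
    fun s' t' h1 h2 h3 h4 => hmax (show (s', t') ∈ _ from ⟨⟨h1, h2⟩, ⟨h3, h4⟩⟩)
  have hs0 : 0 ≤ s := hst.1.1
  have hsL : s ≤ L := hst.1.2
  have ht0 : 0 ≤ t := hst.2.1
  have htL : t ≤ L := hst.2.2
  have hfz : f (0, 0) = 0 := by rw [hf]; simp [Real.zero_rpow (by linarith : q ≠ 0)]
  have hf0 : 0 ≤ f (s, t) := by
    rw [← hfz]; exact hmax' 0 0 le_rfl hL0.le le_rfl hL0.le
  have hsL' : s < L := by
    refine lt_of_le_of_ne hsL fun h => ?_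
    have h1 := hle s t
    have h2 := gB t ht0
    rw [h] at h1 hf0
    linarith
  have htL' : t < L := by
    refine lt_of_le_of_ne htL fun h => ?_
    have h1 := hle s t
    have h2 := gA s hs0
    rw [h] at h1 hf0
    linarith
  have hspos : 0 < s := by
    refine lt_of_le_of_ne hs0 fun h => ?_
    obtain ⟨s', h1, h2, h3⟩ := lemS_aux hq hq2 hA hc ht0 (by linarith : 0 < Qa) hL0
    have h4 := hmax' s' t h1.le h2.le ht0 htL
    have e : f (s', t) - f (0, t) = s' ^ q * A / q - s' ^ 2 * Qa / 2 + s' * t * c := by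
      rw [hf]; simp only [Real.zero_rpow (by linarith : q ≠ 0)]; ring
    rw [← h] at h4
    linarith
  have htpos : 0 < t := by
    refine lt_of_le_of_ne ht0 fun h => ?_
    obtain ⟨s', h1, h2, h3⟩ := lemS_aux hq hq2 hB hc hs0 (by linarith : 0 < Qb) hL0
    have h4 := hmax' s s' hs0 hsL h1.le h2.le
    have e : f (s, s') - f (s, 0) = s' ^ q * B / q - s' ^ 2 * Qb / 2 + s' * s * c := by
      rw [hf]; simp only [Real.zero_rpow (by linarith : q ≠ 0)]; ring
    rw [← h] at h4
    linarith
  have hds : s ^ (q - 1) * A - (s * Qa - t * c) = 0 := by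
    have hd : HasDerivAt (fun x => f (x, t)) (s ^ (q - 1) * A - (s * Qa - t * c)) s := by
      rw [hf]
      have h1 : HasDerivAt (fun x : ℝ => x ^ q) (q * s ^ (q - 1)) s := Real.hasDerivAt_rpow_const (Or.inl hspos.ne')
      have h2 := (((h1.mul_const A).add_const (t ^ q * B)).div_const q).sub
        (((((hasDerivAt_id s).pow 2).mul_const Qa).sub
          ((((hasDerivAt_id s).const_mul 2).mul_const t).mul_const c)).add_const (t ^ 2 * Qb) |>.div_const 2)
      refine h2.congr_deriv ?_
      simp; field_simp; try ring
    refine IsLocalMax.hasDerivAt_eq_zero ?_ hd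
    filter_upwards [Ioo_mem_nhds hspos hsL'] with x hx
    exact hmax' x t hx.1.le hx.2.le ht0 htL
  have hdt : t ^ (q - 1) * B - (t * Qb - s * c) = 0 := by
    have hd : HasDerivAt (fun x => f (s, x)) (t ^ (q - 1) * B - (t * Qb - s * c)) t := by
      rw [hf]
      have h1 : HasDerivAt (fun x : ℝ => x ^ q) (q * t ^ (q - 1)) t := Real.hasDerivAt_rpow_const (Or.inl htpos.ne')
      have h2 := (((h1.mul_const B).const_add (s ^ q * A)).div_const q).sub
        ((((((hasDerivAt_id t).const_mul (2 * s)).mul_const c).const_sub (s ^ 2 * Qa))).add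
          (((hasDerivAt_id t).pow 2).mul_const Qb) |>.div_const 2)
      refine h2.congr_deriv ?_
      simp; field_simp; try ring
    refine IsLocalMax.hasDerivAt_eq_zero ?_ hd
    filter_upwards [Ioo_mem_nhds htpos htL'] with x hx
    exact hmax' s x hs0 hsL hx.1.le hx.2.le
  have es : s ^ q = s * s ^ (q - 1) := by
    conv_rhs => rw [← Real.rpow_one s]
    rw [← Real.rpow_mul hs0, ← Real.rpow_add hspos]; congr 1; ring
  have et : t ^ q = t * t ^ (q - 1) := by
    conv_rhs => rw [← Real.rpow_one t]
    rw [← Real.rpow_mul ht0, ← Real.rpow_add htpos]; congr 1; ring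
  have E1 : s ^ q * A = s ^ 2 * Qa - s * t * c := by rw [es]; linear_combination s * hds
  have E2 : t ^ q * B = t ^ 2 * Qb - s * t * c := by rw [et]; linear_combination t * hdt
  refine ⟨s, t, hspos, htpos, E1, E2, ?_⟩
  have v : f (s, t) = (1 / q - 1 / 2) * (s ^ q * A + t ^ q * B) := by
    rw [hf]; simp only
    linear_combination (1 / 2) * E1 + (1 / 2) * E2
  have hq' : 0 < 1 / q - 1 / 2 := by
    rw [sub_pos]; exact one_div_lt_one_div_of_lt (by linarith) hq2
  have := (hle s t).trans (add_le_add (gA s hs0) (gB t ht0))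
  rw [v, hcA, hcB, ← mul_add] at this
  exact le_of_mul_le_mul_left this hq'

end

section

variable {Ω : Set E2}

/-- bounded measurable functions vanishing off Ω -/
structure AB (Ω : Set E2) (f : E2 → ℝ) : Prop where
  meas : Measurable f
  bd : ∃ F, 0 ≤ F ∧ ∀ x, |f x| ≤ F
  out : ∀ x, x ∉ Ω → f x = 0

lemma AB.sub {f g : E2 → ℝ} (hf : AB Ω f) (hg : AB Ω g) : AB Ω (fun x => f x - g x) := by
  obtain ⟨F, hF, h1⟩ := hf.bd
  obtain ⟨G, hG, h2⟩ := hg.bd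
  refine ⟨hf.meas.sub hg.meas, ⟨F + G, by linarith, fun x => (abs_sub _ _).trans (add_le_add (h1 x) (h2 x))⟩, fun x hx => ?_⟩
  rw [hf.out x hx, hg.out x hx, sub_zero]

lemma AB.add {f g : E2 → ℝ} (hf : AB Ω f) (hg : AB Ω g) : AB Ω (fun x => f x + g x) := by
  obtain ⟨F, hF, h1⟩ := hf.bd
  obtain ⟨G, hG, h2⟩ := hg.bd
  refine ⟨hf.meas.add hg.meas, ⟨F + G, by linarith, fun x => (abs_add_le _ _).trans (add_le_add (h1 x) (h2 x))⟩, fun x hx => ?_⟩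
  rw [hf.out x hx, hg.out x hx, add_zero]

lemma AB.mul {f g : E2 → ℝ} (hf : AB Ω f) (hg : AB Ω g) : AB Ω (fun x => f x * g x) := by
  obtain ⟨F, hF, h1⟩ := hf.bd
  obtain ⟨G, hG, h2⟩ := hg.bd
  refine ⟨hf.meas.mul hg.meas, ⟨F * G, by positivity, fun x => by rw [abs_mul]; exact mul_le_mul (h1 x) (h2 x) (abs_nonneg _) hF⟩, fun x hx => ?_⟩
  rw [hf.out x hx, zero_mul]

lemma AB.cmul {f : E2 → ℝ} (c : ℝ) (hf : AB Ω f) : AB Ω (fun x => c * f x) := by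
  obtain ⟨F, hF, h1⟩ := hf.bd
  refine ⟨hf.meas.const_mul c, ⟨|c| * F, by positivity, fun x => by rw [abs_mul]; gcongr; exact h1 x⟩, fun x hx => ?_⟩
  rw [hf.out x hx, mul_zero]

/-- domination -/
lemma AB.of_le {f g : E2 → ℝ} (hf : AB Ω f) (hg : Measurable g) (h : ∀ x, |g x| ≤ |f x|) : AB Ω g := by
  obtain ⟨F, hF, h1⟩ := hf.bd
  refine ⟨hg, ⟨F, hF, fun x => (h x).trans (h1 x)⟩, fun x hx => ?_⟩
  have := h x
  rw [hf.out x hx, abs_zero] at this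
  exact abs_eq_zero.1 (le_antisymm this (abs_nonneg _))

lemma AB.rpow {f : E2 → ℝ} (hf : AB Ω f) (h0 : ∀ x, 0 ≤ f x) {m : ℝ} (hm : 0 < m) : AB Ω (fun x => f x ^ m) := by
  obtain ⟨F, hF, h1⟩ := hf.bd
  refine ⟨hf.meas.pow_const m, ⟨F ^ m, by positivity, fun x => ?_⟩, fun x hx => ?_⟩
  · rw [abs_of_nonneg (Real.rpow_nonneg (h0 x) m)]
    exact Real.rpow_le_rpow (h0 x) ((le_abs_self _).trans (h1 x)) hm.le
  · rw [hf.out x hx, Real.zero_rpow hm.ne']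

lemma AB.pos {f : E2 → ℝ} (hf : AB Ω f) : AB Ω (fun x => max (f x) 0) :=
  hf.of_le (hf.meas.max measurable_const) fun x => by
    rcases le_total (f x) 0 with h | h <;> simp [h]

lemma AB.neg {f : E2 → ℝ} (hf : AB Ω f) : AB Ω (fun x => - f x) :=
  hf.of_le hf.meas.neg fun x => by simp

lemma AB.abs {f : E2 → ℝ} (hf : AB Ω f) : AB Ω (fun x => |f x|) :=
  hf.of_le hf.meas.abs fun x => by simp

lemma AB.integrable {f : E2 → ℝ} (hf : AB Ω f) (hΩ : IsOpen Ω) (hb : IsBounded Ω) : Integrable f := by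
  obtain ⟨F, hF, h1⟩ := hf.bd
  refine (integrableOn_iff_integrable_of_support_subset (s := Ω) ?_).1 ?_
  · intro x hx; by_contra h; exact hx (hf.out x h)
  · exact Measure.integrableOn_of_bounded (M := F) hb.measure_lt_top.ne hf.meas.aestronglyMeasurable
      (Eventually.of_forall fun x => h1 x)

lemma AB.indicator {f : E2 → ℝ} (hf : AB Ω f) {s : Set E2} (hs : MeasurableSet s) : AB Ω (s.indicator f) :=
  hf.of_le (hf.meas.indicator hs) fun x => by
    by_cases h : x ∈ s <;> simp [h]

lemma AB.toBM {f : E2 → ℝ} (hf : AB Ω f) {R : ℝ} (hR : Ω ⊆ ball 0 R) : ∃ F, BM f F R := by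
  obtain ⟨F, hF, h1⟩ := hf.bd
  exact ⟨F, hf.meas, h1, fun y hy => hf.out y fun h => hy (hR h)⟩

lemma kk_mul_int (hΩ : IsOpen Ω) (hb : IsBounded Ω) (gd : GreenData Ω) {f : E2 → ℝ} (hf : AB Ω f) (x : E2) :
    Integrable (fun y => kk gd x y * f y) := by
  obtain ⟨F, hF, h1⟩ := hf.bd
  exact (kk_integrable hΩ hb gd x).mul_bdd (c := F) hf.meas.aestronglyMeasurable (Eventually.of_forall h1)

lemma KK_sub (hΩ : IsOpen Ω) (hb : IsBounded Ω) (gd : GreenData Ω) {f g : E2 → ℝ} (hf : AB Ω f) (hg : AB Ω g) (x : E2) :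
    KK gd (fun y => f y - g y) x = KK gd f x - KK gd g x := by
  unfold KK
  rw [← integral_sub (kk_mul_int hΩ hb gd hf x) (kk_mul_int hΩ hb gd hg x)]
  simp only [mul_sub]

lemma KK_add (hΩ : IsOpen Ω) (hb : IsBounded Ω) (gd : GreenData Ω) {f g : E2 → ℝ} (hf : AB Ω f) (hg : AB Ω g) (x : E2) :
    KK gd (fun y => f y + g y) x = KK gd f x + KK gd g x := by
  unfold KK
  rw [← integral_add (kk_mul_int hΩ hb gd hf x) (kk_mul_int hΩ hb gd hg x)]
  simp only [mul_add]

lemma KK_cmul (gd : GreenData Ω) (c : ℝ) (f : E2 → ℝ) (x : E2) :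
    KK gd (fun y => c * f y) x = c * KK gd f x := by
  unfold KK
  rw [← integral_const_mul]
  refine integral_congr_ae (Eventually.of_forall fun y => ?_)
  simp only; ring

lemma KK_nonneg (hΩ : IsOpen Ω) (hb : IsBounded Ω) (gd : GreenData Ω) {f : E2 → ℝ} (h0 : ∀ x, 0 ≤ f x) (x : E2) :
    0 ≤ KK gd f x := integral_nonneg fun y => mul_nonneg (kk_nonneg hΩ hb gd x y) (h0 y)

lemma KK_mono (hΩ : IsOpen Ω) (hb : IsBounded Ω) (gd : GreenData Ω) {f g : E2 → ℝ} (hf : AB Ω f) (hg : AB Ω g)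
    (h : ∀ x, f x ≤ g x) (x : E2) : KK gd f x ≤ KK gd g x :=
  integral_mono (kk_mul_int hΩ hb gd hf x) (kk_mul_int hΩ hb gd hg x)
    fun y => mul_le_mul_of_nonneg_left (h y) (kk_nonneg hΩ hb gd x y)

lemma kk_int_bdd (hΩ : IsOpen Ω) (hb : IsBounded Ω) (gd : GreenData Ω) : ∃ M, 0 ≤ M ∧ ∀ x, ∫ y, kk gd x y ≤ M := by
  obtain ⟨M, hM, h⟩ := kk_rpow_int hΩ hb gd (m := 1) one_pos
  exact ⟨M, hM, fun x => by simpa using (h x).2⟩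

lemma KK_AB (hΩ : IsOpen Ω) (hb : IsBounded Ω) (gd : GreenData Ω) {f : E2 → ℝ} (hf : AB Ω f) : AB Ω (KK gd f) := by
  obtain ⟨F, hF, h1⟩ := hf.bd
  obtain ⟨M, hM, h⟩ := kk_int_bdd hΩ hb gd
  refine ⟨?_, ⟨F * M, by positivity, fun x => (KK_abs_le hΩ hb gd h1 x).trans (by gcongr; exact h x)⟩, fun x hx => KK_out gd f hx⟩
  have : StronglyMeasurable (fun q : E2 × E2 => kk gd q.1 q.2 * f q.2) :=
    ((kk_measurable hΩ gd).mul (hf.meas.comp measurable_snd)).stronglyMeasurable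
  exact this.integral_prod_right.measurable

/-- the bilinear form -/
def QQ (gd : GreenData Ω) (f g : E2 → ℝ) : ℝ := ∫ x, f x * KK gd g x

lemma QQ_int (hΩ : IsOpen Ω) (hb : IsBounded Ω) (gd : GreenData Ω) {f g : E2 → ℝ} (hf : AB Ω f) (hg : AB Ω g) :
    Integrable (fun x => f x * KK gd g x) := (hf.mul (KK_AB hΩ hb gd hg)).integrable hΩ hb

lemma QQ_prod_int (hΩ : IsOpen Ω) (hb : IsBounded Ω) (gd : GreenData Ω) {f g : E2 → ℝ} (hf : AB Ω f) (hg : AB Ω g) :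
    Integrable (fun q : E2 × E2 => f q.1 * (kk gd q.1 q.2 * g q.2)) (volume.prod volume) := by
  have hm : Measurable (fun q : E2 × E2 => f q.1 * (kk gd q.1 q.2 * g q.2)) :=
    (hf.meas.comp measurable_fst).mul ((kk_measurable hΩ gd).mul (hg.meas.comp measurable_snd))
  rw [integrable_prod_iff hm.aestronglyMeasurable]
  refine ⟨Eventually.of_forall fun x => (kk_mul_int hΩ hb gd hg x).const_mul (f x), ?_⟩
  refine (QQ_int hΩ hb gd hf.abs hg.abs).congr (Eventually.of_forall fun x => ?_)
  simp only [KK]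
  rw [← integral_const_mul]
  refine integral_congr_ae (Eventually.of_forall fun y => ?_)
  simp only [norm_mul, Real.norm_eq_abs, abs_of_nonneg (kk_nonneg hΩ hb gd x y)]

lemma QQ_eq (gd : GreenData Ω) (f g : E2 → ℝ) : QQ gd f g = ∫ x, ∫ y, f x * (kk gd x y * g y) := by
  unfold QQ KK
  simp only [integral_const_mul]

lemma QQ_symm (hΩ : IsOpen Ω) (hb : IsBounded Ω) (gd : GreenData Ω) {f g : E2 → ℝ} (hf : AB Ω f) (hg : AB Ω g) :
    QQ gd f g = QQ gd g f := by
  rw [QQ_eq, QQ_eq, integral_integral_swap (f := fun x y => f x * (kk gd x y * g y)) (QQ_prod_int hΩ hb gd hf hg)]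
  refine integral_congr_ae (Eventually.of_forall fun y => integral_congr_ae (Eventually.of_forall fun x => ?_))
  simp only [kk_symm gd x y]; ring

lemma QQ_sub_left (hΩ : IsOpen Ω) (hb : IsBounded Ω) (gd : GreenData Ω) {f g h : E2 → ℝ} (hf : AB Ω f) (hg : AB Ω g) (hh : AB Ω h) :
    QQ gd (fun x => f x - g x) h = QQ gd f h - QQ gd g h := by
  unfold QQ
  rw [← integral_sub (QQ_int hΩ hb gd hf hh) (QQ_int hΩ hb gd hg hh)]
  simp only [sub_mul]

lemma QQ_add_left (hΩ : IsOpen Ω) (hb : IsBounded Ω) (gd : GreenData Ω) {f g h : E2 → ℝ} (hf : AB Ω f) (hg : AB Ω g) (hh : AB Ω h) :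
    QQ gd (fun x => f x + g x) h = QQ gd f h + QQ gd g h := by
  unfold QQ
  rw [← integral_add (QQ_int hΩ hb gd hf hh) (QQ_int hΩ hb gd hg hh)]
  simp only [add_mul]

lemma QQ_cmul_left (gd : GreenData Ω) (c : ℝ) (f h : E2 → ℝ) :
    QQ gd (fun x => c * f x) h = c * QQ gd f h := by
  unfold QQ
  rw [← integral_const_mul]
  simp only [mul_assoc]

lemma QQ_cmul_right (gd : GreenData Ω) (c : ℝ) (f h : E2 → ℝ) :
    QQ gd f (fun x => c * h x) = c * QQ gd f h := by
  unfold QQ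
  rw [← integral_const_mul]
  refine integral_congr_ae (Eventually.of_forall fun x => ?_)
  simp only [KK_cmul]; ring

lemma QQ_sub_right (hΩ : IsOpen Ω) (hb : IsBounded Ω) (gd : GreenData Ω) {f g h : E2 → ℝ} (hf : AB Ω f) (hg : AB Ω g) (hh : AB Ω h) :
    QQ gd f (fun x => g x - h x) = QQ gd f g - QQ gd f h := by
  rw [QQ_symm hΩ hb gd hf (hg.sub hh), QQ_sub_left hΩ hb gd hg hh hf, QQ_symm hΩ hb gd hf hg, QQ_symm hΩ hb gd hf hh]

lemma QQ_add_right (hΩ : IsOpen Ω) (hb : IsBounded Ω) (gd : GreenData Ω) {f g h : E2 → ℝ} (hf : AB Ω f) (hg : AB Ω g) (hh : AB Ω h) :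
    QQ gd f (fun x => g x + h x) = QQ gd f g + QQ gd f h := by
  rw [QQ_symm hΩ hb gd hf (hg.add hh), QQ_add_left hΩ hb gd hg hh hf, QQ_symm hΩ hb gd hf hg, QQ_symm hΩ hb gd hf hh]

lemma QQ_nonneg (hΩ : IsOpen Ω) (hb : IsBounded Ω) (gd : GreenData Ω) {f g : E2 → ℝ} (hf : ∀ x, 0 ≤ f x) (hg : ∀ x, 0 ≤ g x) :
    0 ≤ QQ gd f g := integral_nonneg fun x => mul_nonneg (hf x) (KK_nonneg hΩ hb gd hg x)

lemma QQ_mono (hΩ : IsOpen Ω) (hb : IsBounded Ω) (gd : GreenData Ω) {f g f' g' : E2 → ℝ} (hf : AB Ω f) (hg : AB Ω g)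
    (hf' : AB Ω f') (hg' : AB Ω g') (h0 : ∀ x, 0 ≤ f x) (h0' : ∀ x, 0 ≤ g x) (h1 : ∀ x, f x ≤ f' x) (h2 : ∀ x, g x ≤ g' x) :
    QQ gd f g ≤ QQ gd f' g' :=
  integral_mono (QQ_int hΩ hb gd hf hg) (QQ_int hΩ hb gd hf' hg') fun x =>
    mul_le_mul (h1 x) (KK_mono hΩ hb gd hg hg' h2 x) (KK_nonneg hΩ hb gd h0' x) ((h0 x).trans (h1 x))

end

section

variable {Ω : Set E2}

lemma weak_limit (μ : Measure E2) [IsFiniteMeasure μ] {f : ℕ → E2 → ℝ} {M : ℝ} (hM : 0 ≤ M)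
    (hm : ∀ n, Measurable (f n)) (h0 : ∀ n x, 0 ≤ f n x) (h1 : ∀ n x, f n x ≤ M) :
    ∃ g : E2 → ℝ, Measurable g ∧ (∀ x, 0 ≤ g x) ∧ (∀ x, g x ≤ M) ∧ ∃ φ : ℕ → ℕ, StrictMono φ ∧
      ∀ h : E2 → ℝ, MemLp h 2 μ → Tendsto (fun n => ∫ x, f (φ n) x * h x ∂μ) atTop (𝓝 (∫ x, g x * h x ∂μ)) := by
  have hfact : Fact ((2 : ENNReal) ≠ ⊤) := ⟨by norm_num⟩
  have hbd : ∀ n, ∀ᵐ x ∂μ, ‖f n x‖ ≤ M := fun n => Eventually.of_forall fun x => by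
    rw [Real.norm_of_nonneg (h0 n x)]; exact h1 n x
  have hL : ∀ n, MemLp (f n) 2 μ := fun n => MemLp.of_bound (hm n).aestronglyMeasurable M (hbd n)
  obtain ⟨F, hF⟩ : ∃ F : ℕ → Lp ℝ 2 μ, ∀ n, F n = (hL n).toLp (f n) := ⟨_, fun n => rfl⟩
  have hFae : ∀ n, F n =ᵐ[μ] f n := fun n => by rw [hF n]; exact (hL n).coeFn_toLp
  obtain ⟨r, hr⟩ : ∃ r : ℝ, ∀ n, ‖F n‖ ≤ r := by
    refine ⟨_, fun n => Lp.norm_le_of_ae_bound (C := M) hM ?_⟩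
    filter_upwards [hFae n, hbd n] with x e1 e2
    rw [e1]; exact e2
  have hsc := WeakDual.isSeqCompact_closedBall ℝ (Lp ℝ 2 μ) 0 r
  obtain ⟨ℓ, -, φ, hφ, hlim⟩ := hsc (x := fun n => StrongDual.toWeakDual (InnerProductSpace.toDual ℝ (Lp ℝ 2 μ) (F n))) (fun n => by
    simp only [Set.mem_preimage, mem_closedBall, dist_zero_right]
    change ‖InnerProductSpace.toDual ℝ (Lp ℝ 2 μ) (F n)‖ ≤ r
    rw [LinearIsometryEquiv.norm_map]; exact hr n)
  rw [tendsto_iff_forall_eval_tendsto_topDualPairing] at hlim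
  obtain ⟨g, hg⟩ : ∃ g : Lp ℝ 2 μ, g = (InnerProductSpace.toDual ℝ (Lp ℝ 2 μ)).symm (WeakDual.toStrongDual ℓ) := ⟨_, rfl⟩
  have hlim2 : ∀ y : Lp ℝ 2 μ, Tendsto (fun n => inner ℝ (F (φ n)) y) atTop (𝓝 (inner ℝ g y)) := by
    intro y
    have h := hlim y
    have e1 : inner ℝ g y = ((topDualPairing ℝ (Lp ℝ 2 μ)) ℓ) y := by
      rw [hg, InnerProductSpace.toDual_symm_apply]; rfl
    rw [e1]
    refine h.congr fun n => ?_
    simp only [Function.comp]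
    change (InnerProductSpace.toDual ℝ (Lp ℝ 2 μ) (F (φ n))) y = _
    rw [InnerProductSpace.toDual_apply_apply]
  have hlim3 : ∀ h : E2 → ℝ, MemLp h 2 μ → Tendsto (fun n => ∫ x, f (φ n) x * h x ∂μ) atTop (𝓝 (∫ x, g x * h x ∂μ)) := by
    intro h hh
    have := hlim2 (hh.toLp h)
    have e : ∀ (k : Lp ℝ 2 μ) (k' : E2 → ℝ), k =ᵐ[μ] k' → inner ℝ k (hh.toLp h) = ∫ x, k' x * h x ∂μ := by
      intro k k' hk
      rw [L2.inner_def]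
      refine integral_congr_ae ?_
      filter_upwards [hk, hh.coeFn_toLp] with x e1 e2
      rw [e1, e2]; simp [mul_comm]
    rw [e g g (by rfl)] at this
    exact this.congr fun n => e _ _ (hFae _)
  have hgm : Measurable g := (Lp.stronglyMeasurable g).measurable
  have hgL : MemLp g 2 μ := Lp.memLp g
  have hgi : Integrable g μ := hgL.integrable (by norm_num)
  have hind : ∀ s : Set E2, MeasurableSet s → MemLp (s.indicator fun _ => (1:ℝ)) 2 μ := fun s hs =>
    memLp_indicator_const 2 hs 1 (Or.inr (measure_ne_top _ _))
  have hset : ∀ s : Set E2, MeasurableSet s → Tendsto (fun n => ∫ x in s, f (φ n) x ∂μ) atTop (𝓝 (∫ x in s, g x ∂μ)) := by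
    intro s hs
    have := hlim3 _ (hind s hs)
    have e : ∀ k : E2 → ℝ, ∫ x, k x * s.indicator (fun _ => (1:ℝ)) x ∂μ = ∫ x in s, k x ∂μ := by
      intro k
      rw [← integral_indicator hs]
      refine integral_congr_ae (Eventually.of_forall fun x => ?_)
      by_cases hx : x ∈ s <;> simp [hx]
    simp only [e] at this
    exact this
  have hg0 : 0 ≤ᵐ[μ] g := by
    refine ae_nonneg_of_forall_setIntegral_nonneg hgi fun s hs _ => ?_
    exact ge_of_tendsto' (hset s hs) fun n => integral_nonneg fun x => h0 _ x
  have hg1 : g ≤ᵐ[μ] fun _ => M := by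
    refine ae_le_of_forall_setIntegral_le hgi (integrable_const M) fun s hs _ => ?_
    refine le_of_tendsto' (hset s hs) fun n => ?_
    exact integral_mono (((hL (φ n)).integrable (by norm_num)).integrableOn) (integrable_const M) fun x => h1 _ x
  refine ⟨fun x => max 0 (min (g x) M), measurable_const.max (hgm.min measurable_const), fun x => le_max_left _ _,
    fun x => max_le hM (min_le_right _ _), φ, hφ, fun h hh => ?_⟩
  have e : ∫ x, max 0 (min (g x) M) * h x ∂μ = ∫ x, g x * h x ∂μ := by
    refine integral_congr_ae ?_
    filter_upwards [hg0, hg1] with x a1 a2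
    have a1' : 0 ≤ g x := a1
    rw [min_eq_left a2, max_eq_right a1']
  rw [e]
  exact hlim3 h hh

end

section

variable {Ω : Set E2}

/-- weak convergence -/
def WC (Ω : Set E2) (f : ℕ → E2 → ℝ) (g : E2 → ℝ) : Prop :=
  ∀ h : E2 → ℝ, MemLp h 2 (volume.restrict Ω) → Tendsto (fun n => ∫ x, f n x * h x) atTop (𝓝 (∫ x, g x * h x))

lemma WC.subseq {f : ℕ → E2 → ℝ} {g : E2 → ℝ} (h : WC Ω f g) {φ : ℕ → ℕ} (hφ : StrictMono φ) :
    WC Ω (fun n => f (φ n)) g := fun k hk => (h k hk).comp hφ.tendsto_atTop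

lemma restr_eq (hΩ : IsOpen Ω) {f h : E2 → ℝ} (h0 : ∀ x, x ∉ Ω → f x = 0) :
    ∫ x in Ω, f x * h x = ∫ x, f x * h x := by
  rw [← integral_indicator hΩ.measurableSet]
  refine integral_congr_ae (Eventually.of_forall fun x => ?_)
  by_cases hx : x ∈ Ω
  · simp [hx]
  · simp [hx, h0 x hx]

lemma weak_AB (hΩ : IsOpen Ω) (hb : IsBounded Ω) {f : ℕ → E2 → ℝ} {M : ℝ} (hM : 0 ≤ M)
    (hm : ∀ n, AB Ω (f n)) (h0 : ∀ n x, 0 ≤ f n x) (h1 : ∀ n x, f n x ≤ M) :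
    ∃ g : E2 → ℝ, AB Ω g ∧ (∀ x, 0 ≤ g x) ∧ (∀ x, g x ≤ M) ∧ ∃ φ : ℕ → ℕ, StrictMono φ ∧
      WC Ω (fun n => f (φ n)) g := by
  have hfin : IsFiniteMeasure (volume.restrict Ω) := ⟨by simpa using hb.measure_lt_top⟩
  obtain ⟨g, g1, g2, g3, φ, hφ, hl⟩ := weak_limit (volume.restrict Ω) hM (fun n => (hm n).meas) h0 h1
  refine ⟨Ω.indicator g, ⟨g1.indicator hΩ.measurableSet, ⟨M, hM, fun x => ?_⟩, fun x hx => Set.indicator_of_notMem hx g⟩, ?_, ?_, φ, hφ, ?_⟩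
  · by_cases hx : x ∈ Ω
    · simp only [Set.indicator_of_mem hx, abs_of_nonneg (g2 x)]; exact g3 x
    · simpa [hx] using hM
  · intro x; exact Set.indicator_nonneg (fun x _ => g2 x) x
  · intro x; exact Set.indicator_le' (fun x _ => g3 x) (fun x _ => hM) x
  · intro h hh
    have := hl h hh
    rw [← restr_eq hΩ (f := Ω.indicator g) fun x hx => Set.indicator_of_notMem hx g]
    have e : ∫ x in Ω, Ω.indicator g x * h x = ∫ x in Ω, g x * h x := by
      refine setIntegral_congr_fun hΩ.measurableSet fun x hx => ?_
      simp only [Set.indicator_of_mem hx]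
    rw [e]
    exact this.congr fun n => restr_eq hΩ (hm _).out

lemma kk_L2 (hΩ : IsOpen Ω) (hb : IsBounded Ω) (gd : GreenData Ω) (x : E2) : MemLp (kk gd x) 2 (volume.restrict Ω) := by
  rw [memLp_two_iff_integrable_sq (kk_meas_right hΩ gd x).aestronglyMeasurable]
  obtain ⟨M, hM, h⟩ := kk_rpow_int hΩ hb gd (m := 2) two_pos
  exact_mod_cast (h x).1.integrableOn

lemma AB.L2 (hb : IsBounded Ω) {f : E2 → ℝ} (hf : AB Ω f) : MemLp f 2 (volume.restrict Ω) := by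
  have hfin : IsFiniteMeasure (volume.restrict Ω) := ⟨by simpa using hb.measure_lt_top⟩
  obtain ⟨F, hF, h1⟩ := hf.bd
  exact MemLp.of_bound hf.meas.aestronglyMeasurable F (Eventually.of_forall h1)

lemma WC.kk_lim (hΩ : IsOpen Ω) (hb : IsBounded Ω) (gd : GreenData Ω) {f : ℕ → E2 → ℝ} {g : E2 → ℝ} (h : WC Ω f g) (x : E2) :
    Tendsto (fun n => KK gd (f n) x) atTop (𝓝 (KK gd g x)) := by
  have := h _ (kk_L2 hΩ hb gd x)
  unfold KK
  simpa only [mul_comm] using this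

lemma WC.qq_lim (hΩ : IsOpen Ω) (hb : IsBounded Ω) (gd : GreenData Ω) {f g : ℕ → E2 → ℝ} {f0 g0 : E2 → ℝ} {M : ℝ}
    (hM : 0 ≤ M)
    (hf : ∀ n, AB Ω (f n)) (hg : ∀ n, AB Ω (g n)) (hg0 : AB Ω g0)
    (hfM : ∀ n x, |f n x| ≤ M) (hgM : ∀ n x, |g n x| ≤ M)
    (h1 : WC Ω f f0) (h2 : WC Ω g g0) : Tendsto (fun n => QQ gd (f n) (g n)) atTop (𝓝 (QQ gd f0 g0)) := by
  obtain ⟨G, hG, hG1⟩ := hg0.bd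
  obtain ⟨N, hN, hN1⟩ := kk_int_bdd hΩ hb gd
  have a1 : Tendsto (fun n => ∫ x, f n x * KK gd g0 x) atTop (𝓝 (QQ gd f0 g0)) :=
    h1 _ ((KK_AB hΩ hb gd hg0).L2 hb)
  have a2 : Tendsto (fun n => ∫ x, f n x * (KK gd (g n) x - KK gd g0 x)) atTop (𝓝 (∫ x : E2, (0:ℝ))) := by
    have hind : Integrable (Ω.indicator fun _ : E2 => M * (M * N + G * N)) :=
      (integrable_indicator_iff hΩ.measurableSet).2 (integrableOn_const (hb.measure_lt_top.ne) (by exact enorm_ne_top))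
    refine tendsto_integral_of_dominated_convergence _ (fun n => ?_) hind (fun n => ?_) ?_
    · exact (((hf n).mul ((KK_AB hΩ hb gd (hg n)).sub (KK_AB hΩ hb gd hg0))).meas).aestronglyMeasurable
    · refine Eventually.of_forall fun x => ?_
      by_cases hx : x ∈ Ω
      · rw [Set.indicator_of_mem hx, norm_mul]
        refine mul_le_mul (hfM n x) ?_ (norm_nonneg _) hM
        refine (abs_sub _ _).trans (add_le_add ?_ ?_)
        · exact (KK_abs_le hΩ hb gd (hgM n) x).trans (by gcongr; exact hN1 x)
        · exact (KK_abs_le hΩ hb gd hG1 x).trans (by gcongr; exact hN1 x)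
      · rw [Set.indicator_of_notMem hx, (hf n).out x hx]; simp
    · refine Eventually.of_forall fun x => ?_
      have b1 : Tendsto (fun n => KK gd (g n) x - KK gd g0 x) atTop (𝓝 0) := by
        simpa using (h2.kk_lim hΩ hb gd x).sub_const (KK gd g0 x)
      exact squeeze_zero_norm (a := fun n => M * ‖KK gd (g n) x - KK gd g0 x‖) (fun n => by rw [norm_mul]; exact mul_le_mul_of_nonneg_right (hfM n x) (norm_nonneg _))
        (by simpa using b1.norm.const_mul M)
  have := a1.add a2
  simp only [integral_zero, add_zero] at this
  refine this.congr fun n => ?_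
  rw [← integral_add (QQ_int hΩ hb gd (hf n) hg0)
    (((hf n).mul ((KK_AB hΩ hb gd (hg n)).sub (KK_AB hΩ hb gd hg0))).integrable hΩ hb)]
  unfold QQ
  refine integral_congr_ae (Eventually.of_forall fun x => ?_)
  simp only; ring

lemma tangent {q x y : ℝ} (hq : 1 < q) (hx : 0 ≤ x) (hy : 0 ≤ y) : y ^ q + q * y ^ (q - 1) * (x - y) ≤ x ^ q := by
  have h := Real.geom_mean_le_arith_mean2_weighted (w₁ := 1 / q) (w₂ := 1 - 1 / q) (p₁ := x ^ q) (p₂ := y ^ q)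
    (by positivity) (by rw [sub_nonneg, div_le_one (by linarith)]; exact hq.le) (by positivity) (by positivity) (by ring)
  rw [← Real.rpow_mul hx, ← Real.rpow_mul hy] at h
  have e1 : q * (1 / q) = 1 := by field_simp
  have e2 : q * (1 - 1 / q) = q - 1 := by field_simp
  rw [e1, e2, Real.rpow_one] at h
  have e3 : y ^ q = y ^ (q - 1) * y := by
    rcases hy.eq_or_lt with rfl | hy
    · simp [Real.zero_rpow (by linarith : q ≠ 0)]
    · conv_rhs => rw [← Real.rpow_one y]
      rw [← Real.rpow_mul hy.le, ← Real.rpow_add hy]; congr 1; ring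
  have h2 : q * (x * y ^ (q - 1)) ≤ q * (1 / q * x ^ q + (1 - 1 / q) * y ^ q) := by gcongr
  have e4 : q * (1 / q * x ^ q + (1 - 1 / q) * y ^ q) = x ^ q + (q - 1) * y ^ q := by field_simp
  rw [e4] at h2
  nlinarith [e3, h2]

/-- L^q mass -/
def Aq (q : ℝ) (a : E2 → ℝ) : ℝ := ∫ x, a x ^ q

lemma tangent_int (hΩ : IsOpen Ω) (hb : IsBounded Ω) {q : ℝ} (hq : 1 < q) {a a' : E2 → ℝ} (ha : AB Ω a) (ha' : AB Ω a')
    (h0 : ∀ x, 0 ≤ a x) (h0' : ∀ x, 0 ≤ a' x) :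
    Aq q a + q * ∫ x, a x ^ (q - 1) * (a' x - a x) ≤ Aq q a' := by
  unfold Aq
  have i1 := (ha.rpow h0 (by linarith : 0 < q)).integrable hΩ hb
  have i2 := ((ha.rpow h0 (by linarith : 0 < q - 1)).mul (ha'.sub ha)).integrable hΩ hb
  rw [← integral_const_mul, ← integral_add i1 (i2.const_mul q)]
  refine integral_mono (i1.add (i2.const_mul q)) ((ha'.rpow h0' (by linarith : 0 < q)).integrable hΩ hb) fun x => ?_
  have := tangent hq (h0' x) (h0 x)
  simp only
  linarith

lemma WC.tan_lim (hΩ : IsOpen Ω) (hb : IsBounded Ω) {q : ℝ} (hq : 1 < q) {f : ℕ → E2 → ℝ} {a : E2 → ℝ} (ha : AB Ω a)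
    (hf : ∀ n, AB Ω (f n)) (h0 : ∀ x, 0 ≤ a x) (h : WC Ω f a) :
    Tendsto (fun n => Aq q a + q * ∫ x, a x ^ (q - 1) * (f n x - a x)) atTop (𝓝 (Aq q a)) := by
  have hh := ha.rpow h0 (by linarith : 0 < q - 1)
  have h1 := h _ (hh.L2 hb)
  have h2 : Tendsto (fun n => ∫ x, a x ^ (q - 1) * (f n x - a x)) atTop (𝓝 0) := by
    have := h1.sub_const (∫ x, a x * a x ^ (q - 1))
    rw [sub_self] at this
    refine this.congr fun n => ?_
    rw [← integral_sub (((hf n).mul hh).integrable hΩ hb) ((ha.mul hh).integrable hΩ hb)]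
    refine integral_congr_ae (Eventually.of_forall fun x => ?_)
    simp only; ring
  simpa using (h2.const_mul q).const_add (Aq q a)

lemma Aq_nonneg {q : ℝ} {a : E2 → ℝ} (h0 : ∀ x, 0 ≤ a x) : 0 ≤ Aq q a := integral_nonneg fun x => Real.rpow_nonneg (h0 x) _

lemma Aq_cmul {q s : ℝ} (hs : 0 ≤ s) {a : E2 → ℝ} (h0 : ∀ x, 0 ≤ a x) : Aq q (fun x => s * a x) = s ^ q * Aq q a := by
  unfold Aq
  rw [← integral_const_mul]
  refine integral_congr_ae (Eventually.of_forall fun x => ?_)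
  simp only [Real.mul_rpow hs (h0 x)]

/-- Hoelder -/
lemma KK_holder (hΩ : IsOpen Ω) (hb : IsBounded Ω) (gd : GreenData Ω) {p : ℝ} (hp : 1 < p) :
    ∃ C, 0 < C ∧ ∀ a, AB Ω a → (∀ x, 0 ≤ a x) → (∀ x, KK gd a x ≤ C * Aq (1 + 1 / p) a ^ (1 / (1 + 1 / p))) ∧
      ∫ x, a x ≤ C * Aq (1 + 1 / p) a ^ (1 / (1 + 1 / p)) := by
  obtain ⟨M, hM, h⟩ := kk_rpow_int hΩ hb gd (m := p + 1) (by linarith)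
  have hconj : (p + 1).HolderConjugate (1 + 1 / p) := by
    rw [Real.holderConjugate_iff]; refine ⟨by linarith, ?_⟩; field_simp; ring
  have hvol : Integrable (Ω.indicator fun _ : E2 => (1:ℝ)) :=
    (integrable_indicator_iff hΩ.measurableSet).2 (integrableOn_const (hb.measure_lt_top.ne) (by exact enorm_ne_top))
  have key : ∀ f : E2 → ℝ, Measurable f → (∀ x, 0 ≤ f x) → Integrable (fun x => f x ^ (p + 1)) → ∀ a, AB Ω a → (∀ x, 0 ≤ a x) →
      ∫ x, f x * a x ≤ (∫ x, f x ^ (p + 1)) ^ (1 / (p + 1)) * Aq (1 + 1 / p) a ^ (1 / (1 + 1 / p)) := by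
    intro f hf hf0 hfi a ha ha0
    refine integral_mul_le_Lp_mul_Lq_of_nonneg hconj (Eventually.of_forall hf0) (Eventually.of_forall ha0) ?_ ?_
    · have h1 : ENNReal.ofReal (p + 1) ≠ 0 := by simp; linarith
      rw [← integrable_norm_rpow_iff hf.aestronglyMeasurable h1 (by simp), ENNReal.toReal_ofReal (by linarith)]
      refine hfi.congr (Eventually.of_forall fun x => ?_)
      simp only [Real.norm_of_nonneg (hf0 x)]
    · have hq0 : (0:ℝ) < 1 + 1 / p := by positivity
      have h1 : ENNReal.ofReal (1 + 1 / p) ≠ 0 := by simpa using hq0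
      rw [← integrable_norm_rpow_iff ha.meas.aestronglyMeasurable h1 (by simp), ENNReal.toReal_ofReal hq0.le]
      refine ((ha.rpow ha0 hq0).integrable hΩ hb).congr (Eventually.of_forall fun x => ?_)
      simp only [Real.norm_of_nonneg (ha0 x)]
  refine ⟨(M ^ (1 / (p + 1)) + (∫ x, (Ω.indicator (fun _ : E2 => (1:ℝ)) x) ^ (p + 1)) ^ (1 / (p + 1))) + 1, ?_, ?_⟩
  · have : 0 ≤ ∫ x, (Ω.indicator (fun _ : E2 => (1:ℝ)) x) ^ (p + 1) :=
      integral_nonneg fun x => Real.rpow_nonneg (Set.indicator_nonneg (fun _ _ => zero_le_one) x) _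
    positivity
  intro a ha ha0
  have hA0 : 0 ≤ Aq (1 + 1 / p) a := Aq_nonneg ha0
  have hI0 : 0 ≤ ∫ x, (Ω.indicator (fun _ : E2 => (1:ℝ)) x) ^ (p + 1) :=
      integral_nonneg fun x => Real.rpow_nonneg (Set.indicator_nonneg (fun _ _ => zero_le_one) x) _
  constructor
  · intro x
    refine (key _ (kk_meas_right hΩ gd x) (kk_nonneg hΩ hb gd x) (h x).1 a ha ha0).trans ?_
    gcongr
    have h2 : (∫ y, kk gd x y ^ (p + 1)) ^ (1 / (p + 1)) ≤ M ^ (1 / (p + 1)) :=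
      Real.rpow_le_rpow (integral_nonneg fun y => Real.rpow_nonneg (kk_nonneg hΩ hb gd x y) _) (h x).2 (by positivity)
    have := Real.rpow_nonneg hI0 (1 / (p + 1))
    linarith
  · have e : (fun x => (Ω.indicator (fun _ : E2 => (1:ℝ)) x) ^ (p + 1)) = Ω.indicator (fun _ : E2 => (1:ℝ)) := by
      funext x
      by_cases hx : x ∈ Ω
      · simp [hx]
      · simp [hx, Real.zero_rpow (by linarith : p + 1 ≠ 0)]
    have := key _ (measurable_const.indicator hΩ.measurableSet) (Set.indicator_nonneg fun _ _ => zero_le_one) (by rw [e]; exact hvol) a ha ha0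
    have e2 : ∫ x, Ω.indicator (fun _ : E2 => (1:ℝ)) x * a x = ∫ x, a x := by
      refine integral_congr_ae (Eventually.of_forall fun x => ?_)
      by_cases hx : x ∈ Ω
      · simp [hx]
      · simp [ha.out x hx]
    rw [e2] at this
    refine this.trans ?_
    gcongr
    have := Real.rpow_nonneg hM (1 / (p + 1))
    linarith

end

section

variable {Ω : Set E2}

def Lam (q A B x y : ℝ) : ℝ := A ^ (1 + q / (2 - q)) * x ^ (-(q / (2 - q))) + B ^ (1 + q / (2 - q)) * y ^ (-(q / (2 - q)))

structure NP (gd : GreenData Ω) (q : ℝ) (a b : E2 → ℝ) : Prop where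
  aAB : AB Ω a
  bAB : AB Ω b
  a0 : ∀ x, 0 ≤ a x
  b0 : ∀ x, 0 ≤ b x
  hA : 0 < Aq q a
  hB : 0 < Aq q b
  hAα : Aq q a ≤ QQ gd a a - QQ gd a b
  hBβ : Aq q b ≤ QQ gd b b - QQ gd a b

lemma NP_of_pos (hΩ : IsOpen Ω) (hb : IsBounded Ω) (gd : GreenData Ω) {q : ℝ} (hq : 1 < q) (hq2 : q < 2) {a b : E2 → ℝ}
    (ha : AB Ω a) (hbb : AB Ω b) (a0 : ∀ x, 0 ≤ a x) (b0 : ∀ x, 0 ≤ b x) (hA : 0 < Aq q a) (hB : 0 < Aq q b)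
    (hα : 0 < QQ gd a a - QQ gd a b) (hβ : 0 < QQ gd b b - QQ gd a b) :
    ∃ a' b', NP gd q a' b' ∧ Aq q a' + Aq q b' ≤ Lam q (Aq q a) (Aq q b) (QQ gd a a - QQ gd a b) (QQ gd b b - QQ gd a b) := by
  obtain ⟨s, t, hs, ht, e1, e2, h⟩ := lemS hq hq2 hA hB (QQ_nonneg hΩ hb gd a0 b0) hα hβ
  have A1 : Aq q (fun x => s * a x) = s ^ q * Aq q a := Aq_cmul hs.le a0
  have B1 : Aq q (fun x => t * b x) = t ^ q * Aq q b := Aq_cmul ht.le b0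
  refine ⟨fun x => s * a x, fun x => t * b x, ⟨ha.cmul s, hbb.cmul t, fun x => mul_nonneg hs.le (a0 x), fun x => mul_nonneg ht.le (b0 x),
    by rw [A1]; positivity, by rw [B1]; positivity, ?_, ?_⟩, ?_⟩
  · rw [A1, e1]; simp only [QQ_cmul_left, QQ_cmul_right]; apply le_of_eq; ring
  · rw [B1, e2]; simp only [QQ_cmul_left, QQ_cmul_right]; apply le_of_eq; ring
  · rw [A1, B1]; exact h

lemma Aq_lower (hΩ : IsOpen Ω) (hb : IsBounded Ω) (gd : GreenData Ω) {p : ℝ} (hp : 1 < p) :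
    ∃ c, 0 < c ∧ ∀ a, AB Ω a → (∀ x, 0 ≤ a x) → 0 < Aq (1 + 1 / p) a → Aq (1 + 1 / p) a ≤ QQ gd a a → c ≤ Aq (1 + 1 / p) a := by
  obtain ⟨C, hC, h⟩ := KK_holder hΩ hb gd hp
  obtain ⟨q, hq⟩ : ∃ q, q = 1 + 1 / p := ⟨_, rfl⟩
  rw [← hq] at h ⊢
  have hq1 : 1 < q := by rw [hq]; have : 0 < 1 / p := by positivity
                         linarith
  have hq2 : q < 2 := by
    rw [hq]; have : 1 / p < 1 := by rw [div_lt_one (by linarith)]; exact hp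
    linarith
  have hr : 0 < 2 / q - 1 := by rw [sub_pos, lt_div_iff₀ (by linarith)]; linarith
  refine ⟨(1 / C ^ 2) ^ (1 / (2 / q - 1)), by positivity, fun a ha a0 hA hle => ?_⟩
  obtain ⟨h1, h2⟩ := h a ha a0
  obtain ⟨A, hAd⟩ : ∃ A, A = Aq q a := ⟨_, rfl⟩
  rw [← hAd] at h1 h2 hA hle ⊢
  have h3 : QQ gd a a ≤ (C * A ^ (1 / q)) * (C * A ^ (1 / q)) := by
    calc QQ gd a a ≤ ∫ x, a x * (C * A ^ (1 / q)) :=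
          integral_mono (QQ_int hΩ hb gd ha ha) ((ha.integrable hΩ hb).mul_const _) fun x =>
            mul_le_mul_of_nonneg_left (h1 x) (a0 x)
      _ = (∫ x, a x) * (C * A ^ (1 / q)) := integral_mul_const _ _
      _ ≤ _ := by gcongr
  have e : (C * A ^ (1 / q)) * (C * A ^ (1 / q)) = C ^ 2 * (A ^ (2 / q - 1) * A) := by
    have : A ^ (1 / q) * A ^ (1 / q) = A ^ (2 / q - 1) * A := by
      conv_rhs => rw [← Real.rpow_one A]
      rw [← Real.rpow_mul hA.le, ← Real.rpow_add hA, ← Real.rpow_add hA]; congr 1; ring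
    linear_combination C ^ 2 * this
  rw [e] at h3
  have h4 : 1 ≤ C ^ 2 * A ^ (2 / q - 1) := by
    by_contra hcon
    push Not at hcon
    have := mul_lt_mul_of_pos_right hcon hA
    linarith
  have h5 : 1 / C ^ 2 ≤ A ^ (2 / q - 1) := by rw [div_le_iff₀ (by positivity)]; linarith
  calc (1 / C ^ 2) ^ (1 / (2 / q - 1)) ≤ (A ^ (2 / q - 1)) ^ (1 / (2 / q - 1)) := by gcongr
    _ = A := by rw [← Real.rpow_mul hA.le, mul_one_div_cancel hr.ne', Real.rpow_one]

lemma trunc (hΩ : IsOpen Ω) (hb : IsBounded Ω) (gd : GreenData Ω) {q C M : ℝ} (hq : 1 < q) (hC : 0 < C) (hM : 0 < M)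
    (hMC : 4 * C ≤ M ^ (q - 1)) {a b : E2 → ℝ}
    (ha : AB Ω a) (hbb : AB Ω b) (a0 : ∀ x, 0 ≤ a x) (b0 : ∀ x, 0 ≤ b x) (hK : ∀ x, KK gd a x ≤ C)
    (hle : Aq q a ≤ QQ gd a a - QQ gd a b) :
    AB Ω (fun x => min (a x) M) ∧ Aq q (fun x => min (a x) M) ≤ Aq q a ∧
    Aq q (fun x => min (a x) M) ≤ QQ gd (fun x => min (a x) M) (fun x => min (a x) M) - QQ gd (fun x => min (a x) M) (fun x => min (b x) M) ∧
    Aq q a / 2 ≤ QQ gd (fun x => min (a x) M) (fun x => min (a x) M) - QQ gd (fun x => min (a x) M) (fun x => min (b x) M) := by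
  have tr : ∀ f : E2 → ℝ, AB Ω f → (∀ x, 0 ≤ f x) → AB Ω (fun x => min (f x) M) := fun f hf f0 =>
    hf.of_le (hf.meas.min measurable_const) fun x => by
      rw [abs_of_nonneg (le_min (f0 x) hM.le), abs_of_nonneg (f0 x)]; exact min_le_left _ _
  have haM := tr a ha a0
  have hbM := tr b hbb b0
  obtain ⟨aM, haMd⟩ : ∃ aM, aM = fun x => min (a x) M := ⟨_, rfl⟩
  obtain ⟨bM, hbMd⟩ : ∃ bM, bM = fun x => min (b x) M := ⟨_, rfl⟩
  rw [← haMd, ← hbMd]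
  rw [← haMd] at haM
  rw [← hbMd] at hbM
  have haM0 : ∀ x, 0 ≤ aM x := fun x => by rw [haMd]; exact le_min (a0 x) hM.le
  have hbM0 : ∀ x, 0 ≤ bM x := fun x => by rw [hbMd]; exact le_min (b0 x) hM.le
  have haMle : ∀ x, aM x ≤ a x := fun x => by rw [haMd]; exact min_le_left _ _
  have hbMle : ∀ x, bM x ≤ b x := fun x => by rw [hbMd]; exact min_le_left _ _
  obtain ⟨e, he⟩ : ∃ e : ℝ, e = ∫ x, (a x - aM x) := ⟨_, rfl⟩
  have heAB := ha.sub haM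
  have he0 : 0 ≤ e := by rw [he]; exact integral_nonneg fun x => sub_nonneg.2 (haMle x)
  have hMp : 0 < M ^ (q - 1) := by positivity
  have hA1 : Aq q aM + M ^ (q - 1) * e ≤ Aq q a := by
    rw [he, ← integral_const_mul]
    unfold Aq
    have i1 := (haM.rpow haM0 (by linarith : 0 < q)).integrable hΩ hb
    have i2 := (heAB.integrable hΩ hb).const_mul (M ^ (q - 1))
    rw [← integral_add i1 i2]
    refine integral_mono (i1.add i2) ((ha.rpow a0 (by linarith : 0 < q)).integrable hΩ hb) fun x => ?_
    simp only [haMd]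
    rcases le_total (a x) M with h | h
    · simp [min_eq_left h]
    · rw [min_eq_right h]
      have e1 : ∀ y : ℝ, 0 < y → y ^ q = y ^ (q - 1) * y := fun y hy => by
        conv_rhs => rw [← Real.rpow_one y]
        rw [← Real.rpow_mul hy.le, ← Real.rpow_add hy]; congr 1; ring
      rw [e1 _ hM, e1 _ (hM.trans_le h)]
      have : M ^ (q - 1) ≤ a x ^ (q - 1) := Real.rpow_le_rpow hM.le h (by linarith)
      nlinarith
  have hQe : ∀ f : E2 → ℝ, AB Ω f → (∀ x, f x ≤ a x) → QQ gd (fun x => a x - aM x) f ≤ C * e := by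
    intro f hf hfa
    rw [he, ← integral_const_mul]
    refine integral_mono (QQ_int hΩ hb gd heAB hf) ((heAB.integrable hΩ hb).const_mul C) fun x => ?_
    have h1 : KK gd f x ≤ C := (KK_mono hΩ hb gd hf ha hfa x).trans (hK x)
    have h2 := sub_nonneg.2 (haMle x)
    simp only
    nlinarith
  have hα : QQ gd a a - QQ gd a b - 2 * C * e ≤ QQ gd aM aM - QQ gd aM bM := by
    have h1 := hQe a ha fun x => le_rfl
    have h2 := hQe aM haM haMle
    rw [QQ_sub_left hΩ hb gd ha haM ha] at h1
    rw [QQ_sub_left hΩ hb gd ha haM haM] at h2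
    have h3 := QQ_symm hΩ hb gd ha haM
    have h4 := QQ_mono hΩ hb gd haM hbM ha hbb haM0 hbM0 haMle hbMle
    linarith
  have hAM0 : 0 ≤ Aq q aM := Aq_nonneg haM0
  have h5 : 4 * C * e ≤ M ^ (q - 1) * e := mul_le_mul_of_nonneg_right hMC he0
  have h6 : 0 ≤ C * e := by positivity
  refine ⟨haM, by linarith, by linarith, by linarith⟩

lemma QQ_pos_Aq (hΩ : IsOpen Ω) (hb : IsBounded Ω) (gd : GreenData Ω) {q : ℝ} (hq : 1 < q) {a : E2 → ℝ}
    (ha : AB Ω a) (a0 : ∀ x, 0 ≤ a x) (b : E2 → ℝ) (h : 0 < QQ gd a a - QQ gd a b) : 0 < Aq q a := by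
  refine lt_of_le_of_ne (Aq_nonneg a0) fun hz => ?_
  unfold Aq at hz
  have h1 := (integral_eq_zero_iff_of_nonneg (fun x => Real.rpow_nonneg (a0 x) q)
    ((ha.rpow a0 (by linarith : 0 < q)).integrable hΩ hb)).1 hz.symm
  have h2 : a =ᵐ[volume] fun _ => 0 := by
    filter_upwards [h1] with x hx
    exact (Real.rpow_eq_zero (a0 x) (by linarith)).1 hx
  have h3 : ∀ f : E2 → ℝ, QQ gd a f = 0 := fun f => by
    unfold QQ
    rw [← integral_zero E2 ℝ]
    refine integral_congr_ae ?_
    filter_upwards [h2] with x hx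
    rw [hx, zero_mul]
  rw [h3, h3, sub_zero] at h
  exact lt_irrefl _ h

end

section

variable {Ω : Set E2}

structure MinP (gd : GreenData Ω) (q : ℝ) (a b : E2 → ℝ) : Prop where
  aAB : AB Ω a
  bAB : AB Ω b
  a0 : ∀ x, 0 ≤ a x
  b0 : ∀ x, 0 ≤ b x
  hA : 0 < Aq q a
  hB : 0 < Aq q b
  hAα : Aq q a = QQ gd a a - QQ gd a b
  hBβ : Aq q b = QQ gd b b - QQ gd a b
  min : ∀ a' b', AB Ω a' → AB Ω b' → (∀ x, 0 ≤ a' x) → (∀ x, 0 ≤ b' x) → 0 < Aq q a' → 0 < Aq q b' →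
    0 < QQ gd a' a' - QQ gd a' b' → 0 < QQ gd b' b' - QQ gd a' b' →
    Aq q a + Aq q b ≤ Lam q (Aq q a') (Aq q b') (QQ gd a' a' - QQ gd a' b') (QQ gd b' b' - QQ gd a' b')

lemma Lam_term_le {A α θ : ℝ} (hθ : 0 < θ) (hA : 0 < A) (h : A ≤ α) : A ^ (1 + θ) * α ^ (-θ) ≤ A := by
  have hα : 0 < α := hA.trans_le h
  rw [Real.rpow_add hA, Real.rpow_one, Real.rpow_neg hα.le, mul_assoc, ← div_eq_mul_inv]
  have : A ^ θ / α ^ θ ≤ 1 := by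
    rw [div_le_one (by positivity)]; exact Real.rpow_le_rpow hA.le h hθ.le
  nlinarith

lemma Lam_term_lt {A α θ : ℝ} (hθ : 0 < θ) (hA : 0 < A) (h : A < α) : A ^ (1 + θ) * α ^ (-θ) < A := by
  have hα : 0 < α := hA.trans h
  rw [Real.rpow_add hA, Real.rpow_one, Real.rpow_neg hα.le, mul_assoc, ← div_eq_mul_inv]
  have : A ^ θ / α ^ θ < 1 := by
    rw [div_lt_one (by positivity)]; exact Real.rpow_lt_rpow hA.le h hθ
  nlinarith

lemma exists_min (hΩ : IsOpen Ω) (hb : IsBounded Ω) (gd : GreenData Ω) {p : ℝ} (hp : 1 < p)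
    (hne : ∃ a b, NP gd (1 + 1 / p) a b) : ∃ a b, MinP gd (1 + 1 / p) a b := by
  obtain ⟨Ch, hCh, hhold⟩ := KK_holder hΩ hb gd hp
  obtain ⟨c0, hc0, hlow⟩ := Aq_lower hΩ hb gd hp
  obtain ⟨q, hq⟩ : ∃ q, q = 1 + 1 / p := ⟨_, rfl⟩
  rw [← hq] at hhold hlow hne ⊢
  have hq1 : 1 < q := by rw [hq]; have : 0 < 1 / p := by positivity
                         linarith
  have hq2 : q < 2 := by
    rw [hq]; have : 1 / p < 1 := by rw [div_lt_one (by linarith)]; exact hp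
    linarith
  obtain ⟨S, hS⟩ : ∃ S : Set ℝ, S = {r | ∃ a b, NP gd q a b ∧ r = Aq q a + Aq q b} := ⟨_, rfl⟩
  have hSne : S.Nonempty := by
    obtain ⟨a, b, h⟩ := hne
    exact ⟨_, by rw [hS]; exact ⟨a, b, h, rfl⟩⟩
  have hSbd : BddBelow S := ⟨0, by
    rw [hS]
    rintro r ⟨a, b, h, rfl⟩
    exact (add_pos h.hA h.hB).le⟩
  obtain ⟨I, hI⟩ : ∃ I, I = sInf S := ⟨_, rfl⟩
  have hIle : ∀ a b, NP gd q a b → I ≤ Aq q a + Aq q b := fun a b h => by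
    rw [hI]; exact csInf_le hSbd (by rw [hS]; exact ⟨a, b, h, rfl⟩)
  obtain ⟨u, hu1, hu2, hu3⟩ := exists_seq_tendsto_sInf hSne hSbd
  rw [← hI] at hu2
  have hu4 : ∀ n, ∃ a b, NP gd q a b ∧ u n = Aq q a + Aq q b := fun n => by
    have := hu3 n; rw [hS] at this; exact this
  choose a b hab huab using hu4
  obtain ⟨U, hU⟩ : ∃ U, U = u 0 := ⟨_, rfl⟩
  have hUle : ∀ n, u n ≤ U := fun n => by rw [hU]; exact hu1 (Nat.zero_le n)
  have hU0 : 0 < U := by rw [hU, huab 0]; exact add_pos (hab 0).hA (hab 0).hB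
  have hAU : ∀ n, Aq q (a n) ≤ U := fun n => by have h1 := hUle n; rw [huab n] at h1; linarith [(hab n).hB]
  have hBU : ∀ n, Aq q (b n) ≤ U := fun n => by have h1 := hUle n; rw [huab n] at h1; linarith [(hab n).hA]
  obtain ⟨C, hC⟩ : ∃ C, C = Ch * U ^ (1 / q) := ⟨_, rfl⟩
  have hC0 : 0 < C := by rw [hC]; positivity
  have hKa : ∀ n x, KK gd (a n) x ≤ C := fun n x => by
    rw [hC]
    refine ((hhold _ (hab n).aAB (hab n).a0).1 x).trans ?_
    have := Real.rpow_le_rpow (hab n).hA.le (hAU n) (by positivity : 0 ≤ 1 / q)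
    gcongr
  have hKb : ∀ n x, KK gd (b n) x ≤ C := fun n x => by
    rw [hC]
    refine ((hhold _ (hab n).bAB (hab n).b0).1 x).trans ?_
    have := Real.rpow_le_rpow (hab n).hB.le (hBU n) (by positivity : 0 ≤ 1 / q)
    gcongr
  obtain ⟨M, hM⟩ : ∃ M, M = (4 * C) ^ (1 / (q - 1)) := ⟨_, rfl⟩
  have hM0 : 0 < M := by rw [hM]; positivity
  have hMC : 4 * C ≤ M ^ (q - 1) := by
    rw [hM, ← Real.rpow_mul (by positivity), one_div_mul_cancel (by linarith), Real.rpow_one]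
  have Ta := fun n => trunc hΩ hb gd hq1 hC0 hM0 hMC (hab n).aAB (hab n).bAB (hab n).a0 (hab n).b0 (hKa n) (hab n).hAα
  have Tb := fun n => trunc hΩ hb gd hq1 hC0 hM0 hMC (hab n).bAB (hab n).aAB (hab n).b0 (hab n).a0 (hKb n)
    (by rw [QQ_symm hΩ hb gd (hab n).bAB (hab n).aAB]; exact (hab n).hBβ)
  obtain ⟨a', ha'⟩ : ∃ a' : ℕ → E2 → ℝ, a' = fun n x => min (a n x) M := ⟨_, rfl⟩
  obtain ⟨b', hb'⟩ : ∃ b' : ℕ → E2 → ℝ, b' = fun n x => min (b n x) M := ⟨_, rfl⟩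
  have ea : ∀ n, (fun x => min (a n x) M) = a' n := fun n => by rw [ha']
  have eb : ∀ n, (fun x => min (b n x) M) = b' n := fun n => by rw [hb']
  simp only [ea, eb] at Ta Tb
  have a'0 : ∀ n x, 0 ≤ a' n x := fun n x => by rw [ha']; exact le_min ((hab n).a0 x) hM0.le
  have b'0 : ∀ n x, 0 ≤ b' n x := fun n x => by rw [hb']; exact le_min ((hab n).b0 x) hM0.le
  have a'M : ∀ n x, a' n x ≤ M := fun n x => by rw [ha']; exact min_le_right _ _
  have b'M : ∀ n x, b' n x ≤ M := fun n x => by rw [hb']; exact min_le_right _ _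
  obtain ⟨f, f1, f2, f3, φ, hφ, hf⟩ := weak_AB hΩ hb hM0.le (fun n => (Ta n).1) a'0 a'M
  obtain ⟨g, g1, g2, g3, ψ, hψ, hg⟩ := weak_AB hΩ hb hM0.le (fun n => (Tb (φ n)).1) (fun n => b'0 (φ n)) (fun n => b'M (φ n))
  have hf' := hf.subseq hψ
  obtain ⟨k, hk⟩ : ∃ k : ℕ → ℕ, k = fun n => φ (ψ n) := ⟨_, rfl⟩
  have hkt : Tendsto k atTop atTop := by rw [hk]; exact hφ.tendsto_atTop.comp hψ.tendsto_atTop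
  have hf2 : WC Ω (fun n => a' (k n)) f := by rw [hk]; exact hf'
  have hg2 : WC Ω (fun n => b' (k n)) g := by rw [hk]; exact hg
  have aa : ∀ n x, |a' (k n) x| ≤ M := fun n x => by rw [abs_of_nonneg (a'0 _ x)]; exact a'M _ x
  have bb : ∀ n x, |b' (k n) x| ≤ M := fun n x => by rw [abs_of_nonneg (b'0 _ x)]; exact b'M _ x
  have qaa := WC.qq_lim hΩ hb gd hM0.le (fun n => (Ta (k n)).1) (fun n => (Ta (k n)).1) f1 aa aa hf2 hf2
  have qab := WC.qq_lim hΩ hb gd hM0.le (fun n => (Ta (k n)).1) (fun n => (Tb (k n)).1) g1 aa bb hf2 hg2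
  have qbb := WC.qq_lim hΩ hb gd hM0.le (fun n => (Tb (k n)).1) (fun n => (Tb (k n)).1) g1 bb bb hg2 hg2
  have ta := hf2.tan_lim hΩ hb hq1 f1 (fun n => (Ta (k n)).1) f2
  have tb := hg2.tan_lim hΩ hb hq1 g1 (fun n => (Tb (k n)).1) g2
  have ta' := fun n => tangent_int hΩ hb hq1 f1 (Ta (k n)).1 f2 (a'0 (k n))
  have tb' := fun n => tangent_int hΩ hb hq1 g1 (Tb (k n)).1 g2 (b'0 (k n))
  have sy : ∀ n, QQ gd (b' n) (a' n) = QQ gd (a' n) (b' n) := fun n => QQ_symm hΩ hb gd (Tb n).1 (Ta n).1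
  simp only [sy] at Tb
  have r1 : Aq q f ≤ QQ gd f f - QQ gd f g :=
    le_of_tendsto_of_tendsto' ta (qaa.sub qab) fun n => (ta' n).trans (Ta (k n)).2.2.1
  have r2 : Aq q g ≤ QQ gd g g - QQ gd f g :=
    le_of_tendsto_of_tendsto' tb (qbb.sub qab) fun n => (tb' n).trans (Tb (k n)).2.2.1
  have r3 : Aq q f + Aq q g ≤ I :=
    le_of_tendsto_of_tendsto' (ta.add tb) (hu2.comp hkt) fun n => by
      simp only [Function.comp]
      rw [huab]
      have h1 := (Ta (k n)).2.1
      have h2 := (Tb (k n)).2.1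
      have h3 := ta' n
      have h4 := tb' n
      linarith
  have la : ∀ n, c0 ≤ Aq q (a n) := fun n => hlow _ (hab n).aAB (hab n).a0 (hab n).hA
    ((hab n).hAα.trans (sub_le_self _ (QQ_nonneg hΩ hb gd (hab n).a0 (hab n).b0)))
  have lb : ∀ n, c0 ≤ Aq q (b n) := fun n => hlow _ (hab n).bAB (hab n).b0 (hab n).hB
    ((hab n).hBβ.trans (sub_le_self _ (QQ_nonneg hΩ hb gd (hab n).a0 (hab n).b0)))
  have r4 : c0 / 2 ≤ QQ gd f f - QQ gd f g :=
    ge_of_tendsto' (qaa.sub qab) fun n => by linarith [(Ta (k n)).2.2.2, la (k n)]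
  have r5 : c0 / 2 ≤ QQ gd g g - QQ gd f g :=
    ge_of_tendsto' (qbb.sub qab) fun n => by linarith [(Tb (k n)).2.2.2, lb (k n)]
  have pA : 0 < Aq q f := QQ_pos_Aq hΩ hb gd hq1 f1 f2 g (by linarith)
  have pB : 0 < Aq q g := QQ_pos_Aq hΩ hb gd hq1 g1 g2 f (by rw [QQ_symm hΩ hb gd g1 f1]; linarith)
  have hmin : ∀ a' b', AB Ω a' → AB Ω b' → (∀ x, 0 ≤ a' x) → (∀ x, 0 ≤ b' x) → 0 < Aq q a' → 0 < Aq q b' →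
    0 < QQ gd a' a' - QQ gd a' b' → 0 < QQ gd b' b' - QQ gd a' b' →
    I ≤ Lam q (Aq q a') (Aq q b') (QQ gd a' a' - QQ gd a' b') (QQ gd b' b' - QQ gd a' b') := by
    intro a' b' h1 h2 h3 h4 h5 h6 h7 h8
    obtain ⟨a'', b'', h9, h10⟩ := NP_of_pos hΩ hb gd hq1 hq2 h1 h2 h3 h4 h5 h6 h7 h8
    exact (hIle _ _ h9).trans h10
  have hθ : 0 < q / (2 - q) := div_pos (by linarith) (by linarith)
  have hm := hmin f g f1 g1 f2 g2 pA pB (by linarith) (by linarith)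
  unfold Lam at hm
  have e1 : Aq q f = QQ gd f f - QQ gd f g := by
    by_contra hne
    have h1 := Lam_term_lt hθ pA (lt_of_le_of_ne r1 hne)
    have h2 := Lam_term_le hθ pB r2
    linarith
  have e2 : Aq q g = QQ gd g g - QQ gd f g := by
    by_contra hne
    have h1 := Lam_term_le hθ pA r1
    have h2 := Lam_term_lt hθ pB (lt_of_le_of_ne r2 hne)
    linarith
  exact ⟨f, g, f1, g1, f2, g2, pA, pB, e1, e2, fun a' b' h1 h2 h3 h4 h5 h6 h7 h8 =>
    r3.trans (hmin a' b' h1 h2 h3 h4 h5 h6 h7 h8)⟩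

lemma MinP.swap (hΩ : IsOpen Ω) (hb : IsBounded Ω) {gd : GreenData Ω} {q : ℝ} {a b : E2 → ℝ} (h : MinP gd q a b) :
    MinP gd q b a := by
  refine ⟨h.bAB, h.aAB, h.b0, h.a0, h.hB, h.hA, ?_, ?_, ?_⟩
  · rw [QQ_symm hΩ hb gd h.bAB h.aAB]; exact h.hBβ
  · rw [QQ_symm hΩ hb gd h.bAB h.aAB]; exact h.hAα
  · intro a' b' h1 h2 h3 h4 h5 h6 h7 h8
    have e := QQ_symm hΩ hb gd h1 h2
    rw [e] at h7 h8
    have := h.min b' a' h2 h1 h4 h3 h6 h5 h8 h7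
    rw [e]
    unfold Lam at this ⊢
    linarith

end

section

variable {Ω : Set E2}

lemma dLam {A B θ d x y w δ : ℝ} (hA : 0 < A) (hB : 0 < B) (hδ : 0 < δ)
    (h : ∀ ε, 0 < ε → ε < δ → A + B ≤ (A + ε * d) ^ (1 + θ) * (A + ε * x + ε ^ 2 * y) ^ (-θ)
      + B ^ (1 + θ) * (B + ε * w) ^ (-θ)) : 0 ≤ (1 + θ) * d - θ * x - θ * w := by
  obtain ⟨f, hf⟩ : ∃ f : ℝ → ℝ, f = fun ε => (A + ε * d) ^ (1 + θ) * (A + ε * x + ε ^ 2 * y) ^ (-θ)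
      + B ^ (1 + θ) * (B + ε * w) ^ (-θ) := ⟨_, rfl⟩
  have e1 : HasDerivAt (fun ε : ℝ => A + ε * d) d 0 := by
    simpa using ((hasDerivAt_id (0:ℝ)).mul_const d).const_add A
  have e2 : HasDerivAt (fun ε : ℝ => A + ε * x + ε ^ 2 * y) x 0 := by
    have h1 := ((hasDerivAt_id (0:ℝ)).mul_const x).const_add A
    have h2 := ((hasDerivAt_pow 2 (0:ℝ)).mul_const y)
    exact (h1.add h2).congr_deriv (by simp)
  have e3 : HasDerivAt (fun ε : ℝ => B + ε * w) w 0 := by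
    simpa using ((hasDerivAt_id (0:ℝ)).mul_const w).const_add B
  have d1 := e1.rpow_const (p := 1 + θ) (Or.inl (by simp [hA.ne']))
  have d2 := e2.rpow_const (p := -θ) (Or.inl (by simp [hA.ne']))
  have d3 := (e3.rpow_const (p := -θ) (Or.inl (by simp [hB.ne']))).const_mul (B ^ (1 + θ))
  have D := (d1.mul d2).add d3
  simp only [zero_mul, add_zero, ne_eq, OfNat.ofNat_ne_zero, not_false_eq_true, zero_pow] at D
  have key : ∀ C : ℝ, 0 < C → C ^ (1 + θ) * C ^ (-θ - 1) = 1 := fun C hC => by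
    rw [← Real.rpow_add hC]; ring_nf; exact Real.rpow_zero C
  have key2 : A ^ (1 + θ - 1) * A ^ (-θ) = 1 := by
    rw [← Real.rpow_add hA]; ring_nf; exact Real.rpow_zero A
  have D' : HasDerivAt f ((1 + θ) * d - θ * x - θ * w) 0 := by
    rw [hf]
    refine D.congr_deriv ?_
    have k1 := key A hA
    have k2 := key B hB
    linear_combination (-θ * x) * k1 + (-θ * w) * k2 + (1 + θ) * d * key2
  have f0 : f 0 = A + B := by
    rw [hf]
    simp only [zero_mul, add_zero, ne_eq, OfNat.ofNat_ne_zero, not_false_eq_true, zero_pow]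
    have k : ∀ C : ℝ, 0 < C → C ^ (1 + θ) * C ^ (-θ) = C := fun C hC => by
      rw [← Real.rpow_add hC]; ring_nf; exact Real.rpow_one C
    rw [k A hA, k B hB]
  have := hasDerivAt_iff_tendsto_slope_zero.1 D'
  have t2 := this.mono_left (nhdsGT_le_nhdsNE (0:ℝ))
  refine ge_of_tendsto t2 ?_
  filter_upwards [Ioo_mem_nhdsGT hδ] with ε hε
  rw [zero_add, f0, smul_eq_mul]
  refine mul_nonneg (inv_nonneg.2 hε.1.le) (sub_nonneg.2 ?_)
  rw [hf]
  exact h ε hε.1 hε.2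

lemma MinP.EL (hΩ : IsOpen Ω) (hb : IsBounded Ω) {gd : GreenData Ω} {p : ℝ} (hp : 1 < p) {a b : E2 → ℝ}
    (h : MinP gd (1 + 1 / p) a b) :
    ∀ᵐ x, a x = (max (KK gd (fun y => a y - b y) x) 0) ^ p := by
  have hp0 : 0 < p := by linarith
  obtain ⟨q, hq⟩ : ∃ q, q = 1 + 1 / p := ⟨_, rfl⟩
  rw [← hq] at h
  have hq1 : 1 < q := by rw [hq]; have : 0 < 1 / p := by positivity
                         linarith
  have hq2 : q < 2 := by
    rw [hq]; have : 1 / p < 1 := by rw [div_lt_one (by linarith)]; exact hp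
    linarith
  have hqp : q - 1 = 1 / p := by rw [hq]; ring
  obtain ⟨z, hz⟩ : ∃ z, z = KK gd (fun y => a y - b y) := ⟨_, rfl⟩
  have haA := h.aAB
  have hbA := h.bAB
  have ha0 := h.a0
  have hzA : AB Ω z := by rw [hz]; exact KK_AB hΩ hb gd (haA.sub hbA)
  obtain ⟨s, hs⟩ : ∃ s : E2 → ℝ, s = fun x => (max (z x) 0) ^ p := ⟨_, rfl⟩
  have hsA : AB Ω s := by rw [hs]; exact hzA.pos.rpow (fun x => le_max_right _ _) hp0
  have hs0 : ∀ x, 0 ≤ s x := fun x => by rw [hs]; exact Real.rpow_nonneg (le_max_right _ _) _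
  obtain ⟨φ, hφ⟩ : ∃ φ : E2 → ℝ, φ = fun x => s x - a x := ⟨_, rfl⟩
  have hφA : AB Ω φ := by rw [hφ]; exact hsA.sub haA
  have hφx : ∀ x, φ x = s x - a x := fun x => by rw [hφ]
  have hcA : ∀ ε, AB Ω (fun x => a x + ε * φ x) := fun ε => haA.add (hφA.cmul ε)
  have hc0 : ∀ ε, 0 ≤ ε → ε ≤ 1 → ∀ x, 0 ≤ a x + ε * φ x := fun ε h0 h1 x => by
    rw [hφx]; nlinarith [ha0 x, hs0 x, mul_nonneg h0 (hs0 x), mul_nonneg (sub_nonneg.2 h1) (ha0 x)]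
  obtain ⟨D, hD⟩ : ∃ D : ℝ → ℝ, D = fun δ => ∫ x, (a x + δ * φ x) ^ (q - 1) * φ x := ⟨_, rfl⟩
  have hDint : ∀ δ, 0 ≤ δ → δ ≤ 1 → Integrable (fun x => (a x + δ * φ x) ^ (q - 1) * φ x) := fun δ h0 h1 =>
    (((hcA δ).rpow (hc0 δ h0 h1) (by linarith : 0 < q - 1)).mul hφA).integrable hΩ hb
  have hDmono : ∀ ε δ, 0 ≤ ε → ε ≤ δ → δ ≤ 1 → D ε ≤ D δ := fun ε δ h0 h1 h2 => by
    rw [hD]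
    refine integral_mono (hDint ε h0 (h1.trans h2)) (hDint δ (h0.trans h1) h2) fun x => ?_
    simp only
    have c1 := hc0 ε h0 (h1.trans h2) x
    have c2 := hc0 δ (h0.trans h1) h2 x
    rcases le_total 0 (φ x) with hx | hx
    · refine mul_le_mul_of_nonneg_right (Real.rpow_le_rpow c1 ?_ (by linarith)) hx
      nlinarith
    · refine mul_le_mul_of_nonpos_right (Real.rpow_le_rpow c2 ?_ (by linarith)) hx
      nlinarith
  have hAle : ∀ ε δ, 0 ≤ ε → ε ≤ δ → δ ≤ 1 → Aq q (fun x => a x + ε * φ x) ≤ Aq q a + ε * (q * D δ) := fun ε δ h0 h1 h2 => by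
    have t := tangent_int hΩ hb hq1 (hcA ε) haA (hc0 ε h0 (h1.trans h2)) ha0
    have e : ∫ x, (a x + ε * φ x) ^ (q - 1) * (a x - (a x + ε * φ x)) = - (ε * D ε) := by
      rw [hD, ← integral_const_mul, ← integral_neg]
      refine integral_congr_ae (Eventually.of_forall fun x => ?_)
      simp only; ring
    rw [e] at t
    have := mul_le_mul_of_nonneg_left (hDmono ε δ h0 h1 h2) (mul_nonneg h0 (by linarith : 0 ≤ q))
    nlinarith
  have hα : ∀ ε, QQ gd (fun x => a x + ε * φ x) (fun x => a x + ε * φ x) - QQ gd (fun x => a x + ε * φ x) b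
      = Aq q a + ε * (2 * QQ gd φ a - QQ gd φ b) + ε ^ 2 * QQ gd φ φ := fun ε => by
    rw [h.hAα, QQ_add_left hΩ hb gd haA (hφA.cmul ε) (hcA ε), QQ_add_left hΩ hb gd haA (hφA.cmul ε) hbA,
      QQ_add_right hΩ hb gd haA haA (hφA.cmul ε), QQ_add_right hΩ hb gd (hφA.cmul ε) haA (hφA.cmul ε)]
    simp only [QQ_cmul_left, QQ_cmul_right]
    rw [QQ_symm hΩ hb gd haA hφA]; ring
  have hβ : ∀ ε, QQ gd b b - QQ gd (fun x => a x + ε * φ x) b = Aq q b + ε * (- QQ gd φ b) := fun ε => by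
    rw [h.hBβ, QQ_add_left hΩ hb gd haA (hφA.cmul ε) hbA]
    simp only [QQ_cmul_left]; ring
  obtain ⟨θ, hθ⟩ : ∃ θ, θ = q / (2 - q) := ⟨_, rfl⟩
  have hθ0 : 0 < θ := by rw [hθ]; exact div_pos (by linarith) (by linarith)
  have hθq : (1 + θ) * q = 2 * θ := by
    rw [hθ]; field_simp [(by linarith : (2 - q) ≠ 0)]; ring
  have hlim : ∀ δ, 0 < δ → δ ≤ 1 → 0 ≤ D δ - (QQ gd φ a - QQ gd φ b) := fun δ hδ hδ1 => by
    have c1 : ∀ᶠ ε in 𝓝[>] (0:ℝ), 0 < Aq q a + ε * (2 * QQ gd φ a - QQ gd φ b) + ε ^ 2 * QQ gd φ φ := by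
      have : Tendsto (fun ε : ℝ => Aq q a + ε * (2 * QQ gd φ a - QQ gd φ b) + ε ^ 2 * QQ gd φ φ) (𝓝 0)
        (𝓝 (Aq q a + 0 * (2 * QQ gd φ a - QQ gd φ b) + 0 ^ 2 * QQ gd φ φ)) := by
        apply Continuous.tendsto; fun_prop
      exact (this.mono_left nhdsWithin_le_nhds).eventually (lt_mem_nhds (by simpa using h.hA))
    have c2 : ∀ᶠ ε in 𝓝[>] (0:ℝ), 0 < Aq q b + ε * (- QQ gd φ b) := by
      have : Tendsto (fun ε : ℝ => Aq q b + ε * (- QQ gd φ b)) (𝓝 0)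
        (𝓝 (Aq q b + 0 * (- QQ gd φ b))) := by
        apply Continuous.tendsto; fun_prop
      exact (this.mono_left nhdsWithin_le_nhds).eventually (lt_mem_nhds (by simpa using h.hB))
    obtain ⟨η, hη, hη'⟩ := mem_nhdsGT_iff_exists_Ioo_subset.1 (c1.and c2)
    have hη0 : 0 < η := hη
    have := dLam (d := q * D δ) (x := 2 * QQ gd φ a - QQ gd φ b) (y := QQ gd φ φ) (w := - QQ gd φ b) (θ := θ)
      h.hA h.hB (lt_min hη0 hδ) (fun ε h0 h1 => by
        have h2 : ε < η := h1.trans_le (min_le_left _ _)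
        have h3 : ε < δ := h1.trans_le (min_le_right _ _)
        obtain ⟨p1, p2⟩ := hη' ⟨h0, h2⟩
        have q1 : 0 < QQ gd (fun x => a x + ε * φ x) (fun x => a x + ε * φ x) - QQ gd (fun x => a x + ε * φ x) b := by
          rw [hα]; exact p1
        have q2 : 0 < QQ gd b b - QQ gd (fun x => a x + ε * φ x) b := by rw [hβ]; exact p2
        have q3 := QQ_pos_Aq hΩ hb gd hq1 (hcA ε) (hc0 ε h0.le (h3.le.trans hδ1)) b q1
        have m := h.min _ b (hcA ε) hbA (hc0 ε h0.le (h3.le.trans hδ1)) h.b0 q3 h.hB q1 q2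
        unfold Lam at m
        rw [hα, hβ, ← hθ] at m
        refine m.trans ?_
        have := Real.rpow_le_rpow q3.le (hAle ε δ h0.le h3.le hδ1) (by linarith : 0 ≤ 1 + θ)
        have p3 := Real.rpow_nonneg p1.le (-θ)
        nlinarith [mul_le_mul_of_nonneg_right this p3])
    have e : (1 + θ) * (q * D δ) - θ * (2 * QQ gd φ a - QQ gd φ b) - θ * (- QQ gd φ b) =
      (2 * θ) * (D δ - (QQ gd φ a - QQ gd φ b)) := by rw [← hθq]; linear_combination (-QQ gd φ a + QQ gd φ b) * (-hθq)
    rw [e] at this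
    exact nonneg_of_mul_nonneg_right this (by linarith)
  have hDlim : Tendsto (fun n : ℕ => D (1 / ((n:ℝ) + 1))) atTop (𝓝 (∫ x, a x ^ (q - 1) * φ x)) := by
    rw [hD]
    have hbound : AB Ω (fun x => (a x + s x) ^ (q - 1) * |φ x|) :=
      ((haA.add hsA).rpow (fun x => add_nonneg (ha0 x) (hs0 x)) (by linarith : 0 < q - 1)).mul hφA.abs
    refine tendsto_integral_of_dominated_convergence _ (fun n => ?_) (hbound.integrable hΩ hb) (fun n => Eventually.of_forall fun x => ?_)
      (Eventually.of_forall fun x => ?_)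
    · exact (hDint _ (by positivity) (by rw [div_le_one (by positivity)]; linarith [(Nat.cast_nonneg n : (0:ℝ) ≤ n)])).aestronglyMeasurable
    · have h0 : (0:ℝ) ≤ 1 / ((n:ℝ) + 1) := by positivity
      have h1 : (1:ℝ) / ((n:ℝ) + 1) ≤ 1 := by rw [div_le_one (by positivity)]; linarith [(Nat.cast_nonneg n : (0:ℝ) ≤ n)]
      have c := hc0 _ h0 h1 x
      rw [Real.norm_eq_abs, abs_mul, abs_of_nonneg (Real.rpow_nonneg c _)]
      refine mul_le_mul_of_nonneg_right (Real.rpow_le_rpow c ?_ (by linarith)) (abs_nonneg _)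
      rw [hφx]
      nlinarith [ha0 x, hs0 x, mul_nonneg h0 (ha0 x), mul_nonneg (sub_nonneg.2 h1) (hs0 x)]
    · have t : Tendsto (fun n : ℕ => a x + 1 / ((n:ℝ) + 1) * φ x) atTop (𝓝 (a x + 0 * φ x)) :=
        (tendsto_one_div_add_atTop_nhds_zero_nat.mul_const _).const_add _
      rw [zero_mul, add_zero] at t
      exact (t.rpow_const (Or.inr (by linarith))).mul_const _
  have hfin : 0 ≤ (∫ x, a x ^ (q - 1) * φ x) - (QQ gd φ a - QQ gd φ b) := by
    refine ge_of_tendsto (hDlim.sub_const _) (Eventually.of_forall fun n => ?_)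
    exact hlim _ (by positivity) (by rw [div_le_one (by positivity)]; linarith [(Nat.cast_nonneg n : (0:ℝ) ≤ n)])
  have hQz : QQ gd φ a - QQ gd φ b = ∫ x, z x * φ x := by
    rw [← QQ_sub_right hΩ hb gd hφA haA hbA]
    unfold QQ
    rw [← hz]; simp only [mul_comm]
  have hi1 : Integrable (fun x => a x ^ (q - 1) * φ x) := ((haA.rpow ha0 (by linarith : 0 < q - 1)).mul hφA).integrable hΩ hb
  have hi2 : Integrable (fun x => z x * φ x) := (hzA.mul hφA).integrable hΩ hb
  rw [hQz, ← integral_sub hi1 hi2] at hfin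
  have hneg : ∀ x, 0 ≤ -(a x ^ (q - 1) * φ x - z x * φ x) ∧ (-(a x ^ (q - 1) * φ x - z x * φ x) = 0 → a x = s x) := fun x => by
    have hax := ha0 x
    rw [hqp, hφx, hs]
    simp only
    have hr : 0 ≤ a x ^ (1 / p) := Real.rpow_nonneg hax _
    have hrp : (a x ^ (1 / p)) ^ p = a x := by
      rw [← Real.rpow_mul hax, one_div_mul_cancel hp0.ne', Real.rpow_one]
    rcases le_or_gt (z x) 0 with hz0 | hz0
    · rw [max_eq_right hz0, Real.zero_rpow hp0.ne']
      constructor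
      · nlinarith [mul_nonneg hr hax, mul_nonneg (neg_nonneg.2 hz0) hax]
      · intro e
        have h1 : a x ^ (1/p) * a x = 0 := by nlinarith [mul_nonneg hr hax, mul_nonneg (neg_nonneg.2 hz0) hax]
        rcases mul_eq_zero.1 h1 with h2 | h2
        · rw [← hrp, h2, Real.zero_rpow hp0.ne']
        · exact h2
    · rw [max_eq_left hz0.le]
      constructor
      · rcases le_total (a x ^ (1/p)) (z x) with h1 | h1
        · have := Real.rpow_le_rpow hr h1 hp0.le
          rw [hrp] at this
          nlinarith
        · have := Real.rpow_le_rpow hz0.le h1 hp0.le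
          rw [hrp] at this
          nlinarith
      · intro e
        have h1 : (a x ^ (1/p) - z x) * (z x ^ p - a x) = 0 := by linarith
        rcases mul_eq_zero.1 h1 with h2 | h2
        · rw [← hrp, sub_eq_zero.1 h2]
        · exact (sub_eq_zero.1 h2).symm
  have hae : (fun x => -(a x ^ (q - 1) * φ x - z x * φ x)) =ᵐ[volume] 0 := by
    rw [← integral_eq_zero_iff_of_nonneg (fun x => (hneg x).1) (hi1.sub hi2).neg]
    refine le_antisymm ?_ (integral_nonneg fun x => (hneg x).1)
    rw [integral_neg]; linarith
  filter_upwards [hae] with x hx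
  have := (hneg x).2 hx
  rw [this, hs, ← hz]

end

section

variable {Ω : Set E2}

lemma exists_sol (hΩ : IsOpen Ω) (hb : IsBounded Ω) (gd : GreenData Ω) {p : ℝ} (hp : 1 < p) {a0 b0 : E2 → ℝ}
    (ha : AB Ω a0) (hbb : AB Ω b0) (ha0 : ∀ x, 0 ≤ a0 x) (hb0 : ∀ x, 0 ≤ b0 x)
    (hα : 0 < QQ gd a0 a0 - QQ gd a0 b0) (hβ : 0 < QQ gd b0 b0 - QQ gd a0 b0) :
    ∃ v, IsSolution Ω p v ∧ IsNodal Ω v ∧ ∫ x in Ω, |v x| ^ (p + 1) ≤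
      Lam (1 + 1 / p) (Aq (1 + 1 / p) a0) (Aq (1 + 1 / p) b0) (QQ gd a0 a0 - QQ gd a0 b0) (QQ gd b0 b0 - QQ gd a0 b0) := by
  have hp0 : 0 < p := by linarith
  have hq1 : 1 < 1 + 1 / p := by
    have : 0 < 1 / p := by positivity
    linarith
  have hq2 : 1 + 1 / p < 2 := by
    have : 1 / p < 1 := by rw [div_lt_one (by linarith)]; exact hp
    linarith
  have hA0 := QQ_pos_Aq hΩ hb gd hq1 ha ha0 b0 hα
  have hB0 := QQ_pos_Aq hΩ hb gd hq1 hbb hb0 a0 (by rw [QQ_symm hΩ hb gd hbb ha]; exact hβ)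
  obtain ⟨a1, b1, hNP, -⟩ := NP_of_pos hΩ hb gd hq1 hq2 ha hbb ha0 hb0 hA0 hB0 hα hβ
  obtain ⟨a, b, hm⟩ := exists_min hΩ hb gd hp ⟨a1, b1, hNP⟩
  have hmin := hm.min a0 b0 ha hbb ha0 hb0 hA0 hB0 hα hβ
  obtain ⟨z, hz⟩ : ∃ z, z = KK gd (fun y => a y - b y) := ⟨_, rfl⟩
  have e1 := hm.EL hΩ hb hp
  have e2 := (hm.swap hΩ hb).EL hΩ hb hp
  rw [← hz] at e1
  have hz' : ∀ x, KK gd (fun y => b y - a y) x = - z x := fun x => by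
    rw [hz, KK_sub hΩ hb gd hm.aAB hm.bAB, KK_sub hΩ hb gd hm.bAB hm.aAB]; ring
  simp only [hz'] at e2
  have hzA : AB Ω z := by rw [hz]; exact KK_AB hΩ hb gd (hm.aAB.sub hm.bAB)
  obtain ⟨w, hw⟩ : ∃ w : E2 → ℝ, w = fun x => nl p (z x) := ⟨_, rfl⟩
  have hwx : ∀ x, w x = nl p (z x) := fun x => by rw [hw]
  have hwae : ∀ᵐ x, w x = a x - b x := by
    filter_upwards [e1, e2] with x h1 h2
    rw [hwx, h1, h2]
    rcases le_total (z x) 0 with h | h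
    · rw [max_eq_right h, max_eq_left (by linarith), Real.zero_rpow hp0.ne', zero_sub,
        ← nl_of_nonneg hp (by linarith : 0 ≤ - z x), nl_neg, neg_neg]
    · rw [max_eq_left h, max_eq_right (by linarith), Real.zero_rpow hp0.ne', sub_zero, nl_of_nonneg hp h]
  have hzw : KK gd w = z := by
    funext x
    rw [hz]; unfold KK
    refine integral_congr_ae ?_
    filter_upwards [hwae] with y hy
    rw [hy]
  have hwA : AB Ω w := by
    obtain ⟨F, hF, h1⟩ := hzA.bd
    refine ⟨?_, ⟨F ^ p, by positivity, fun x => ?_⟩, fun x hx => ?_⟩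
    · rw [hw]; exact (contDiff_nl hp).continuous.measurable.comp hzA.meas
    · rw [hwx, abs_nl hp]; exact Real.rpow_le_rpow (abs_nonneg _) (h1 x) hp0.le
    · rw [hwx, hzA.out x hx, nl_zero]
  obtain ⟨R, hR⟩ := hb.subset_ball (0 : E2)
  obtain ⟨F, hBM⟩ := hwA.toBM hR
  have hz1 : ContDiffOn ℝ 1 z Ω := by rw [← hzw]; exact KK_C1 hΩ hb gd hBM hR hwA.out
  have hw1 : ContDiffOn ℝ 1 w Ω := by rw [hw]; exact (contDiff_nl hp).comp_contDiffOn hz1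
  obtain ⟨k1, k2⟩ := KK_C2 hΩ hb gd hBM hR hwA.out hw1
  have k3 := KK_continuousOn hΩ hb gd hBM hR hwA.out
  rw [hzw] at k1 k2 k3
  have hpq : ∀ t : ℝ, 0 ≤ t → (t ^ p) ^ (1 + 1 / p) = t ^ (p + 1) := fun t ht => by
    rw [← Real.rpow_mul ht]; congr 1; field_simp
  have hAa : ∀ᵐ x, a x ^ (1 + 1 / p) = max (z x) 0 ^ (p + 1) := by
    filter_upwards [e1] with x h1
    rw [h1, hpq _ (le_max_right _ _)]
  have hAb : ∀ᵐ x, b x ^ (1 + 1 / p) = max (- z x) 0 ^ (p + 1) := by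
    filter_upwards [e2] with x h1
    rw [h1, hpq _ (le_max_right _ _)]
  refine ⟨z, ⟨k1, k3, fun x hx => ?_, fun x hx => ?_⟩, ⟨?_, ?_⟩, ?_⟩
  · rw [k2 x hx, neg_neg, hwx]; rfl
  · rw [hΩ.frontier_eq] at hx; exact hzA.out x hx.2
  · by_contra hcon
    push Not at hcon
    have hz0 : ∀ x, z x ≤ 0 := fun x => by
      by_cases hx : x ∈ Ω
      · exact hcon x hx
      · exact (hzA.out x hx).le
    have : Aq (1 + 1 / p) a = 0 := by
      unfold Aq
      rw [integral_congr_ae hAa]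
      simp [hz0, Real.zero_rpow (by linarith : p + 1 ≠ 0)]
    linarith [hm.hA]
  · by_contra hcon
    push Not at hcon
    have hz0 : ∀ x, 0 ≤ z x := fun x => by
      by_cases hx : x ∈ Ω
      · exact hcon x hx
      · exact (hzA.out x hx).ge
    have : Aq (1 + 1 / p) b = 0 := by
      unfold Aq
      rw [integral_congr_ae hAb]
      simp [hz0, Real.zero_rpow (by linarith : p + 1 ≠ 0)]
    linarith [hm.hB]
  · refine le_of_eq_of_le ?_ hmin
    unfold Aq
    rw [← integral_add ((hm.aAB.rpow hm.a0 (by linarith)).integrable hΩ hb) ((hm.bAB.rpow hm.b0 (by linarith)).integrable hΩ hb),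
      setIntegral_eq_integral_of_forall_compl_eq_zero (fun x hx => by
        rw [hzA.out x hx, abs_zero, Real.zero_rpow (by linarith)])]
    refine integral_congr_ae ?_
    filter_upwards [hAa, hAb] with x h1 h2
    rw [h1, h2]
    have h3 : (0:ℝ) ^ (p + 1) = 0 := Real.zero_rpow (by linarith)
    rcases le_total (z x) 0 with h | h
    · rw [abs_of_nonpos h, max_eq_right h, max_eq_left (by linarith), h3, zero_add]
    · rw [abs_of_nonneg h, max_eq_left h, max_eq_right (by linarith), h3, add_zero]

end

section

variable {Ω : Set E2}

lemma pm_sub (t : ℝ) : max t 0 - max (-t) 0 = t := by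
  rcases le_total t 0 with h | h
  · rw [max_eq_right h, max_eq_left (by linarith)]; ring
  · rw [max_eq_left h, max_eq_right (by linarith)]; ring

lemma sol_data (hΩ : IsOpen Ω) (hb : IsBounded Ω) (gd : GreenData Ω) {p : ℝ} (hp : 1 < p) {u : E2 → ℝ}
    (hu : IsSolution Ω p u) : ∃ w : E2 → ℝ, AB Ω w ∧ (∀ x ∈ Ω, w x = nl p (u x)) ∧ (∀ x ∈ Ω, KK gd w x = u x) ∧
    Aq (1 + 1 / p) (fun x => max (w x) 0) = QQ gd (fun x => max (w x) 0) w ∧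
    Aq (1 + 1 / p) (fun x => max (- w x) 0) = - QQ gd (fun x => max (- w x) 0) w ∧
    Aq (1 + 1 / p) (fun x => max (w x) 0) + Aq (1 + 1 / p) (fun x => max (- w x) 0) = ∫ x in Ω, |u x| ^ (p + 1) := by
  have hp0 : 0 < p := by linarith
  have hq0 : 0 < 1 + 1 / p := by positivity
  obtain ⟨C, hC, hCb⟩ := sol_bdd hb hu
  obtain ⟨w, hw⟩ : ∃ w : E2 → ℝ, w = Ω.indicator (fun x => nl p (u x)) := ⟨_, rfl⟩
  have hwi : ∀ x ∈ Ω, w x = nl p (u x) := fun x hx => by rw [hw, Set.indicator_of_mem hx]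
  have hwo : ∀ x, x ∉ Ω → w x = 0 := fun x hx => by rw [hw, Set.indicator_of_notMem hx]
  have hwA : AB Ω w := by
    refine ⟨?_, ⟨C ^ p, by positivity, fun x => ?_⟩, hwo⟩
    · have h2 : ContinuousOn (fun x => nl p (u x)) Ω := (contDiff_nl hp).continuous.comp_continuousOn hu.1.continuousOn
      rw [hw]
      classical
      rw [← Set.piecewise_eq_indicator]
      exact h2.measurable_piecewise continuousOn_const hΩ.measurableSet
    · by_cases hx : x ∈ Ω
      · rw [hwi x hx, abs_nl hp]; exact Real.rpow_le_rpow (abs_nonneg _) (hCb x (subset_closure hx)) hp0.le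
      · rw [hwo x hx, abs_zero]; positivity
  obtain ⟨R, hR⟩ := hb.subset_ball (0 : E2)
  obtain ⟨F, hBM⟩ := hwA.toBM hR
  have hw1 : ContDiffOn ℝ 1 w Ω := by
    refine ((contDiff_nl hp).comp_contDiffOn (hu.1.of_le (by norm_num))).congr fun x hx => ?_
    rw [hwi x hx]; rfl
  have hK : ∀ x ∈ Ω, u x = KK gd w x := eq_KK hΩ hb gd hBM hR hwA.out hw1 hu.1 hu.2.1 (fun x hx => by
    rw [hwi x hx]
    have := hu.2.2.1 x hx
    unfold nl; linarith) hu.2.2.2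
  have hpq : ∀ t : ℝ, 0 ≤ t → (t ^ p) ^ (1 + 1 / p) = t ^ (p + 1) := fun t ht => by
    rw [← Real.rpow_mul ht]; congr 1; field_simp
  have hq00 : (0:ℝ) ^ (1 + 1 / p) = 0 := Real.zero_rpow hq0.ne'
  -- pointwise description
  have hnl : ∀ t : ℝ, 0 ≤ t → 0 ≤ nl p t := fun t ht => by rw [nl_of_nonneg hp ht]; positivity
  have ptw : ∀ t : ℝ, max (nl p t) 0 ^ (1 + 1 / p) = max (nl p t) 0 * t := fun t => by
    rcases le_total t 0 with h | h
    · have := hnl (-t) (by linarith)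
      rw [nl_neg] at this
      rw [max_eq_right (by linarith), hq00, zero_mul]
    · rw [max_eq_left (hnl t h), nl_mul_self hp, nl_of_nonneg hp h, hpq t h, abs_of_nonneg h]
  have eA : ∀ x, max (w x) 0 ^ (1 + 1 / p) = max (w x) 0 * KK gd w x := fun x => by
    by_cases hx : x ∈ Ω
    · rw [hwi x hx, ← hK x hx]; exact ptw _
    · rw [hwo x hx, max_self, hq00, zero_mul]
  have eB : ∀ x, max (- w x) 0 ^ (1 + 1 / p) = -(max (- w x) 0 * KK gd w x) := fun x => by
    by_cases hx : x ∈ Ω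
    · rw [hwi x hx, ← hK x hx, ← nl_neg, ptw]; ring
    · rw [hwo x hx, neg_zero, max_self, hq00, zero_mul, neg_zero]
  refine ⟨w, hwA, hwi, fun x hx => (hK x hx).symm, ?_, ?_, ?_⟩
  · unfold Aq QQ; simp only [eA]
  · unfold Aq QQ; simp only [eB]; rw [integral_neg]
  · unfold Aq
    rw [← integral_add ((hwA.pos.rpow (fun x => le_max_right _ _) hq0).integrable hΩ hb)
      ((hwA.neg.pos.rpow (fun x => le_max_right _ _) hq0).integrable hΩ hb), ← integral_indicator hΩ.measurableSet]
    refine integral_congr_ae (Eventually.of_forall fun x => ?_)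
    simp only [eA, eB]
    rw [← sub_eq_add_neg, ← sub_mul, pm_sub]
    by_cases hx : x ∈ Ω
    · rw [Set.indicator_of_mem hx, hwi x hx, ← hK x hx, nl_mul_self hp]
    · rw [Set.indicator_of_notMem hx, hwo x hx, zero_mul]

lemma least_le (hΩ : IsOpen Ω) (hb : IsBounded Ω) (gd : GreenData Ω) {p : ℝ} (hp : 1 < p) {u : E2 → ℝ}
    (hu : IsSolution Ω p u) (hl : ∀ v : E2 → ℝ, IsSolution Ω p v → IsNodal Ω v → energy Ω p u ≤ energy Ω p v)
    {a0 b0 : E2 → ℝ}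
    (ha : AB Ω a0) (hbb : AB Ω b0) (ha0 : ∀ x, 0 ≤ a0 x) (hb0 : ∀ x, 0 ≤ b0 x)
    (hα : 0 < QQ gd a0 a0 - QQ gd a0 b0) (hβ : 0 < QQ gd b0 b0 - QQ gd a0 b0) :
    ∫ x in Ω, |u x| ^ (p + 1) ≤
      Lam (1 + 1 / p) (Aq (1 + 1 / p) a0) (Aq (1 + 1 / p) b0) (QQ gd a0 a0 - QQ gd a0 b0) (QQ gd b0 b0 - QQ gd a0 b0) := by
  obtain ⟨v, h1, h2, h3⟩ := exists_sol hΩ hb gd hp ha hbb ha0 hb0 hα hβ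
  refine le_trans ?_ h3
  have := hl v h1 h2
  rw [energy_sol hΩ hb hp hu, energy_sol hΩ hb hp h1] at this
  refine le_of_mul_le_mul_left this ?_
  have : 1 / (p + 1) < 1 / 2 := by
    apply one_div_lt_one_div_of_lt <;> linarith
  linarith

end

section

variable {Ω : Set E2}

structure Conc (gd : GreenData Ω) (P M : E2) (W : ℕ → E2 → ℝ) (C m : ℝ) : Prop where
  wAB : ∀ n, AB Ω (W n)
  l1 : ∀ᶠ n in atTop, ∫ x, |W n x| ≤ C
  small : ∀ ρ, 0 < ρ → ∀ η, 0 < η → ∀ᶠ n in atTop, ∀ x, x ∉ ball P ρ → x ∉ ball M ρ → |W n x| ≤ η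
  pt : ∀ x ∈ Ω, x ≠ P → x ≠ M → Tendsto (fun n => KK gd (W n) x) atTop (𝓝 (m * (gd.G P x - gd.G M x)))

lemma Conc.lim (hΩ : IsOpen Ω) (hb : IsBounded Ω) {gd : GreenData Ω} {P M : E2} {W : ℕ → E2 → ℝ} {C m : ℝ} (h : Conc gd P M W C m)
    {ψ : E2 → ℝ} (hψ : Integrable ψ)
    (hc : ∀ ε, 0 < ε → ∃ ρ, 0 < ρ ∧ ∀ y, (y ∈ ball P ρ ∨ y ∈ ball M ρ) → |ψ y| ≤ ε) :
    Tendsto (fun n => ∫ y, ψ y * W n y) atTop (𝓝 0) := by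
  have hC : 0 ≤ C := by
    obtain ⟨n, hn⟩ := h.l1.exists
    exact (integral_nonneg fun x => abs_nonneg _).trans hn
  rw [Metric.tendsto_nhds]
  intro ε hε
  obtain ⟨e1, he1⟩ : ∃ e1, e1 = ε / (2 * (C + 1)) := ⟨_, rfl⟩
  have he10 : 0 < e1 := by rw [he1]; positivity
  have hI : 0 ≤ ∫ y, |ψ y| := integral_nonneg fun x => abs_nonneg _
  obtain ⟨η, hη⟩ : ∃ η, η = ε / (2 * ((∫ y, |ψ y|) + 1)) := ⟨_, rfl⟩
  have hη0 : 0 < η := by rw [hη]; positivity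
  obtain ⟨ρ, hρ, hρ'⟩ := hc e1 he10
  filter_upwards [h.l1, h.small ρ hρ η hη0] with n h1 h2
  rw [Real.dist_eq, sub_zero]
  have hWi := ((h.wAB n).abs).integrable hΩ hb
  calc |∫ y, ψ y * W n y| ≤ ∫ y, |ψ y * W n y| := abs_integral_le_integral_abs
    _ ≤ ∫ y, (e1 * |W n y| + η * |ψ y|) := by
        refine integral_mono_of_nonneg (Eventually.of_forall fun x => abs_nonneg _) ((hWi.const_mul _).add (hψ.abs.const_mul _))
          (Eventually.of_forall fun y => ?_)
        simp only [abs_mul]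
        have k1 := abs_nonneg (W n y)
        have k2 := abs_nonneg (ψ y)
        by_cases hy : y ∈ ball P ρ ∨ y ∈ ball M ρ
        · nlinarith [hρ' y hy]
        · push Not at hy
          nlinarith [h2 y hy.1 hy.2]
    _ = e1 * (∫ y, |W n y|) + η * ∫ y, |ψ y| := by
        rw [integral_add (hWi.const_mul _) (hψ.abs.const_mul _), integral_const_mul, integral_const_mul]
    _ ≤ e1 * C + η * ∫ y, |ψ y| := by gcongr
    _ < ε := by
        have a1 : e1 * (C + 1) = ε / 2 := by rw [he1]; field_simp
        have a2 : η * ((∫ y, |ψ y|) + 1) = ε / 2 := by rw [hη]; field_simp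
        nlinarith

lemma G_contAt (hΩ : IsOpen Ω) (gd : GreenData Ω) {x P : E2} (hx : x ∈ Ω) (hP : P ∈ Ω) (hne : x ≠ P) :
    ContinuousAt (gd.G x) P := by
  have : gd.G x = fun y => -(1 / (2 * π)) * Real.log ‖x - y‖ + gd.H x y := by funext y; exact gd.decomp x y
  rw [this]
  have h1 : ContinuousAt (gd.H x) P := (gd.contH x hx).continuousAt (mem_of_superset (hΩ.mem_nhds hP) subset_closure)
  have h2 : ContinuousAt (fun y : E2 => Real.log ‖x - y‖) P :=
    ContinuousAt.log (by fun_prop) (norm_ne_zero_iff.2 (sub_ne_zero.2 hne))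
  exact (h2.const_mul _).add h1

lemma exists_G_gt (hΩ : IsOpen Ω) (gd : GreenData Ω) {P M : E2} (hP : P ∈ Ω) (hM : M ∈ Ω) (hne : P ≠ M) :
    ∃ x ∈ Ω, x ≠ P ∧ x ≠ M ∧ gd.G M x < gd.G P x := by
  have h1 : ContinuousAt (gd.H P) P := (gd.contH P hP).continuousAt (mem_of_superset (hΩ.mem_nhds hP) subset_closure)
  have h2 : ContinuousAt (gd.G M) P := G_contAt hΩ gd hM hP hne.symm
  have h3 : Tendsto (fun y => ‖P - y‖) (𝓝[≠] P) (𝓝[>] 0) := by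
    refine tendsto_nhdsWithin_iff.2 ⟨?_, ?_⟩
    · have : Tendsto (fun y => ‖P - y‖) (𝓝 P) (𝓝 ‖P - P‖) := by
        apply Continuous.tendsto; fun_prop
      rw [sub_self, norm_zero] at this
      exact this.mono_left nhdsWithin_le_nhds
    · filter_upwards [self_mem_nhdsWithin] with y hy
      exact norm_pos_iff.2 (sub_ne_zero.2 (Ne.symm hy))
  have h4 : Tendsto (fun y => -(1 / (2 * π)) * Real.log ‖P - y‖) (𝓝[≠] P) atTop :=
    (Real.tendsto_log_nhdsGT_zero.comp h3).const_mul_atBot_of_neg (by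
      have : 0 < 1 / (2 * π) := by positivity
      linarith)
  have h5 : Tendsto (fun y => -(1 / (2 * π)) * Real.log ‖P - y‖ + (gd.H P y - gd.G M y)) (𝓝[≠] P) atTop :=
    h4.atTop_add ((h1.sub h2).tendsto.mono_left nhdsWithin_le_nhds)
  have e1 := h5.eventually (eventually_gt_atTop 0)
  have e2 : ∀ᶠ y in 𝓝[≠] P, y ∈ Ω := nhdsWithin_le_nhds (hΩ.mem_nhds hP)
  have e3 : ∀ᶠ y in 𝓝[≠] P, y ≠ M := nhdsWithin_le_nhds (isOpen_ne.mem_nhds hne)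
  have e4 : ∀ᶠ y in 𝓝[≠] P, y ≠ P := self_mem_nhdsWithin
  obtain ⟨y, y1, y2, y3, y4⟩ := (e1.and (e2.and (e3.and e4))).exists
  refine ⟨y, y2, y4, y3, ?_⟩
  rw [gd.decomp P y]; linarith

lemma Conc.mass (hΩ : IsOpen Ω) (hb : IsBounded Ω) {gd : GreenData Ω} {P M : E2} {W : ℕ → E2 → ℝ} {C m : ℝ} (h : Conc gd P M W C m)
    (hP : P ∈ Ω) (hM : M ∈ Ω) (hne : P ≠ M) {r : ℝ} (hr : 0 < r) (hdis : Disjoint (ball P r) (ball M r)) :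
    Tendsto (fun n => ∫ y in ball P r, W n y) atTop (𝓝 m) ∧ Tendsto (fun n => ∫ y in ball M r, W n y) atTop (𝓝 (-m)) := by
  have key : ∀ x ∈ Ω, x ≠ P → x ≠ M → Tendsto (fun n => ((∫ y in ball P r, W n y) - m) * gd.G P x
      + ((∫ y in ball M r, W n y) + m) * gd.G M x) atTop (𝓝 0) := fun x hx hxP hxM => by
    obtain ⟨ψ, hψ⟩ : ∃ ψ : E2 → ℝ, ψ = fun y => kk gd x y - (ball P r).indicator (fun _ => gd.G P x) y
      - (ball M r).indicator (fun _ => gd.G M x) y := ⟨_, rfl⟩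
    have i1 : Integrable ((ball P r).indicator (fun _ : E2 => gd.G P x)) := by
      rw [integrable_indicator_iff measurableSet_ball]
      exact integrableOn_const measure_ball_lt_top.ne (by exact enorm_ne_top)
    have i2 : Integrable ((ball M r).indicator (fun _ : E2 => gd.G M x)) := by
      rw [integrable_indicator_iff measurableSet_ball]
      exact integrableOn_const measure_ball_lt_top.ne (by exact enorm_ne_top)
    have iψ : Integrable ψ := by rw [hψ]; exact ((kk_integrable hΩ hb gd x).sub i1).sub i2
    have loc : ∀ Q ∈ Ω, x ≠ Q → ∀ ε, 0 < ε → ∃ ρ, 0 < ρ ∧ ∀ y ∈ ball Q ρ, |kk gd x y - gd.G Q x| ≤ ε := fun Q hQ hxQ ε hε => by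
      have c := G_contAt hΩ gd hx hQ hxQ
      have e1 : ∀ᶠ y in 𝓝 Q, |gd.G x y - gd.G x Q| < ε := by
        have := Metric.tendsto_nhds.1 c ε hε
        simpa [Real.dist_eq] using this
      have e2 : ∀ᶠ y in 𝓝 Q, y ∈ Ω := hΩ.mem_nhds hQ
      have e3 : ∀ᶠ y in 𝓝 Q, y ≠ x := isOpen_ne.mem_nhds hxQ.symm
      obtain ⟨ρ, hρ, hρ'⟩ := Metric.eventually_nhds_iff_ball.1 (e1.and (e2.and e3))
      refine ⟨ρ, hρ, fun y hy => ?_⟩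
      obtain ⟨y1, y2, y3⟩ := hρ' y hy
      rw [kk_eq gd hx y2 y3.symm, gd.symm Q x]; exact y1.le
    have L := h.lim hΩ hb iψ (fun ε hε => by
      obtain ⟨ρ1, h1, h1'⟩ := loc P hP hxP ε hε
      obtain ⟨ρ2, h2, h2'⟩ := loc M hM hxM ε hε
      refine ⟨min r (min ρ1 ρ2), by positivity, fun y hy => ?_⟩
      rw [hψ]
      simp only
      rcases hy with hy | hy
      · have yr : y ∈ ball P r := ball_subset_ball (min_le_left _ _) hy
        have yρ : y ∈ ball P ρ1 := ball_subset_ball ((min_le_right _ _).trans (min_le_left _ _)) hy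
        have yn : y ∉ ball M r := fun hh => Set.disjoint_left.1 hdis yr hh
        rw [Set.indicator_of_mem yr, Set.indicator_of_notMem yn, sub_zero]; exact h1' y yρ
      · have yr : y ∈ ball M r := ball_subset_ball (min_le_left _ _) hy
        have yρ : y ∈ ball M ρ2 := ball_subset_ball ((min_le_right _ _).trans (min_le_right _ _)) hy
        have yn : y ∉ ball P r := fun hh => Set.disjoint_left.1 hdis hh yr
        rw [Set.indicator_of_mem yr, Set.indicator_of_notMem yn, sub_zero]; exact h2' y yρ)
    have e : ∀ n, ∫ y, ψ y * W n y = KK gd (W n) x - (∫ y in ball P r, W n y) * gd.G P x - (∫ y in ball M r, W n y) * gd.G M x := fun n => by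
      have wi := (h.wAB n).integrable hΩ hb
      rw [← integral_indicator measurableSet_ball, ← integral_indicator measurableSet_ball, ← integral_mul_const, ← integral_mul_const]
      unfold KK
      rw [← integral_sub (kk_mul_int hΩ hb gd (h.wAB n) x) ((wi.indicator measurableSet_ball).mul_const _),
        ← integral_sub (f := fun a => kk gd x a * W n a - (ball P r).indicator (W n) a * gd.G P x)
          ((kk_mul_int hΩ hb gd (h.wAB n) x).sub ((wi.indicator measurableSet_ball).mul_const _)) ((wi.indicator measurableSet_ball).mul_const _)]
      refine integral_congr_ae (Eventually.of_forall fun y => ?_)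
      rw [hψ]
      by_cases y1 : y ∈ ball P r <;> by_cases y2 : y ∈ ball M r <;> simp only [y1, y2, Set.indicator_of_mem, Set.indicator_of_notMem, not_false_eq_true] <;> ring
    simp only [e] at L
    have L2 := (h.pt x hx hxP hxM).sub L
    rw [sub_zero] at L2
    have L3 := L2.sub_const (m * (gd.G P x - gd.G M x))
    rw [sub_self] at L3
    refine L3.congr fun n => ?_
    ring
  obtain ⟨x0, a1, a2, a3, a4⟩ := exists_G_gt hΩ gd hP hM hne
  obtain ⟨x1, b1, b2, b3, b4⟩ := exists_G_gt hΩ gd hM hP hne.symm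
  have k0 := key x0 a1 a2 a3
  have k1 := key x1 b1 b3 b2
  have p1 : 0 ≤ gd.G M x0 := G_nonneg hΩ hb gd hM a1 a3.symm
  have p2 : 0 ≤ gd.G P x1 := G_nonneg hΩ hb gd hP b1 b3.symm
  have hdet : 0 < gd.G P x0 * gd.G M x1 - gd.G P x1 * gd.G M x0 := by nlinarith
  constructor
  · have L := ((k0.mul_const (gd.G M x1)).sub (k1.mul_const (gd.G M x0))).div_const (gd.G P x0 * gd.G M x1 - gd.G P x1 * gd.G M x0)
    have L' := L.add_const m
    simp only [zero_mul, sub_self, zero_div, zero_add] at L'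
    refine L'.congr fun n => ?_
    rw [div_add' _ _ _ hdet.ne', div_eq_iff hdet.ne']
    ring
  · have L := ((k1.mul_const (gd.G P x0)).sub (k0.mul_const (gd.G P x1))).div_const (gd.G P x0 * gd.G M x1 - gd.G P x1 * gd.G M x0)
    have L' := L.sub_const m
    simp only [zero_mul, sub_self, zero_div, zero_sub] at L'
    refine L'.congr fun n => ?_
    rw [div_sub' hdet.ne', div_eq_iff hdet.ne']
    ring

end

section

variable {Ω : Set E2}

/-- restriction to a ball followed by a translation -/
def tr (f : E2 → ℝ) (c : E2) (r : ℝ) (h : E2) : E2 → ℝ := fun z => (ball c r).indicator f (z - h)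

lemma tr_AB {f : E2 → ℝ} (hf : AB Ω f) {c h : E2} {r : ℝ} (hc : ball (c + h) r ⊆ Ω) : AB Ω (tr f c r h) := by
  obtain ⟨F, hF, h1⟩ := hf.bd
  refine ⟨?_, ⟨F, hF, fun x => ?_⟩, fun x hx => ?_⟩
  · exact (hf.meas.indicator measurableSet_ball).comp (measurable_id.sub_const h)
  · unfold tr
    by_cases hx : x - h ∈ ball c r
    · rw [Set.indicator_of_mem hx]; exact h1 _
    · rw [Set.indicator_of_notMem hx, abs_zero]; exact hF
  · unfold tr
    rw [Set.indicator_of_notMem]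
    intro hh
    refine hx (hc ?_)
    rw [mem_ball_iff_norm] at hh ⊢
    rwa [show x - (c + h) = x - h - c by abel]

lemma QQ_tr (hΩ : IsOpen Ω) (hb : IsBounded Ω) (gd : GreenData Ω) {f g : E2 → ℝ} (hf : AB Ω f) (hg : AB Ω g)
    {c c' h h' : E2} {r δ ε : ℝ} (hc : ball (c + h) r ⊆ Ω) (hc' : ball (c' + h') r ⊆ Ω) (hε : 0 ≤ ε)
    (hK : ∀ s ∈ ball c r, ∀ t ∈ ball c' r, s ≠ t → |kk gd (s + h) (t + h') - kk gd s t - δ| ≤ ε) :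
    |QQ gd (tr f c r h) (tr g c' r h') - QQ gd ((ball c r).indicator f) ((ball c' r).indicator g)
      - δ * (∫ x in ball c r, f x) * (∫ x in ball c' r, g x)| ≤ ε * (∫ x, |f x|) * (∫ x, |g x|) := by
  obtain ⟨f1, hf1⟩ : ∃ f1, f1 = (ball c r).indicator f := ⟨_, rfl⟩
  obtain ⟨g1, hg1⟩ : ∃ g1, g1 = (ball c' r).indicator g := ⟨_, rfl⟩
  have hf1A : AB Ω f1 := by rw [hf1]; exact hf.indicator measurableSet_ball
  have hg1A : AB Ω g1 := by rw [hg1]; exact hg.indicator measurableSet_ball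
  have hgt := tr_AB hg hc'
  have hft := tr_AB hf hc
  have hf1o : ∀ s, s ∉ ball c r → f1 s = 0 := fun s hs => by rw [hf1, Set.indicator_of_notMem hs]
  have hg1o : ∀ s, s ∉ ball c' r → g1 s = 0 := fun s hs => by rw [hg1, Set.indicator_of_notMem hs]
  have hf1le : ∀ s, |f1 s| ≤ |f s| := fun s => by
    rw [hf1]; by_cases hs : s ∈ ball c r <;> simp [hs]
  have hg1le : ∀ s, |g1 s| ≤ |g s| := fun s => by
    rw [hg1]; by_cases hs : s ∈ ball c' r <;> simp [hs]
  have trf : ∀ s, tr f c r h (s + h) = f1 s := fun s => by unfold tr; rw [add_sub_cancel_right, hf1]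
  have trg : ∀ s, tr g c' r h' (s + h') = g1 s := fun s => by unfold tr; rw [add_sub_cancel_right, hg1]
  have hfg : Integrable f1 := hf1A.integrable hΩ hb
  have hgg : Integrable g1 := hg1A.integrable hΩ hb
  -- the translated kernel integral
  have eK : ∀ s, KK gd (tr g c' r h') (s + h) = ∫ t, kk gd (s + h) (t + h') * g1 t := fun s => by
    unfold KK
    rw [← integral_add_right_eq_self (fun y => kk gd (s + h) y * tr g c' r h' y) h']
    simp only [trg]
  have iK : ∀ s, Integrable (fun t => kk gd (s + h) (t + h') * g1 t) := fun s => by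
    have := (kk_mul_int hΩ hb gd hgt (s + h)).comp_add_right h'
    simpa only [trg] using this
  have bd : ∀ s ∈ ball c r, |KK gd (tr g c' r h') (s + h) - KK gd g1 s - δ * ∫ t, g1 t| ≤ ε * ∫ t, |g t| := fun s hs => by
    rw [eK s]
    have i2 := kk_mul_int hΩ hb gd hg1A s
    unfold KK
    rw [← integral_const_mul, ← integral_sub (iK s) i2,
      ← integral_sub (f := fun t => kk gd (s + h) (t + h') * g1 t - kk gd s t * g1 t) ((iK s).sub i2) (hgg.const_mul δ),
      ← integral_const_mul]
    refine abs_integral_le_integral_abs.trans ?_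
    refine integral_mono_ae (((iK s).sub i2).sub (hgg.const_mul δ)).abs ((hg.abs.integrable hΩ hb).const_mul ε) ?_
    filter_upwards [ae_ne_pt s] with t ht
    by_cases htb : t ∈ ball c' r
    · rw [show kk gd (s + h) (t + h') * g1 t - kk gd s t * g1 t - δ * g1 t = (kk gd (s + h) (t + h') - kk gd s t - δ) * g1 t by ring, abs_mul]
      exact mul_le_mul (hK s hs t htb ht) (hg1le t) (abs_nonneg _) hε
    · rw [hg1o t htb]; simp only [mul_zero, sub_zero, abs_zero]; positivity
  have e1 : QQ gd (tr f c r h) (tr g c' r h') = ∫ s, f1 s * KK gd (tr g c' r h') (s + h) := by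
    unfold QQ
    rw [← integral_add_right_eq_self (fun y => tr f c r h y * KK gd (tr g c' r h') y) h]
    simp only [trf]
  have j1 : Integrable (fun s => f1 s * KK gd (tr g c' r h') (s + h)) := by
    have := (QQ_int hΩ hb gd hft hgt).comp_add_right h
    simpa only [trf] using this
  have j2 := QQ_int hΩ hb gd hf1A hg1A
  have j3 := hfg.mul_const (δ * ∫ t, g1 t)
  have e3 : δ * (∫ x in ball c r, f x) * (∫ x in ball c' r, g x) = ∫ s, f1 s * (δ * ∫ t, g1 t) := by
    rw [integral_mul_const, hf1, hg1, integral_indicator measurableSet_ball, integral_indicator measurableSet_ball]; ring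
  rw [e1, e3, ← hf1, ← hg1]
  unfold QQ
  rw [← integral_sub j1 j2, ← integral_sub (f := fun s => f1 s * KK gd (tr g c' r h') (s + h) - f1 s * KK gd g1 s) (j1.sub j2) j3]
  refine abs_integral_le_integral_abs.trans ?_
  rw [show ε * (∫ x, |f x|) * (∫ x, |g x|) = ∫ x, |f x| * (ε * ∫ x, |g x|) by rw [integral_mul_const]; ring]
  have hgn : 0 ≤ ∫ x, |g x| := integral_nonneg fun x => abs_nonneg _
  refine integral_mono ((j1.sub j2).sub j3).abs ((hf.abs.integrable hΩ hb).mul_const _) fun s => ?_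
  simp only
  by_cases hs : s ∈ ball c r
  · rw [show f1 s * KK gd (tr g c' r h') (s + h) - f1 s * KK gd g1 s - f1 s * (δ * ∫ t, g1 t)
      = f1 s * (KK gd (tr g c' r h') (s + h) - KK gd g1 s - δ * ∫ t, g1 t) by ring, abs_mul]
    exact mul_le_mul (hf1le s) (bd s hs) (abs_nonneg _) (abs_nonneg _)
  · rw [hf1o s hs]; simp only [zero_mul, sub_zero, abs_zero]; positivity

lemma QQ_abs_le (hΩ : IsOpen Ω) (hb : IsBounded Ω) (gd : GreenData Ω) {f g : E2 → ℝ} (hf : AB Ω f) (hg : AB Ω g)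
    {η Mk : ℝ} (hη : 0 ≤ η) (hM : ∀ x, ∫ y, kk gd x y ≤ Mk) (h : ∀ x, |g x| ≤ η) :
    |QQ gd f g| ≤ (∫ x, |f x|) * (η * Mk) := by
  unfold QQ
  refine abs_integral_le_integral_abs.trans ?_
  rw [← integral_mul_const]
  refine integral_mono (QQ_int hΩ hb gd hf hg).abs ((hf.abs.integrable hΩ hb).mul_const _) fun x => ?_
  simp only [abs_mul]
  exact mul_le_mul_of_nonneg_left ((KK_abs_le hΩ hb gd h x).trans (mul_le_mul_of_nonneg_left (hM x) hη)) (abs_nonneg _)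

/-- transplantation of a function concentrated near `P, M` to the points `P + h, M + k` -/
def sft (f : E2 → ℝ) (P M : E2) (r : ℝ) (h k : E2) : E2 → ℝ := fun z => tr f P r h z + tr f M r k z

lemma sft_diff (hΩ : IsOpen Ω) (hb : IsBounded Ω) (gd : GreenData Ω) {F W : E2 → ℝ} (hF : AB Ω F) (hW : AB Ω W)
    (hFW : ∀ x, |F x| ≤ |W x|) {P M h k : E2} {r d11 d12 d22 ε η C Mk : ℝ} (hε : 0 ≤ ε) (hη : 0 ≤ η)
    (hdis : Disjoint (ball P r) (ball M r))
    (hP : ball (P + h) r ⊆ Ω) (hM : ball (M + k) r ⊆ Ω)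
    (hMk : ∀ x, ∫ y, kk gd x y ≤ Mk) (hMk0 : 0 ≤ Mk) (hC : ∫ x, |W x| ≤ C)
    (hsm : ∀ x, x ∉ ball P r → x ∉ ball M r → |W x| ≤ η)
    (h11 : ∀ s ∈ ball P r, ∀ t ∈ ball P r, s ≠ t → |kk gd (s + h) (t + h) - kk gd s t - d11| ≤ ε)
    (h12 : ∀ s ∈ ball P r, ∀ t ∈ ball M r, s ≠ t → |kk gd (s + h) (t + k) - kk gd s t - d12| ≤ ε)
    (h22 : ∀ s ∈ ball M r, ∀ t ∈ ball M r, s ≠ t → |kk gd (s + k) (t + k) - kk gd s t - d22| ≤ ε) :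
    |QQ gd (sft F P M r h k) (sft W P M r h k) - QQ gd F W
      - (d11 * (∫ x in ball P r, F x) * (∫ x in ball P r, W x) + d12 * (∫ x in ball P r, F x) * (∫ x in ball M r, W x)
        + d12 * (∫ x in ball M r, F x) * (∫ x in ball P r, W x) + d22 * (∫ x in ball M r, F x) * (∫ x in ball M r, W x))|
      ≤ 4 * (ε * C * C) + 3 * (C * (η * Mk)) := by
  have hC0 : 0 ≤ C := (integral_nonneg fun x => abs_nonneg _).trans hC
  have hFC : ∫ x, |F x| ≤ C := (integral_mono (hF.abs.integrable hΩ hb) (hW.abs.integrable hΩ hb) hFW).trans hC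
  have hF0 : 0 ≤ ∫ x, |F x| := integral_nonneg fun x => abs_nonneg _
  have hW0 : 0 ≤ ∫ x, |W x| := integral_nonneg fun x => abs_nonneg _
  have hFWC : ε * (∫ x, |F x|) * (∫ x, |W x|) ≤ ε * C * C := by gcongr
  have t11 := (QQ_tr hΩ hb gd hF hW hP hP hε h11).trans hFWC
  have t12 := (QQ_tr hΩ hb gd hF hW hP hM hε h12).trans hFWC
  have t21 := (QQ_tr hΩ hb gd hF hW hM hP hε (δ := d12) (fun s hs t ht hst => by
    rw [kk_symm gd (s + k), kk_symm gd s]; exact h12 t ht s hs hst.symm)).trans hFWC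
  have t22 := (QQ_tr hΩ hb gd hF hW hM hM hε h22).trans hFWC
  have aP := tr_AB hF hP
  have aM := tr_AB hF hM
  have wP := tr_AB hW hP
  have wM := tr_AB hW hM
  have e1 : QQ gd (sft F P M r h k) (sft W P M r h k) = QQ gd (tr F P r h) (tr W P r h) + QQ gd (tr F P r h) (tr W M r k)
      + (QQ gd (tr F M r k) (tr W P r h) + QQ gd (tr F M r k) (tr W M r k)) := by
    unfold sft
    rw [QQ_add_left hΩ hb gd aP aM (wP.add wM), QQ_add_right hΩ hb gd aP wP wM, QQ_add_right hΩ hb gd aM wP wM]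
  obtain ⟨F1, hF1⟩ : ∃ F1, F1 = (ball P r).indicator F := ⟨_, rfl⟩
  obtain ⟨F2, hF2⟩ : ∃ F1, F1 = (ball M r).indicator F := ⟨_, rfl⟩
  obtain ⟨W1, hW1⟩ : ∃ F1, F1 = (ball P r).indicator W := ⟨_, rfl⟩
  obtain ⟨W2, hW2⟩ : ∃ F1, F1 = (ball M r).indicator W := ⟨_, rfl⟩
  have aF1 : AB Ω F1 := by rw [hF1]; exact hF.indicator measurableSet_ball
  have aF2 : AB Ω F2 := by rw [hF2]; exact hF.indicator measurableSet_ball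
  have aW1 : AB Ω W1 := by rw [hW1]; exact hW.indicator measurableSet_ball
  have aW2 : AB Ω W2 := by rw [hW2]; exact hW.indicator measurableSet_ball
  have lF1 : ∫ x, |F1 x| ≤ C := (integral_mono (aF1.abs.integrable hΩ hb) (hF.abs.integrable hΩ hb) (fun x => by
    rw [hF1]; by_cases hs : x ∈ ball P r <;> simp [hs])).trans hFC
  have lF2 : ∫ x, |F2 x| ≤ C := (integral_mono (aF2.abs.integrable hΩ hb) (hF.abs.integrable hΩ hb) (fun x => by
    rw [hF2]; by_cases hs : x ∈ ball M r <;> simp [hs])).trans hFC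
  have rem : ∀ f : E2 → ℝ, (∀ x, |f x| ≤ |W x|) → ∀ x, |f x - ((ball P r).indicator f x + (ball M r).indicator f x)| ≤ η := fun f hf x => by
    by_cases h1 : x ∈ ball P r
    · have h2 : x ∉ ball M r := fun hh => Set.disjoint_left.1 hdis h1 hh
      simp [h1, h2, hη]
    · by_cases h2 : x ∈ ball M r
      · simp [h1, h2, hη]
      · simp only [h1, h2, not_false_eq_true, Set.indicator_of_notMem, add_zero, sub_zero]
        exact (hf x).trans (hsm x h1 h2)
  have aF3 : AB Ω (fun x => F x - (F1 x + F2 x)) := hF.sub (aF1.add aF2)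
  have aW3 : AB Ω (fun x => W x - (W1 x + W2 x)) := hW.sub (aW1.add aW2)
  have r1 := QQ_abs_le hΩ hb gd hW aF3 hη hMk (by rw [hF1, hF2]; exact rem F hFW)
  have r2 := QQ_abs_le hΩ hb gd aF1 aW3 hη hMk (by rw [hW1, hW2]; exact rem W (fun x => le_rfl))
  have r3 := QQ_abs_le hΩ hb gd aF2 aW3 hη hMk (by rw [hW1, hW2]; exact rem W (fun x => le_rfl))
  have hnn : 0 ≤ η * Mk := mul_nonneg hη hMk0
  have r1' := r1.trans (mul_le_mul_of_nonneg_right hC hnn)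
  have r2' := r2.trans (mul_le_mul_of_nonneg_right lF1 hnn)
  have r3' := r3.trans (mul_le_mul_of_nonneg_right lF2 hnn)
  rw [QQ_symm hΩ hb gd hW aF3, QQ_sub_left hΩ hb gd hF (aF1.add aF2) hW, QQ_add_left hΩ hb gd aF1 aF2 hW] at r1'
  rw [QQ_sub_right hΩ hb gd aF1 hW (aW1.add aW2), QQ_add_right hΩ hb gd aF1 aW1 aW2] at r2'
  rw [QQ_sub_right hΩ hb gd aF2 hW (aW1.add aW2), QQ_add_right hΩ hb gd aF2 aW1 aW2] at r3'
  rw [← hF1, ← hW1] at t11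
  rw [← hF1, ← hW2] at t12
  rw [← hF2, ← hW1] at t21
  rw [← hF2, ← hW2] at t22
  rw [e1]
  rw [abs_le] at t11 t12 t21 t22 r1' r2' r3' ⊢
  constructor <;> linarith [t11.1, t12.1, t21.1, t22.1, r1'.1, r2'.1, r3'.1, t11.2, t12.2, t21.2, t22.2, r1'.2, r2'.2, r3'.2]

end

section

variable {Ω : Set E2}

lemma H_contAt (hΩ : IsOpen Ω) (gd : GreenData Ω) {x y : E2} (hx : x ∈ Ω) (hy : y ∈ Ω) :
    ContinuousAt (fun q : E2 × E2 => gd.H q.1 q.2) (x, y) :=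
  (H_contOn gd).continuousAt ((hΩ.prod hΩ).mem_nhds ⟨hx, hy⟩)

lemma ev_mem (hΩ : IsOpen Ω) {c c' h h' : E2} (h1 : c ∈ Ω) (h2 : c' ∈ Ω) (h3 : c + h ∈ Ω) (h4 : c' + h' ∈ Ω) :
    ∀ᶠ q : E2 × E2 in 𝓝 (c, c'), q.1 ∈ Ω ∧ q.2 ∈ Ω ∧ q.1 + h ∈ Ω ∧ q.2 + h' ∈ Ω := by
  have c1 : ContinuousAt (fun q : E2 × E2 => q.1) (c, c') := continuousAt_fst
  have c2 : ContinuousAt (fun q : E2 × E2 => q.2) (c, c') := continuousAt_snd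
  have c3 : ContinuousAt (fun q : E2 × E2 => q.1 + h) (c, c') := c1.add continuousAt_const
  have c4 : ContinuousAt (fun q : E2 × E2 => q.2 + h') (c, c') := c2.add continuousAt_const
  exact (c1.eventually (hΩ.mem_nhds h1)).and ((c2.eventually (hΩ.mem_nhds h2)).and
    ((c3.eventually (hΩ.mem_nhds h3)).and (c4.eventually (hΩ.mem_nhds h4))))

lemma kk_diff_diag (hΩ : IsOpen Ω) (gd : GreenData Ω) {c h : E2} (h1 : c ∈ Ω) (h2 : c + h ∈ Ω) {ε : ℝ} (hε : 0 < ε) :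
    ∃ r, 0 < r ∧ ∀ s ∈ ball c r, ∀ t ∈ ball c r, s ≠ t →
      |kk gd (s + h) (t + h) - kk gd s t - (gd.H (c + h) (c + h) - gd.H c c)| ≤ ε := by
  have c1 : ContinuousAt (fun q : E2 × E2 => gd.H (q.1 + h) (q.2 + h)) (c, c) := by
    have := H_contAt hΩ gd h2 h2
    exact ContinuousAt.comp (f := fun q : E2 × E2 => (q.1 + h, q.2 + h)) (x := (c, c)) this (by fun_prop)
  have c2 := H_contAt hΩ gd h1 h1
  have e1 := Metric.tendsto_nhds.1 (c1.sub c2) ε hε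
  obtain ⟨r, hr, hr'⟩ := Metric.eventually_nhds_iff_ball.1 (e1.and (ev_mem hΩ h1 h1 h2 h2))
  refine ⟨r, hr, fun s hs t ht hst => ?_⟩
  obtain ⟨d, m1, m2, m3, m4⟩ := hr' (s, t) (by rw [← ball_prod_same]; exact ⟨hs, ht⟩)
  rw [Real.dist_eq] at d
  have hst' : s + h ≠ t + h := fun hh => hst (add_right_cancel hh)
  rw [kk_eq gd m3 m4 hst', kk_eq gd m1 m2 hst, gd.decomp, gd.decomp s t, add_sub_add_right_eq_sub]
  refine le_trans (le_of_eq ?_) d.le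
  congr 1
  simp only [Pi.sub_apply]
  ring

lemma kk_diff_off (hΩ : IsOpen Ω) (gd : GreenData Ω) {c c' h h' : E2} (h1 : c ∈ Ω) (h2 : c + h ∈ Ω) (h3 : c' ∈ Ω) (h4 : c' + h' ∈ Ω)
    (hne : c ≠ c') (hne' : c + h ≠ c' + h') {ε : ℝ} (hε : 0 < ε) :
    ∃ r, 0 < r ∧ ∀ s ∈ ball c r, ∀ t ∈ ball c' r, s ≠ t →
      |kk gd (s + h) (t + h') - kk gd s t - (gd.G (c + h) (c' + h') - gd.G c c')| ≤ ε := by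
  have gc : ∀ {x y : E2}, x ∈ Ω → y ∈ Ω → x ≠ y → ContinuousAt (fun q : E2 × E2 => gd.G q.1 q.2) (x, y) := fun {x y} hx hy hxy => by
    have : (fun q : E2 × E2 => gd.G q.1 q.2) = fun q => -(1 / (2 * π)) * Real.log ‖q.1 - q.2‖ + gd.H q.1 q.2 := by
      funext q; exact gd.decomp _ _
    rw [this]
    have l : ContinuousAt (fun q : E2 × E2 => Real.log ‖q.1 - q.2‖) (x, y) :=
      ContinuousAt.log (by fun_prop) (norm_ne_zero_iff.2 (sub_ne_zero.2 hxy))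
    exact (l.const_mul _).add (H_contAt hΩ gd hx hy)
  have c1 : ContinuousAt (fun q : E2 × E2 => gd.G (q.1 + h) (q.2 + h')) (c, c') := by
    have := gc h2 h4 hne'
    exact ContinuousAt.comp (f := fun q : E2 × E2 => (q.1 + h, q.2 + h')) (x := (c, c')) this (by fun_prop)
  have c2 := gc h1 h3 hne
  have e1 := Metric.tendsto_nhds.1 (c1.sub c2) ε hε
  have e2 : ∀ᶠ q : E2 × E2 in 𝓝 (c, c'), q.1 + h ≠ q.2 + h' := by
    have cc : ContinuousAt (fun q : E2 × E2 => (q.1 + h) - (q.2 + h')) (c, c') := by fun_prop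
    filter_upwards [cc.eventually_ne (sub_ne_zero.2 hne')] with q hq
    exact sub_ne_zero.1 hq
  obtain ⟨r, hr, hr'⟩ := Metric.eventually_nhds_iff_ball.1 (e1.and (e2.and (ev_mem hΩ h1 h3 h2 h4)))
  refine ⟨r, hr, fun s hs t ht hst => ?_⟩
  obtain ⟨d, n1, m1, m2, m3, m4⟩ := hr' (s, t) (by rw [← ball_prod_same]; exact ⟨hs, ht⟩)
  rw [Real.dist_eq] at d
  rw [kk_eq gd m3 m4 n1, kk_eq gd m1 m2 hst]
  exact d.le

lemma exists_r (hΩ : IsOpen Ω) (gd : GreenData Ω) {P M h k : E2} (hP : P ∈ Ω) (hM : M ∈ Ω) (hPh : P + h ∈ Ω) (hMk : M + k ∈ Ω)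
    (hne : P ≠ M) (hne' : P + h ≠ M + k) {ε : ℝ} (hε : 0 < ε) :
    ∃ r, 0 < r ∧ Disjoint (ball P r) (ball M r) ∧ Disjoint (ball (P + h) r) (ball (M + k) r) ∧
      ball (P + h) r ⊆ Ω ∧ ball (M + k) r ⊆ Ω ∧
      (∀ s ∈ ball P r, ∀ t ∈ ball P r, s ≠ t → |kk gd (s + h) (t + h) - kk gd s t - (gd.H (P + h) (P + h) - gd.H P P)| ≤ ε) ∧
      (∀ s ∈ ball P r, ∀ t ∈ ball M r, s ≠ t → |kk gd (s + h) (t + k) - kk gd s t - (gd.G (P + h) (M + k) - gd.G P M)| ≤ ε) ∧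
      (∀ s ∈ ball M r, ∀ t ∈ ball M r, s ≠ t → |kk gd (s + k) (t + k) - kk gd s t - (gd.H (M + k) (M + k) - gd.H M M)| ≤ ε) := by
  obtain ⟨r1, p1, q1⟩ := kk_diff_diag hΩ gd hP hPh hε
  obtain ⟨r2, p2, q2⟩ := kk_diff_off hΩ gd hP hPh hM hMk hne hne' hε
  obtain ⟨r3, p3, q3⟩ := kk_diff_diag hΩ gd hM hMk hε
  obtain ⟨r4, p4, q4⟩ := Metric.isOpen_iff.1 hΩ _ hPh
  obtain ⟨r5, p5, q5⟩ := Metric.isOpen_iff.1 hΩ _ hMk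
  have p6 : 0 < dist P M / 2 := half_pos (dist_pos.2 hne)
  have p7 : 0 < dist (P + h) (M + k) / 2 := half_pos (dist_pos.2 hne')
  obtain ⟨r, hr, b1, b2, b3, b4, b5, b6, b7⟩ : ∃ r, 0 < r ∧ r ≤ r1 ∧ r ≤ r2 ∧ r ≤ r3 ∧ r ≤ r4 ∧ r ≤ r5 ∧ r ≤ dist P M / 2 ∧
      r ≤ dist (P + h) (M + k) / 2 := by
    refine ⟨min r1 (min r2 (min r3 (min r4 (min r5 (min (dist P M / 2) (dist (P + h) (M + k) / 2)))))), by positivity, ?_, ?_, ?_, ?_, ?_, ?_, ?_⟩ <;> simp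
  exact ⟨r, hr, ball_disjoint_ball (by linarith), ball_disjoint_ball (by linarith), (ball_subset_ball b4).trans q4, (ball_subset_ball b5).trans q5,
    fun s hs t ht => q1 s (ball_subset_ball b1 hs) t (ball_subset_ball b1 ht),
    fun s hs t ht => q2 s (ball_subset_ball b2 hs) t (ball_subset_ball b2 ht),
    fun s hs t ht => q3 s (ball_subset_ball b3 hs) t (ball_subset_ball b3 ht)⟩

lemma sft_AB {f : E2 → ℝ} (hf : AB Ω f) {P M h k : E2} {r : ℝ} (hP : ball (P + h) r ⊆ Ω) (hM : ball (M + k) r ⊆ Ω) :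
    AB Ω (sft f P M r h k) := (tr_AB hf hP).add (tr_AB hf hM)

lemma tr_nonneg {f : E2 → ℝ} (h0 : ∀ x, 0 ≤ f x) (c h : E2) (r : ℝ) (x : E2) : 0 ≤ tr f c r h x :=
  Set.indicator_nonneg (fun y _ => h0 y) _

lemma sft_nonneg {f : E2 → ℝ} (h0 : ∀ x, 0 ≤ f x) (P M h k : E2) (r : ℝ) (x : E2) : 0 ≤ sft f P M r h k x :=
  add_nonneg (tr_nonneg h0 _ _ _ _) (tr_nonneg h0 _ _ _ _)

lemma sft_sub (f g : E2 → ℝ) (P M h k : E2) (r : ℝ) (x : E2) :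
    sft (fun y => f y - g y) P M r h k x = sft f P M r h k x - sft g P M r h k x := by
  unfold sft tr Set.indicator
  split_ifs <;> ring

lemma Aq_sft_le (hΩ : IsOpen Ω) (hb : IsBounded Ω) {f : E2 → ℝ} (hf : AB Ω f) (h0 : ∀ x, 0 ≤ f x) {q : ℝ} (hq : 0 < q)
    {P M h k : E2} {r : ℝ} (hdis : Disjoint (ball P r) (ball M r)) (hdis' : Disjoint (ball (P + h) r) (ball (M + k) r))
    (hP : ball (P + h) r ⊆ Ω) (hM : ball (M + k) r ⊆ Ω) : Aq q (sft f P M r h k) ≤ Aq q f := by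
  have hq0 : (0:ℝ) ^ q = 0 := Real.zero_rpow hq.ne'
  have tq : ∀ c h' : E2, ∀ z, tr f c r h' z ^ q = tr (fun x => f x ^ q) c r h' z := fun c h' z => by
    unfold tr Set.indicator
    split_ifs
    · rfl
    · exact hq0
  have hz : ∀ (g : E2 → ℝ) (c h' z : E2), z ∉ ball (c + h') r → tr g c r h' z = 0 := fun g c h' z hzb => by
    unfold tr
    rw [Set.indicator_of_notMem]
    intro hh
    apply hzb
    rw [mem_ball_iff_norm] at hh ⊢
    rwa [show z - (c + h') = z - h' - c by abel]
  have hfq := hf.rpow h0 hq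
  have e : ∀ z, sft f P M r h k z ^ q = tr (fun x => f x ^ q) P r h z + tr (fun x => f x ^ q) M r k z := fun z => by
    unfold sft
    rw [← tq, ← tq]
    by_cases h1 : z ∈ ball (P + h) r
    · rw [hz f M k z (fun hh => Set.disjoint_left.1 hdis' h1 hh), hq0, add_zero, add_zero]
    · rw [hz f P h z h1, hq0, zero_add, zero_add]
  have it : ∀ c h' : E2, ∫ z, tr (fun x => f x ^ q) c r h' z = ∫ z, (ball c r).indicator (fun x => f x ^ q) z := fun c h' => by
    unfold tr
    exact integral_sub_right_eq_self (fun z => (ball c r).indicator (fun x => f x ^ q) z) h'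
  unfold Aq
  simp only [e]
  rw [integral_add ((tr_AB hfq hP).integrable hΩ hb) ((tr_AB hfq hM).integrable hΩ hb), it, it,
    ← integral_add ((hfq.indicator measurableSet_ball).integrable hΩ hb) ((hfq.indicator measurableSet_ball).integrable hΩ hb)]
  refine integral_mono (((hfq.indicator measurableSet_ball).add (hfq.indicator measurableSet_ball)).integrable hΩ hb) (hfq.integrable hΩ hb) fun x => ?_
  have hn : 0 ≤ f x ^ q := Real.rpow_nonneg (h0 x) q
  by_cases h1 : x ∈ ball P r
  · have h2 : x ∉ ball M r := fun hh => Set.disjoint_left.1 hdis h1 hh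
    simp only [h1, h2, Set.indicator_of_mem, Set.indicator_of_notMem, not_false_eq_true, add_zero, le_refl]
  · by_cases h2 : x ∈ ball M r
    · simp only [h1, h2, Set.indicator_of_mem, Set.indicator_of_notMem, not_false_eq_true, zero_add, le_refl]
    · simp only [h1, h2, Set.indicator_of_notMem, not_false_eq_true, zero_add, hn]

/-- second order bound for the reduced functional -/
lemma rpow_second {A D θ : ℝ} (hA : 0 < A) (hD : |D| ≤ A / 2) (h1 : 1 ≤ θ) (h2 : θ ≤ 2) :
    A ^ (1 + θ) * (A + D) ^ (-θ) ≤ A - θ * D + 8 * (D ^ 2 / A) := by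
  obtain ⟨t, ht⟩ : ∃ t, t = D / A := ⟨_, rfl⟩
  have hDt : D = A * t := by rw [ht]; field_simp
  have ht2 : -(1 / 2) ≤ t := by
    rw [ht, le_div_iff₀ hA]; linarith [(abs_le.1 hD).1]
  have h1t : 0 < 1 + t := by linarith
  obtain ⟨s, hs⟩ : ∃ s, s = (1 + t)⁻¹ := ⟨_, rfl⟩
  have hs0 : 0 < s := by rw [hs]; positivity
  have hst : s * (1 + t) = 1 := by rw [hs]; field_simp
  have e : A ^ (1 + θ) * (A + D) ^ (-θ) = A * s ^ θ := by
    rw [hDt, show A + A * t = A * (1 + t) by ring, Real.mul_rpow hA.le h1t.le, ← mul_assoc, ← Real.rpow_add hA,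
      Real.rpow_neg h1t.le, ← Real.inv_rpow h1t.le, ← hs]
    congr 1
    ring_nf; exact Real.rpow_one A
  have amgm : s ^ θ ≤ (2 - θ) * s + (θ - 1) * s ^ 2 := by
    have := Real.geom_mean_le_arith_mean2_weighted (by linarith : 0 ≤ 2 - θ) (by linarith : 0 ≤ θ - 1) hs0.le (sq_nonneg s) (by ring)
    refine le_trans (le_of_eq ?_) this
    rw [← Real.rpow_natCast s 2, ← Real.rpow_mul hs0.le, ← Real.rpow_add hs0]
    congr 1; push_cast; ring
  have s1 : s ≤ 1 - t + 8 * t ^ 2 := by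
    have : 0 ≤ (1 - t + 8 * t ^ 2) * (1 + t) - s * (1 + t) := by
      rw [hst]; nlinarith [mul_nonneg (sq_nonneg t) (by linarith : 0 ≤ 8 * t + 7)]
    nlinarith
  have s2 : s ^ 2 ≤ 1 - 2 * t + 8 * t ^ 2 := by
    have e2 : s ^ 2 * (1 + t) ^ 2 = 1 := by rw [← mul_pow, hst, one_pow]
    have : s ^ 2 * (1 + t) ^ 2 ≤ (1 - 2 * t + 8 * t ^ 2) * (1 + t) ^ 2 := by
      rw [e2]
      have : 0 ≤ t ^ 2 * ((4 * t + 5) * (2 * t + 1)) := by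
        apply mul_nonneg (sq_nonneg t); apply mul_nonneg <;> linarith
      nlinarith
    exact le_of_mul_le_mul_right this (by positivity)
  have fin : s ^ θ ≤ 1 - θ * t + 8 * t ^ 2 := by
    have := mul_le_mul_of_nonneg_left s1 (by linarith : 0 ≤ 2 - θ)
    have := mul_le_mul_of_nonneg_left s2 (by linarith : 0 ≤ θ - 1)
    nlinarith
  rw [e]
  refine (mul_le_mul_of_nonneg_left fin hA.le).trans (le_of_eq ?_)
  rw [hDt]; field_simp

end

section

variable {Ω : Set E2}

lemma C0_of {S : Set E2} {F : ℕ → E2 → ℝ} {g : E2 → ℝ} (h : TendstoC2LocOn S F g) {K : Set E2} (hK : IsCompact K) (hKS : K ⊆ S)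
    {ε : ℝ} (hε : 0 < ε) : ∀ᶠ n in atTop, ∀ x ∈ K, |F n x - g x| < ε := by
  have := h K hKS hK 0 (by norm_num)
  rw [Metric.tendstoUniformlyOn_iff] at this
  filter_upwards [this ε hε] with n hn x hx
  have h1 := hn x hx
  rw [dist_eq_norm] at h1
  have h2 := (iteratedFDeriv ℝ 0 g x - iteratedFDeriv ℝ 0 (F n) x).le_opNorm (fun _ => 0)
  simp only [ContinuousMultilinearMap.sub_apply, iteratedFDeriv_zero_apply, Finset.univ_eq_empty, Finset.prod_empty, mul_one] at h2
  rw [Real.norm_eq_abs, abs_sub_comm] at h2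
  exact h2.trans_lt h1

lemma t_le {p t : ℝ} (hp : 1 < p) (ht : 0 ≤ t) : t ≤ 2 * t ^ (1 + 1 / p) + (1 / 2) ^ p := by
  have hp0 : 0 < p := by linarith
  have h0 : 0 ≤ t ^ (1 + 1 / p) := Real.rpow_nonneg ht _
  rcases le_total t ((1 / 2) ^ p) with h | h
  · linarith
  · have hh : (0:ℝ) < (1 / 2) ^ p := by positivity
    have ht0 : 0 < t := hh.trans_le h
    have e : t ^ (1 + 1 / p) = t * t ^ (1 / p) := by rw [Real.rpow_add ht0, Real.rpow_one]
    have : 1 / 2 ≤ t ^ (1 / p) := by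
      have := Real.rpow_le_rpow hh.le h (by positivity : 0 ≤ 1 / p)
      rwa [← Real.rpow_mul (by norm_num), mul_one_div_cancel hp0.ne', Real.rpow_one] at this
    rw [e]; nlinarith

lemma int_le_Aq (hΩ : IsOpen Ω) (hb : IsBounded Ω) {p : ℝ} (hp : 1 < p) {f : E2 → ℝ} (hf : AB Ω f) (h0 : ∀ x, 0 ≤ f x) :
    ∫ x, f x ≤ 2 * Aq (1 + 1 / p) f + volume.real Ω * (1 / 2) ^ p := by
  have hp0 : 0 < p := by linarith
  have hfq := hf.rpow h0 (by positivity : 0 < 1 + 1 / p)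
  have i2 : Integrable (Ω.indicator (fun _ : E2 => ((1:ℝ) / 2) ^ p)) := by
    rw [integrable_indicator_iff hΩ.measurableSet]
    exact integrableOn_const hb.measure_lt_top.ne (by exact enorm_ne_top)
  have : ∫ x, f x ≤ ∫ x, (2 * f x ^ (1 + 1 / p) + Ω.indicator (fun _ : E2 => ((1:ℝ) / 2) ^ p) x) := by
    refine integral_mono (hf.integrable hΩ hb) (((hfq.integrable hΩ hb).const_mul 2).add i2) fun x => ?_
    by_cases hx : x ∈ Ω
    · simp only [hx, Set.indicator_of_mem]; exact t_le hp (h0 x)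
    · simp only [hx, Set.indicator_of_notMem, not_false_eq_true, hf.out x hx]
      rw [Real.zero_rpow (by positivity)]; simp
  refine this.trans (le_of_eq ?_)
  rw [integral_add ((hfq.integrable hΩ hb).const_mul 2) i2, integral_const_mul, integral_indicator hΩ.measurableSet,
    setIntegral_const, smul_eq_mul]
  rfl

lemma p_half {p : ℕ → ℝ} (hptop : Tendsto p atTop atTop) : Tendsto (fun n => p n * (1 / 2) ^ p n) atTop (𝓝 0) := by
  have hl : 0 < Real.log 2 := Real.log_pos (by norm_num)
  have h1 := (Real.tendsto_pow_mul_exp_neg_atTop_nhds_zero 1).comp (hptop.atTop_mul_const hl)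
  have h2 := h1.div_const (Real.log 2)
  rw [zero_div] at h2
  refine h2.congr fun n => ?_
  simp only [Function.comp, pow_one]
  rw [Real.rpow_def_of_pos (by norm_num), one_div, Real.log_inv]
  field_simp

lemma g_contOn (gd : GreenData Ω) {P M : E2} (hP : P ∈ Ω) (hM : M ∈ Ω) (m : ℝ) :
    ContinuousOn (fun x => m * (gd.G P x - gd.G M x)) (closure Ω \ {P, M}) := by
  have gc : ∀ Q ∈ Ω, Q ∈ ({P, M} : Set E2) → ContinuousOn (gd.G Q) (closure Ω \ {P, M}) := fun Q hQ hQ' => by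
    have : gd.G Q = fun y => -(1 / (2 * π)) * Real.log ‖Q - y‖ + gd.H Q y := by funext y; exact gd.decomp Q y
    rw [this]
    refine ContinuousOn.add (ContinuousOn.mul continuousOn_const (ContinuousOn.log (by fun_prop) fun y hy => ?_))
      ((gd.contH Q hQ).mono Set.diff_subset)
    refine norm_ne_zero_iff.2 (sub_ne_zero.2 ?_)
    rintro rfl
    exact hy.2 hQ'
  exact continuousOn_const.mul ((gc P hP (by simp)).sub (gc M hM (by simp)))

lemma conc_of (hΩ : IsOpen Ω) (hb : IsBounded Ω) (gd : GreenData Ω) {p : ℕ → ℝ} (hp1 : ∀ n, 1 < p n) (hptop : Tendsto p atTop atTop)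
    {u w : ℕ → E2 → ℝ} {P M : E2} (hP : P ∈ Ω) (hM : M ∈ Ω) {m L : ℝ}
    (hconc : TendstoC2LocOn (closure Ω \ {P, M}) (fun n x => p n * u n x) (fun x => m * (gd.G P x - gd.G M x)))
    (hwA : ∀ n, AB Ω (w n)) (hwu : ∀ n, ∀ x ∈ Ω, w n x = nl (p n) (u n x)) (hK : ∀ n, ∀ x ∈ Ω, KK gd (w n) x = u n x)
    (hlim : Tendsto (fun n => p n * (Aq (1 + 1 / p n) (fun x => max (w n x) 0) + Aq (1 + 1 / p n) (fun x => max (- w n x) 0))) atTop (𝓝 L)) :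
    ∃ C, Conc gd P M (fun n x => p n * w n x) C m := by
  obtain ⟨V, hV⟩ : ∃ V, V = volume.real Ω := ⟨_, rfl⟩
  have hV0 : 0 ≤ V := by rw [hV]; exact measureReal_nonneg
  refine ⟨2 * (L + 1) + 2 * V, fun n => (hwA n).cmul (p n), ?_, ?_, ?_⟩
  · filter_upwards [hlim.eventually (gt_mem_nhds (lt_add_one L)), (p_half hptop).eventually (gt_mem_nhds one_pos)] with n h1 h2
    have hpn : 0 < p n := by linarith [hp1 n]
    have e : ∀ x, |p n * w n x| = p n * max (w n x) 0 + p n * max (- w n x) 0 := fun x => by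
      rw [abs_mul, abs_of_pos hpn, ← mul_add]
      congr 1
      rcases le_total (w n x) 0 with h | h
      · rw [abs_of_nonpos h, max_eq_right h, max_eq_left (by linarith), zero_add]
      · rw [abs_of_nonneg h, max_eq_left h, max_eq_right (by linarith), add_zero]
    simp only [e]
    have aA := (hwA n).pos
    have bA := (hwA n).neg.pos
    rw [integral_add ((aA.integrable hΩ hb).const_mul _) ((bA.integrable hΩ hb).const_mul _), integral_const_mul, integral_const_mul]
    have k1 := mul_le_mul_of_nonneg_left (int_le_Aq hΩ hb (hp1 n) aA (fun x => le_max_right _ _)) hpn.le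
    have k2 := mul_le_mul_of_nonneg_left (int_le_Aq hΩ hb (hp1 n) bA (fun x => le_max_right _ _)) hpn.le
    rw [← hV] at k1 k2
    have k3 : V * (p n * (1 / 2) ^ p n) ≤ V * 1 := mul_le_mul_of_nonneg_left h2.le hV0
    nlinarith
  · intro ρ hρ η hη
    obtain ⟨K, hKd⟩ : ∃ K, K = closure Ω \ (ball P ρ ∪ ball M ρ) := ⟨_, rfl⟩
    have hKc : IsCompact K := by rw [hKd]; exact hb.isCompact_closure.diff (isOpen_ball.union isOpen_ball)
    have hKS : K ⊆ closure Ω \ {P, M} := by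
      rw [hKd]
      refine Set.diff_subset_diff_right ?_
      rintro y (rfl | rfl)
      · exact Or.inl (mem_ball_self hρ)
      · exact Or.inr (mem_ball_self hρ)
    obtain ⟨Cg, hCg⟩ := hKc.exists_bound_of_continuousOn ((g_contOn gd hP hM m).mono hKS)
    filter_upwards [C0_of hconc hKc hKS one_pos, hptop.eventually_ge_atTop (2 * (|Cg| + 1)),
      (p_half hptop).eventually (gt_mem_nhds hη)] with n h1 h2 h3 x hx1 hx2
    have hpn : 0 < p n := by linarith [hp1 n]
    by_cases hx : x ∈ Ω
    · have hxK : x ∈ K := by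
        rw [hKd]; exact ⟨subset_closure hx, fun hh => hh.elim hx1 hx2⟩
      have k1 := h1 x hxK
      have k2 := hCg x hxK
      rw [Real.norm_eq_abs] at k2
      have k3 : |p n * u n x| ≤ |Cg| + 1 := by
        have := abs_sub_abs_le_abs_sub (p n * u n x) (m * (gd.G P x - gd.G M x))
        linarith [le_abs_self Cg]
      rw [abs_mul, abs_of_pos hpn] at k3
      have k4 : |u n x| ≤ 1 / 2 := by
        by_contra hcon
        push Not at hcon
        nlinarith
      rw [hwu n x hx, abs_mul, abs_of_pos hpn, abs_nl (hp1 n)]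
      have := Real.rpow_le_rpow (abs_nonneg _) k4 hpn.le
      nlinarith [mul_le_mul_of_nonneg_left this hpn.le]
    · rw [(hwA n).out x hx, mul_zero, abs_zero]; exact hη.le
  · intro x hx hxP hxM
    rw [Metric.tendsto_nhds]
    intro ε hε
    filter_upwards [C0_of hconc (isCompact_singleton (x := x)) (by
      rintro y rfl
      refine ⟨subset_closure hx, ?_⟩
      simp [hxP, hxM]) hε] with n hn
    rw [Real.dist_eq, KK_cmul, hK n x hx]
    exact hn x rfl

end

section

variable {Ω : Set E2}

lemma quad_term {p c K A D : ℝ} (hp : 0 < p) (hc : 0 < c) (hA : c / p ≤ A) (hD : |D| ≤ K / p ^ 2) :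
    D ^ 2 / A ≤ K ^ 2 / (c * p ^ 3) := by
  have hA0 : 0 < c / p := by positivity
  have h1 : D ^ 2 ≤ (K / p ^ 2) ^ 2 := by
    rw [← sq_abs]; exact pow_le_pow_left₀ (abs_nonneg _) hD 2
  calc D ^ 2 / A ≤ (K / p ^ 2) ^ 2 / (c / p) := div_le_div₀ (by positivity) h1 hA0 hA
    _ = K ^ 2 / (c * p ^ 3) := by field_simp

lemma K_le {p c K : ℝ} (hp : 0 < p) (hK : 2 * K ≤ c * p) : K / p ^ 2 ≤ c / p / 2 := by
  rw [div_div, div_le_div_iff₀ (by positivity) (by positivity)]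
  nlinarith [mul_le_mul_of_nonneg_right hK hp.le]

lemma final_real {p c K κ A B D1 D2 A' B' θ : ℝ} (hp : 0 < p) (hc : 0 < c) (hκ : 0 < κ)
    (hA : c / p ≤ A) (hB : c / p ≤ B) (hD1 : |D1| ≤ K / p ^ 2) (hD2 : |D2| ≤ K / p ^ 2) (hs : κ / p ^ 2 ≤ D1 + D2)
    (hK : 2 * K ≤ c * p) (h1 : 1 ≤ θ) (h2 : θ ≤ 2) (hA' : A' ≤ A) (hB' : B' ≤ B) (hA0 : 0 ≤ A') (hB0 : 0 ≤ B')
    (hle : A + B ≤ A' ^ (1 + θ) * (A + D1) ^ (-θ) + B' ^ (1 + θ) * (B + D2) ^ (-θ)) :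
    κ * p ≤ 16 * (K ^ 2 / c) := by
  have hcp : 0 < c / p := by positivity
  have hKc : K / p ^ 2 ≤ c / p / 2 := K_le hp hK
  have a1 : |D1| ≤ A / 2 := by linarith
  have b1 : |D2| ≤ B / 2 := by linarith
  have A0 : 0 < A := by linarith
  have B0 : 0 < B := by linarith
  have a2 : 0 ≤ A + D1 := by linarith [(abs_le.1 a1).1]
  have b2 : 0 ≤ B + D2 := by linarith [(abs_le.1 b1).1]
  have a3 := rpow_second A0 a1 h1 h2
  have b3 := rpow_second B0 b1 h1 h2
  have a4 : A' ^ (1 + θ) * (A + D1) ^ (-θ) ≤ A ^ (1 + θ) * (A + D1) ^ (-θ) :=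
    mul_le_mul_of_nonneg_right (Real.rpow_le_rpow hA0 hA' (by linarith)) (Real.rpow_nonneg a2 _)
  have b4 : B' ^ (1 + θ) * (B + D2) ^ (-θ) ≤ B ^ (1 + θ) * (B + D2) ^ (-θ) :=
    mul_le_mul_of_nonneg_right (Real.rpow_le_rpow hB0 hB' (by linarith)) (Real.rpow_nonneg b2 _)
  have a5 := quad_term hp hc hA hD1
  have b5 := quad_term hp hc hB hD2
  have hs0 : 0 < κ / p ^ 2 := by positivity
  have h6 : θ * (D1 + D2) ≤ 16 * (K ^ 2 / (c * p ^ 3)) := by linarith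
  have h7 : κ / p ^ 2 ≤ 16 * (K ^ 2 / (c * p ^ 3)) := by nlinarith
  have := mul_le_mul_of_nonneg_right h7 (by positivity : 0 ≤ p ^ 3)
  calc κ * p = κ / p ^ 2 * p ^ 3 := by field_simp
    _ ≤ _ := this
    _ = _ := by field_simp

lemma abs_form {d11 d12 d22 s t μ ν C : ℝ} (hs : |s| ≤ C) (ht : |t| ≤ C) (hμ : |μ| ≤ C) (hν : |ν| ≤ C) :
    |d11 * s * μ + d12 * s * ν + d12 * t * μ + d22 * t * ν| ≤ (|d11| + 2 * |d12| + |d22|) * C ^ 2 := by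
  have hC : 0 ≤ C := (abs_nonneg _).trans hs
  have key : ∀ d x y : ℝ, |x| ≤ C → |y| ≤ C → |d * x * y| ≤ |d| * C ^ 2 := fun d x y hx hy => by
    rw [abs_mul, abs_mul, mul_assoc, pow_two]
    exact mul_le_mul_of_nonneg_left (mul_le_mul hx hy (abs_nonneg _) hC) (abs_nonneg _)
  have k1 := abs_le.1 (key d11 s μ hs hμ)
  have k2 := abs_le.1 (key d12 s ν hs hν)
  have k3 := abs_le.1 (key d12 t μ ht hμ)
  have k4 := abs_le.1 (key d22 t ν ht hν)
  rw [abs_le]; constructor <;> linarith [k1.1, k1.2, k2.1, k2.2, k3.1, k3.2, k4.1, k4.2]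

lemma set_int_le (hΩ : IsOpen Ω) (hb : IsBounded Ω) {F W : E2 → ℝ} (hF : AB Ω F) (hW : AB Ω W) (hFW : ∀ x, |F x| ≤ |W x|)
    {C : ℝ} (hC : ∫ x, |W x| ≤ C) (s : Set E2) : |∫ x in s, F x| ≤ C := by
  have i1 := hF.abs.integrable hΩ hb
  have i2 := hW.abs.integrable hΩ hb
  calc |∫ x in s, F x| ≤ ∫ x in s, |F x| := abs_integral_le_integral_abs
    _ ≤ ∫ x, |F x| := setIntegral_le_integral i1 (Eventually.of_forall fun x => abs_nonneg _)
    _ ≤ ∫ x, |W x| := integral_mono i1 i2 hFW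
    _ ≤ C := hC

set_option maxHeartbeats 1000000 in
lemma final_step (hΩ : IsOpen Ω) (hb : IsBounded Ω) (gd : GreenData Ω) {p : ℝ} (hp : 3 ≤ p) {u w : E2 → ℝ}
    (hu : IsSolution Ω p u) (hl : ∀ v : E2 → ℝ, IsSolution Ω p v → IsNodal Ω v → energy Ω p u ≤ energy Ω p v)
    (hw : AB Ω w)
    (hA : Aq (1 + 1 / p) (fun x => max (w x) 0) = QQ gd (fun x => max (w x) 0) w)
    (hB : Aq (1 + 1 / p) (fun x => max (- w x) 0) = - QQ gd (fun x => max (- w x) 0) w)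
    (hAB : Aq (1 + 1 / p) (fun x => max (w x) 0) + Aq (1 + 1 / p) (fun x => max (- w x) 0) = ∫ x in Ω, |u x| ^ (p + 1))
    {P M h k : E2} {r d11 d12 d22 ε η C Mk c κ : ℝ} (hε : 0 ≤ ε) (hη : 0 ≤ η)
    (hdis : Disjoint (ball P r) (ball M r)) (hdis' : Disjoint (ball (P + h) r) (ball (M + k) r))
    (hP : ball (P + h) r ⊆ Ω) (hM : ball (M + k) r ⊆ Ω)
    (hMk : ∀ x, ∫ y, kk gd x y ≤ Mk) (hMk0 : 0 ≤ Mk) (hC : ∫ x, |w x| ≤ C / p)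
    (hsm : ∀ x, x ∉ ball P r → x ∉ ball M r → |w x| ≤ η / p)
    (h11 : ∀ s ∈ ball P r, ∀ t ∈ ball P r, s ≠ t → |kk gd (s + h) (t + h) - kk gd s t - d11| ≤ ε)
    (h12 : ∀ s ∈ ball P r, ∀ t ∈ ball M r, s ≠ t → |kk gd (s + h) (t + k) - kk gd s t - d12| ≤ ε)
    (h22 : ∀ s ∈ ball M r, ∀ t ∈ ball M r, s ≠ t → |kk gd (s + k) (t + k) - kk gd s t - d22| ≤ ε)
    (hc : 0 < c) (hκ : 0 < κ)
    (hcA : c ≤ p * Aq (1 + 1 / p) (fun x => max (w x) 0)) (hcB : c ≤ p * Aq (1 + 1 / p) (fun x => max (- w x) 0))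
    (hκm : κ + (4 * (ε * C * C) + 3 * (C * (η * Mk))) ≤
      d11 * (∫ x in ball P r, p * w x) ^ 2 + 2 * d12 * ((∫ x in ball P r, p * w x) * (∫ x in ball M r, p * w x))
        + d22 * (∫ x in ball M r, p * w x) ^ 2)
    {K : ℝ} (hKd : K = (|d11| + 2 * |d12| + |d22|) * C ^ 2 + (4 * (ε * C * C) + 3 * (C * (η * Mk))))
    (hK : 2 * K ≤ c * p) : κ * p ≤ 16 * (K ^ 2 / c) := by
  have hp0 : 0 < p := by linarith
  obtain ⟨a, ha⟩ : ∃ a : E2 → ℝ, a = fun x => max (w x) 0 := ⟨_, rfl⟩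
  obtain ⟨b, hbd⟩ : ∃ b : E2 → ℝ, b = fun x => max (- w x) 0 := ⟨_, rfl⟩
  rw [← ha] at hA hAB hcA
  rw [← hbd] at hB hAB hcB
  have haA : AB Ω a := by rw [ha]; exact hw.pos
  have hbA : AB Ω b := by rw [hbd]; exact hw.neg.pos
  have a0 : ∀ x, 0 ≤ a x := fun x => by rw [ha]; exact le_max_right _ _
  have b0 : ∀ x, 0 ≤ b x := fun x => by rw [hbd]; exact le_max_right _ _
  have hwab : w = fun x => a x - b x := by
    funext x; rw [ha, hbd]; exact (pm_sub _).symm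
  have aw : ∀ x, |a x| ≤ |w x| := fun x => by
    rw [abs_of_nonneg (a0 x), ha]; exact max_le (le_abs_self _) (abs_nonneg _)
  have bw : ∀ x, |b x| ≤ |w x| := fun x => by
    rw [abs_of_nonneg (b0 x), hbd]; exact max_le (neg_le_abs _) (abs_nonneg _)
  obtain ⟨a', ha'⟩ : ∃ a', a' = sft a P M r h k := ⟨_, rfl⟩
  obtain ⟨b', hb'⟩ : ∃ b', b' = sft b P M r h k := ⟨_, rfl⟩
  obtain ⟨w', hw'⟩ : ∃ w', w' = sft w P M r h k := ⟨_, rfl⟩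
  have hwab' : w' = fun x => a' x - b' x := by
    funext x; rw [hw', ha', hb', ← sft_sub, ← hwab]
  have haA' : AB Ω a' := by rw [ha']; exact sft_AB haA hP hM
  have hbA' : AB Ω b' := by rw [hb']; exact sft_AB hbA hP hM
  have hwA' : AB Ω w' := by rw [hw']; exact sft_AB hw hP hM
  have a0' : ∀ x, 0 ≤ a' x := fun x => by rw [ha']; exact sft_nonneg a0 _ _ _ _ _ _
  have b0' : ∀ x, 0 ≤ b' x := fun x => by rw [hb']; exact sft_nonneg b0 _ _ _ _ _ _
  have hq0 : 0 < 1 + 1 / p := by positivity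
  have Aa' : Aq (1 + 1 / p) a' ≤ Aq (1 + 1 / p) a := by rw [ha']; exact Aq_sft_le hΩ hb haA a0 hq0 hdis hdis' hP hM
  have Bb' : Aq (1 + 1 / p) b' ≤ Aq (1 + 1 / p) b := by rw [hb']; exact Aq_sft_le hΩ hb hbA b0 hq0 hdis hdis' hP hM
  have sa := sft_diff hΩ hb gd haA hw aw hε (by positivity : 0 ≤ η / p) hdis hP hM hMk hMk0 hC hsm h11 h12 h22
  have sb := sft_diff hΩ hb gd hbA hw bw hε (by positivity : 0 ≤ η / p) hdis hP hM hMk hMk0 hC hsm h11 h12 h22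
  have sw := sft_diff hΩ hb gd hw hw (fun x => le_rfl) hε (by positivity : 0 ≤ η / p) hdis hP hM hMk hMk0 hC hsm h11 h12 h22
  rw [← ha', ← hw'] at sa
  rw [← hb', ← hw'] at sb
  rw [← hw'] at sw
  obtain ⟨E, hE⟩ : ∃ E, E = 4 * (ε * C * C) + 3 * (C * (η * Mk)) := ⟨_, rfl⟩
  have eE : 4 * (ε * (C / p) * (C / p)) + 3 * (C / p * (η / p * Mk)) = E / p ^ 2 := by
    rw [hE]; field_simp
  rw [eE] at sa sb sw
  rw [← hE] at hκm hKd
  have eK : K / p ^ 2 = (|d11| + 2 * |d12| + |d22|) * (C / p) ^ 2 + E / p ^ 2 := by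
    rw [hKd]; field_simp
  have fa := abs_form (d11 := d11) (d12 := d12) (d22 := d22) (set_int_le hΩ hb haA hw aw hC (ball P r)) (set_int_le hΩ hb haA hw aw hC (ball M r))
    (set_int_le hΩ hb hw hw (fun x => le_rfl) hC (ball P r)) (set_int_le hΩ hb hw hw (fun x => le_rfl) hC (ball M r))
  have fb := abs_form (d11 := d11) (d12 := d12) (d22 := d22) (set_int_le hΩ hb hbA hw bw hC (ball P r)) (set_int_le hΩ hb hbA hw bw hC (ball M r))
    (set_int_le hΩ hb hw hw (fun x => le_rfl) hC (ball P r)) (set_int_le hΩ hb hw hw (fun x => le_rfl) hC (ball M r))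
  rw [integral_const_mul, integral_const_mul] at hκm
  have qa : QQ gd w' w' = QQ gd a' w' - QQ gd b' w' := by
    conv_lhs => rw [show QQ gd w' w' = QQ gd (fun x => a' x - b' x) w' from by rw [← hwab']]
    exact QQ_sub_left hΩ hb gd haA' hbA' hwA'
  have qb : QQ gd w w = QQ gd a w - QQ gd b w := by
    conv_lhs => rw [show QQ gd w w = QQ gd (fun x => a x - b x) w from by rw [← hwab]]
    exact QQ_sub_left hΩ hb gd haA hbA hw
  have qc : QQ gd a' a' - QQ gd a' b' = QQ gd a' w' := by
    rw [hwab', QQ_sub_right hΩ hb gd haA' haA' hbA']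
  have qd : QQ gd b' b' - QQ gd a' b' = - QQ gd b' w' := by
    rw [hwab', QQ_sub_right hΩ hb gd hbA' haA' hbA', QQ_symm hΩ hb gd haA' hbA']; ring
  obtain ⟨D1, hD1⟩ : ∃ D1, D1 = QQ gd a' w' - QQ gd a w := ⟨_, rfl⟩
  obtain ⟨D2, hD2⟩ : ∃ D2, D2 = -(QQ gd b' w' - QQ gd b w) := ⟨_, rfl⟩
  have k1 : |D1| ≤ K / p ^ 2 := by
    rw [eK, hD1]
    have := abs_le.1 sa
    have := abs_le.1 fa
    rw [abs_le]; constructor <;> linarith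
  have k2 : |D2| ≤ K / p ^ 2 := by
    rw [eK, hD2, abs_neg]
    have := abs_le.1 sb
    have := abs_le.1 fb
    rw [abs_le]; constructor <;> linarith
  have k3 : κ / p ^ 2 ≤ D1 + D2 := by
    have h1 := (abs_le.1 sw).1
    have h2 : D1 + D2 = QQ gd w' w' - QQ gd w w := by rw [hD1, hD2, qa, qb]; ring
    have h3 := div_le_div_of_nonneg_right hκm (by positivity : 0 ≤ p ^ 2)
    rw [add_div] at h3
    rw [h2]
    refine (le_sub_iff_add_le.2 h3).trans ?_
    have h4 : ∀ x y : ℝ, (d11 * (p * x) ^ 2 + 2 * d12 * (p * x * (p * y)) + d22 * (p * y) ^ 2) / p ^ 2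
      = d11 * x * x + d12 * x * y + d12 * y * x + d22 * y * y := fun x y => by field_simp; ring
    rw [h4]; linarith
  have hcA' : c / p ≤ Aq (1 + 1 / p) a := by rw [div_le_iff₀ hp0]; linarith
  have hcB' : c / p ≤ Aq (1 + 1 / p) b := by rw [div_le_iff₀ hp0]; linarith
  have e1 : QQ gd a' w' = Aq (1 + 1 / p) a + D1 := by rw [hD1, hA]; ring
  have e2 : - QQ gd b' w' = Aq (1 + 1 / p) b + D2 := by rw [hD2, hB]; ring
  have hcp : 0 < c / p := by positivity
  have hKc : K / p ^ 2 ≤ c / p / 2 := K_le hp0 hK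
  have p1 : 0 < QQ gd a' a' - QQ gd a' b' := by rw [qc, e1]; linarith [(abs_le.1 k1).1]
  have p2 : 0 < QQ gd b' b' - QQ gd a' b' := by rw [qd, e2]; linarith [(abs_le.1 k2).1]
  have hle := least_le hΩ hb gd (by linarith : 1 < p) hu hl haA' hbA' a0' b0' p1 p2
  rw [← hAB, qc, qd, e1, e2, Lam] at hle
  have hθ : (1 + 1 / p) / (2 - (1 + 1 / p)) = (p + 1) / (p - 1) := by
    have : p - 1 ≠ 0 := by linarith
    have h2 : 2 - (1 + 1 / p) = (p - 1) / p := by field_simp; ring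
    rw [h2]; field_simp
  rw [hθ] at hle
  refine final_real hp0 hc hκ hcA' hcB' k1 k2 k3 hK ?_ ?_ Aa' Bb' (Aq_nonneg a0') (Aq_nonneg b0') hle
  · rw [le_div_iff₀ (by linarith)]; linarith
  · rw [div_le_iff₀ (by linarith)]; linarith

end

section

theorem main_aux
    (Ω : Set E2) (hΩo : IsOpen Ω) (hΩb : IsBounded Ω)
    (p : ℕ → ℝ) (hp1 : ∀ n, 1 < p n) (hptop : Tendsto p atTop atTop)
    (u : ℕ → E2 → ℝ)
    (hsol : ∀ n, IsSolution Ω (p n) (u n))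
    {L m : ℝ} (hm : 0 < m)
    (hlow : Tendsto (fun n => p n * ∫ x in Ω, |u n x| ^ (p n + 1)) atTop (𝓝 L))
    (hleast : ∀ n, ∀ v : E2 → ℝ, IsSolution Ω (p n) v → IsNodal Ω v →
      energy Ω (p n) (u n) ≤ energy Ω (p n) v)
    (gd : GreenData Ω) (xP xM : E2) (hxP : xP ∈ Ω) (hxM : xM ∈ Ω) (hPM : xP ≠ xM)
    (hconc : TendstoC2LocOn (closure Ω \ {xP, xM})
      (fun n x => p n * u n x)
      (fun x => m * (gd.G xP x - gd.G xM x))) :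
    ∀ x ∈ Ω, ∀ y ∈ Ω, x ≠ y → KR gd (xP, xM) ≤ KR gd (x, y) := by
  intro x hx y hy hxy
  choose w hwA hwu hwK hA hB hAB using fun n => sol_data hΩo hΩb gd (hp1 n) (hsol n)
  obtain ⟨C, hC⟩ := conc_of hΩo hΩb gd hp1 hptop hxP hxM hconc hwA hwu hwK (L := L) (by simpa only [hAB] using hlow)
  obtain ⟨Mk, hMk0, hMk⟩ := kk_int_bdd hΩo hΩb gd
  have hC0 : 0 ≤ C := by
    obtain ⟨n, hn⟩ := hC.l1.exists
    exact (integral_nonneg fun x => abs_nonneg _).trans hn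
  obtain ⟨h, hh⟩ : ∃ h, h = x - xP := ⟨_, rfl⟩
  obtain ⟨k, hk⟩ : ∃ k, k = y - xM := ⟨_, rfl⟩
  have ex : x = xP + h := by rw [hh]; abel
  have ey : y = xM + k := by rw [hk]; abel
  rw [ex] at hx hxy ⊢
  rw [ey] at hy hxy ⊢
  by_contra hcon
  simp only [KR, not_le] at hcon
  obtain ⟨d11, e11⟩ : ∃ d, d = gd.H (xP + h) (xP + h) - gd.H xP xP := ⟨_, rfl⟩
  obtain ⟨d12, e12⟩ : ∃ d, d = gd.G (xP + h) (xM + k) - gd.G xP xM := ⟨_, rfl⟩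
  obtain ⟨d22, e22⟩ : ∃ d, d = gd.H (xM + k) (xM + k) - gd.H xM xM := ⟨_, rfl⟩
  obtain ⟨Δ, hΔ⟩ : ∃ d, d = m ^ 2 * (d11 + d22 - 2 * d12) := ⟨_, rfl⟩
  have hΔ0 : 0 < Δ := by rw [hΔ]; exact mul_pos (by positivity) (by rw [e11, e12, e22]; linarith)
  obtain ⟨ε, hε⟩ : ∃ ε, ε = Δ / (32 * (C * C + 1)) := ⟨_, rfl⟩
  obtain ⟨η, hη⟩ : ∃ η, η = Δ / (24 * (C * Mk + 1)) := ⟨_, rfl⟩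
  have hCM : 0 ≤ C * Mk := by positivity
  have hε0 : 0 < ε := by rw [hε]; positivity
  have hη0 : 0 < η := by rw [hη]; positivity
  have hε1 : ε * (32 * (C * C + 1)) = Δ := by rw [hε]; field_simp
  have hη1 : η * (24 * (C * Mk + 1)) = Δ := by
    rw [hη]; exact div_mul_cancel₀ _ (by positivity)
  have hE : 4 * (ε * C * C) + 3 * (C * (η * Mk)) ≤ Δ / 4 := by nlinarith
  obtain ⟨r, hr, hdis, hdis', hP, hM, h11, h12, h22⟩ := exists_r hΩo gd hxP hxM hx hy hPM hxy hε0
  rw [← e11] at h11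
  rw [← e12] at h12
  rw [← e22] at h22
  obtain ⟨m1, m2⟩ := hC.mass hΩo hΩb hxP hxM hPM hr hdis
  have lim : Tendsto (fun n => d11 * (∫ x in ball xP r, p n * w n x) ^ 2
      + 2 * d12 * ((∫ x in ball xP r, p n * w n x) * (∫ x in ball xM r, p n * w n x))
        + d22 * (∫ x in ball xM r, p n * w n x) ^ 2) atTop (𝓝 (d11 * m ^ 2 + 2 * d12 * (m * (-m)) + d22 * (-m) ^ 2)) :=
    (((m1.pow 2).const_mul d11).add ((m1.mul m2).const_mul (2 * d12))).add ((m2.pow 2).const_mul d22)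
  have elim : d11 * m ^ 2 + 2 * d12 * (m * (-m)) + d22 * (-m) ^ 2 = Δ := by rw [hΔ]; ring
  rw [elim] at lim
  have ph := (p_half hptop).const_mul (volume.real Ω)
  rw [mul_zero] at ph
  obtain ⟨K, hK⟩ : ∃ K, K = (|d11| + 2 * |d12| + |d22|) * C ^ 2 + (4 * (ε * C * C) + 3 * (C * (η * Mk))) := ⟨_, rfl⟩
  have hc : 0 < m / 8 := by positivity
  have hκ : 0 < Δ / 4 := by positivity
  have ev := (hC.l1.and (hC.small r hr η hη0)).and
    ((lim.eventually (lt_mem_nhds (show Δ / 2 < Δ by linarith))).and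
      ((m1.eventually (lt_mem_nhds (show m / 2 < m by linarith))).and
        ((m2.eventually (gt_mem_nhds (show - m < - (m / 2) by linarith))).and
          ((ph.eventually (gt_mem_nhds (show 0 < m / 8 by linarith))).and
            ((hptop.eventually_ge_atTop 3).and ((hptop.eventually_ge_atTop (2 * K / (m / 8))).and
              (hptop.eventually_gt_atTop (16 * (K ^ 2 / (m / 8)) / (Δ / 4)))))))))
  obtain ⟨n, ⟨v1, v2⟩, v3, v4, v5, v6, v7, v8, v9⟩ := ev.exists
  have hp0 : 0 < p n := by linarith
  have eabs : ∀ x, |p n * w n x| = p n * |w n x| := fun x => by rw [abs_mul, abs_of_pos hp0]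
  have aA := (hwA n).pos
  have bA := (hwA n).neg.pos
  have iA := int_le_Aq hΩo hΩb (hp1 n) aA fun x => le_max_right _ _
  have iB := int_le_Aq hΩo hΩb (hp1 n) bA fun x => le_max_right _ _
  have iw := (hwA n).integrable hΩo hΩb
  have sA : ∫ x in ball xP r, w n x ≤ ∫ x, max (w n x) 0 := by
    refine (integral_mono iw.integrableOn (aA.integrable hΩo hΩb).integrableOn fun x => le_max_left _ _).trans ?_
    exact setIntegral_le_integral (aA.integrable hΩo hΩb) (Eventually.of_forall fun x => le_max_right _ _)
  have sB : - ∫ x in ball xM r, w n x ≤ ∫ x, max (- w n x) 0 := by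
    rw [← integral_neg]
    refine (integral_mono iw.neg.integrableOn (bA.integrable hΩo hΩb).integrableOn fun x => le_max_left _ _).trans ?_
    exact setIntegral_le_integral (bA.integrable hΩo hΩb) (Eventually.of_forall fun x => le_max_right _ _)
  rw [integral_const_mul] at v4 v5
  have tA := mul_le_mul_of_nonneg_left (sA.trans iA) hp0.le
  have tB := mul_le_mul_of_nonneg_left (sB.trans iB) hp0.le
  rw [mul_add] at tA tB
  have cA : m / 8 ≤ p n * Aq (1 + 1 / p n) (fun x => max (w n x) 0) := by
    linarith
  have cB : m / 8 ≤ p n * Aq (1 + 1 / p n) (fun x => max (- w n x) 0) := by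
    linarith
  have fin := final_step hΩo hΩb gd v7 (hsol n) (hleast n) (hwA n) (hA n) (hB n) (hAB n) hε0.le hη0.le hdis hdis' hP hM hMk hMk0
    (C := C) (by
      rw [le_div_iff₀ hp0, mul_comm, ← integral_const_mul]
      simpa only [eabs] using v1)
    (fun x h1 h2 => by
      rw [le_div_iff₀ hp0, mul_comm, ← eabs]; exact v2 x h1 h2) h11 h12 h22 hc hκ cA cB
    (by linarith) hK (by rw [div_le_iff₀ hc] at v8; linarith)
  rw [div_lt_iff₀ hκ] at v9
  linarith

end

/-- Corollary 1.6: the concentration points of least energy nodal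
solutions minimize the Kirchhoff–Routh function `Ψ` on `M = Ω² \ diagonal`. -/
theorem least_energy_concentrates_at_minimum
    (Ω : Set E2) (hΩo : IsOpen Ω) (hΩb : IsBounded Ω) (hΩne : Ω.Nonempty)
    (p : ℕ → ℝ) (hp1 : ∀ n, 1 < p n) (hptop : Tendsto p atTop atTop)
    (u : ℕ → E2 → ℝ)
    (hsol : ∀ n, IsSolution Ω (p n) (u n))
    (hnod : ∀ n, IsNodal Ω (u n))
    (hlow : Tendsto (fun n => p n * ∫ x in Ω, |u n x| ^ (p n + 1)) atTop
      (𝓝 (16 * π * Real.exp 1)))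
    (hleast : ∀ n, ∀ v : E2 → ℝ, IsSolution Ω (p n) v → IsNodal Ω v →
      energy Ω (p n) (u n) ≤ energy Ω (p n) v)
    (gd : GreenData Ω) (xP xM : E2) (hxP : xP ∈ Ω) (hxM : xM ∈ Ω) (hPM : xP ≠ xM)
    (hconc : TendstoC2LocOn (closure Ω \ {xP, xM})
      (fun n x => p n * u n x)
      (fun x => 8 * π * Real.sqrt (Real.exp 1) * (gd.G xP x - gd.G xM x)))
    :
    ∀ x ∈ Ω, ∀ y ∈ Ω, x ≠ y → KR gd (xP, xM) ≤ KR gd (x, y) := by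
  exact main_aux Ω hΩo hΩb p hp1 hptop u hsol (by positivity) hlow hleast gd xP xM hxP hxM hPM hconc

end
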